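/- arXiv:2007.07305 — 4 statements merged into one kernel-verified Lean document; each statement's English description precedes it below -/
import Mathlib

section
/- If C_* and D_* are two projective resolutions of the same kH-module N, then M(C_*, ∞) and M(D_*, ∞) are isomorphic in the stable module category of kG; i.e., M(C_*, ∞) ⊕ P ≅ M(D_*, ∞) ⊕ Q for some projective kG-modules P and Q. -/
open MonoidAlgebra

namespace ResMod

section Stable
variable {A : Type} [Ring A] {M N X Y : Type} [AddCommGroup M] [AddCommGroup N] [AddCommGroup X]
  [AddCommGroup Y] [Module A M] [Module A N] [Module A X] [Module A Y]

/-- A stable equivalence gives an isomorphism up to projective summands. -/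
theorem stable_iso [Module.Projective A X] [Module.Projective A Y]
    (f : M →ₗ[A] N) (g : N →ₗ[A] M)
    (a : M →ₗ[A] X) (b : X →ₗ[A] M) (c : N →ₗ[A] Y) (d : Y →ₗ[A] N)
    (h1 : ∀ m, g (f m) - m = b (a m)) (h2 : ∀ n, f (g n) - n = d (c n)) :
    ∃ (P Q : Type) (_ : AddCommGroup P) (_ : AddCommGroup Q) (_ : Module A P) (_ : Module A Q),
      Module.Projective A P ∧ Module.Projective A Q ∧ Nonempty ((M × P) ≃ₗ[A] (N × Q)) := by
  obtain ⟨F, hF⟩ : ∃ F : M × Y →ₗ[A] N, ∀ m y, F (m, y) = f m - d y :=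
    ⟨f.coprod (-d), fun m y => by simp [sub_eq_add_neg]⟩
  obtain ⟨G, hG⟩ : ∃ G : N →ₗ[A] M × Y, ∀ n, G n = (g n, c n) := ⟨g.prod c, fun n => rfl⟩
  have hFG : ∀ n, F (G n) = n := by
    intro n
    rw [hG, hF, ← h2]; abel
  obtain ⟨e, he⟩ : ∃ e : M × Y →ₗ[A] LinearMap.ker F, ∀ x, (e x).1 = x - G (F x) :=
    ⟨(LinearMap.id - G ∘ₗ F).codRestrict _ (fun x => by
      simp only [LinearMap.mem_ker, LinearMap.sub_apply, LinearMap.id_apply, LinearMap.comp_apply,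
        map_sub, hFG, sub_self]), fun x => rfl⟩
  obtain ⟨α, hα⟩ : ∃ α : M × Y →ₗ[A] X × Y × Y, ∀ m y, α (m, y) = (a m, y, y - c (F (m, y))) :=
    ⟨(a ∘ₗ LinearMap.fst A M Y).prod ((LinearMap.snd A M Y).prod
      (LinearMap.snd A M Y - c ∘ₗ F)), fun m y => rfl⟩
  obtain ⟨β, hβ⟩ : ∃ β : X × Y × Y →ₗ[A] M × Y, ∀ x y z, β (x, y, z) = (-b x + g (d y), z) :=
    ⟨((-b).coprod ((g ∘ₗ d) ∘ₗ LinearMap.fst A Y Y)).prod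
      (LinearMap.snd A Y Y ∘ₗ LinearMap.snd A X (Y × Y)), fun x y z => rfl⟩
  have hβα : ∀ x, β (α x) = x - G (F x) := by
    rintro ⟨m, y⟩
    rw [hα, hβ, hG, ← h1, hF]
    refine Prod.ext ?_ rfl
    simp only [Prod.fst_sub, LinearMap.map_sub]
    abel
  have heK : ∀ x : LinearMap.ker F, e x.1 = x := by
    intro x
    apply Subtype.ext
    rw [he, LinearMap.mem_ker.1 x.2, map_zero, sub_zero]
  have heG : ∀ n, e (G n) = 0 := by
    intro n
    apply Subtype.ext
    rw [he, hFG, sub_self]; rfl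
  have hK : Module.Projective A (LinearMap.ker F) := by
    refine Module.Projective.of_split (α ∘ₗ (LinearMap.ker F).subtype) (e ∘ₗ β) ?_
    apply LinearMap.ext
    intro x
    change e (β (α x.1)) = x
    rw [hβα, map_sub, heG, sub_zero, heK]
  refine ⟨Y, LinearMap.ker F, inferInstance, inferInstance, inferInstance, inferInstance,
    inferInstance, hK, ⟨LinearEquiv.ofLinearMap (F.prod e)
      (G.coprod (LinearMap.ker F).subtype) ?_ ?_⟩⟩
  · apply LinearMap.ext
    rintro ⟨n, x⟩
    have hx : F (x : M × Y) = 0 := LinearMap.mem_ker.1 x.2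
    change (F (G n + x.1), e (G n + x.1)) = (n, x)
    rw [map_add, map_add, hFG, heG, heK, hx, add_zero, zero_add]
  · apply LinearMap.ext
    intro x
    change G (F x) + (e x).1 = x
    rw [he]
    abel

end Stable

section Linear
variable {R A : Type} [Ring R] [Ring A] [Module R A] [IsScalarTower R A A]

/-- The properties of `Z` that are used. -/
structure GoodZ (R : Type) {A : Type} [Ring R] [Ring A] [Module R A] (p : ℕ) (Z : A) : Prop where
  comm : ∀ r : R, Z * (r • (1 : A)) = r • Z
  pow : Z ^ p = 0
  gen : Subring.closure (Set.range (fun r : R => r • (1 : A)) ∪ {Z}) = ⊤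

variable {p : ℕ} {Z : A} (hZ : GoodZ R p Z)
variable {M N : Type} [AddCommGroup M] [AddCommGroup N] [Module A M] [Module A N]
  [Module R M] [Module R N] [IsScalarTower R A M] [IsScalarTower R A N]

include hZ in
theorem GoodZ.smul_comm (r : R) (m : M) : Z • r • m = r • Z • m := by
  rw [← smul_assoc r Z m, ← hZ.comm, mul_smul, smul_assoc, one_smul]

include hZ in
theorem GoodZ.pow_smul_comm (n : ℕ) (r : R) (m : M) : Z ^ n • r • m = r • Z ^ n • m := by
  induction n with
  | zero => simp
  | succ n ih => rw [pow_succ', mul_smul, ih, hZ.smul_comm, mul_smul]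

include hZ in
theorem GoodZ.map_smul (F : M →+ N) (h1 : ∀ (r : R) m, F (r • m) = r • F m)
    (h2 : ∀ m, F (Z • m) = Z • F m) (a : A) (m : M) : F (a • m) = a • F m := by
  have ha : a ∈ Subring.closure (Set.range (fun r : R => r • (1 : A)) ∪ {Z}) := by
    rw [hZ.gen]; trivial
  induction ha using Subring.closure_induction generalizing m with
  | mem x hx =>
    rcases hx with ⟨r, rfl⟩ | rfl
    · simp only [smul_assoc, one_smul, h1]
    · exact h2 m
  | zero => simp
  | one => simp
  | add x y _ _ hx hy => simp [add_smul, hx, hy]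
  | neg x _ hx => simp [hx]
  | mul x y _ _ hx hy => simp [mul_smul, hx, hy]

/-- A-linear map from R-linear map commuting with Z. -/
def GoodZ.lin (F : M →ₗ[R] N) (h2 : ∀ m, F (Z • m) = Z • F m) : M →ₗ[A] N where
  toFun := F
  map_add' := F.map_add
  map_smul' := hZ.map_smul F.toAddMonoidHom F.map_smul h2

include hZ in
/-- Traces factor through projectives. -/
theorem GoodZ.trace [Module.Projective R M] (φ : M →ₗ[R] N) :
    ∃ (a : M →ₗ[A] (M →₀ A)) (b : (M →₀ A) →ₗ[A] N),
      ∀ m, b (a m) = ∑ i ∈ Finset.range p, Z ^ i • φ (Z ^ (p - 1 - i) • m) := by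
  obtain ⟨s, hs⟩ := (Module.projective_def' (R := R) (P := M)).1 inferInstance
  let ρ : R →ₗ[R] A := LinearMap.toSpanSingleton R A 1
  let s' : M →ₗ[R] (M →₀ A) := Finsupp.mapRange.linearMap ρ ∘ₗ s
  let b : (M →₀ A) →ₗ[A] N := Finsupp.linearCombination A (fun m => φ m)
  have hb : ∀ m, b (s' m) = φ m := by
    intro m
    have : ∀ u : M →₀ R, b (Finsupp.mapRange.linearMap ρ u) =
        φ (Finsupp.linearCombination R id u) := by
      intro u
      induction u using Finsupp.induction_linear with
      | zero => simp
      | add u v hu hv => simp only [map_add, hu, hv]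
      | single x r => simp [b, ρ]
    have h3 := this (s m)
    rw [show Finsupp.linearCombination R id (s m) = m from LinearMap.congr_fun hs m] at h3
    exact h3
  let α₀ : M →ₗ[R] (M →₀ A) :=
    { toFun := fun m => ∑ i ∈ Finset.range p, Z ^ i • s' (Z ^ (p - 1 - i) • m)
      map_add' := by intro x y; simp [Finset.sum_add_distrib]
      map_smul' := by
        intro r x
        rw [RingHom.id_apply, Finset.smul_sum]
        refine Finset.sum_congr rfl fun i _ => ?_
        rw [hZ.pow_smul_comm, s'.map_smul, hZ.pow_smul_comm] }
  have hα₀ : ∀ m, α₀ m = ∑ i ∈ Finset.range p, Z ^ i • s' (Z ^ (p - 1 - i) • m) := fun _ => rfl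
  have hc : ∀ m, α₀ (Z • m) = Z • α₀ m := by
    intro m
    let T : ℕ → (M →₀ A) := fun i => Z ^ i • s' (Z ^ (p - i) • m)
    have e1 : α₀ (Z • m) = ∑ i ∈ Finset.range p, T i := by
      rw [hα₀]
      refine Finset.sum_congr rfl fun i hi => ?_
      have := Finset.mem_range.1 hi
      simp only [T]
      rw [← mul_smul, ← pow_succ, show p - 1 - i + 1 = p - i by omega]
    have e2 : Z • α₀ m = ∑ i ∈ Finset.range p, T (i + 1) := by
      rw [hα₀, Finset.smul_sum]
      refine Finset.sum_congr rfl fun i hi => ?_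
      simp only [T]
      rw [← mul_smul, ← pow_succ', show p - (i + 1) = p - 1 - i by omega]
    have t0 : T 0 = 0 := by simp [T, hZ.pow]
    have tp : T p = 0 := by simp [T, hZ.pow]
    have h3 := Finset.sum_range_succ T p
    have h4 := Finset.sum_range_succ' T p
    rw [e1, e2]
    rw [h3, t0, tp] at h4
    simpa using h4
  refine ⟨hZ.lin α₀ hc, b, fun m => ?_⟩
  change b (α₀ m) = _
  rw [hα₀, map_sum]
  refine Finset.sum_congr rfl fun i _ => ?_
  rw [LinearMap.map_smul, hb]

end Linear

section Complex
variable {R : Type} [Ring R] 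

theorem lift {P X Y : Type} [AddCommGroup P] [AddCommGroup X] [AddCommGroup Y] [Module R P]
    [Module R X] [Module R Y] [Module.Projective R P] (g : X →ₗ[R] Y) (φ : P →ₗ[R] Y)
    (h : ∀ x, φ x ∈ LinearMap.range g) : ∃ ψ : P →ₗ[R] X, ∀ x, g (ψ x) = φ x := by
  obtain ⟨ψ, hψ⟩ := Module.projective_lifting_property g.rangeRestrict (φ.codRestrict _ h)
    g.surjective_rangeRestrict
  exact ⟨ψ, fun x => congrArg Subtype.val (LinearMap.congr_fun hψ x)⟩

theorem exists_seq {S : ℕ → Type} (r : ∀ n, S n → S (n + 1) → Prop) (s0 : S 0)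
    (h : ∀ n s, ∃ s', r n s s') : ∃ f : ∀ n, S n, f 0 = s0 ∧ ∀ n, r n (f n) (f (n + 1)) := by
  choose g hg using h
  exact ⟨fun n => Nat.rec s0 (fun n s => g n s) n, rfl, fun n => hg n _⟩

variable {N : Type} [AddCommGroup N] [Module R N] {C D : ℕ → Type}
    [∀ i, AddCommGroup (C i)] [∀ i, Module R (C i)]
    [∀ i, AddCommGroup (D i)] [∀ i, Module R (D i)]

/-- Projective resolution -/
structure IsRes (d : ∀ i, C (i + 1) →ₗ[R] C i) (ε : C 0 →ₗ[R] N) : Prop where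
  proj : ∀ i, Module.Projective R (C i)
  surj : Function.Surjective ε
  ex0 : LinearMap.range (d 0) = LinearMap.ker ε
  ex : ∀ i, LinearMap.range (d (i + 1)) = LinearMap.ker (d i)

variable {dC : ∀ i, C (i + 1) →ₗ[R] C i} {dD : ∀ i, D (i + 1) →ₗ[R] D i}
  {εC : C 0 →ₗ[R] N} {εD : D 0 →ₗ[R] N}

theorem IsRes.dd (hC : IsRes dC εC) (i : ℕ) (x) : dC i (dC (i + 1) x) = 0 := by
  have : dC (i + 1) x ∈ LinearMap.ker (dC i) := by rw [← hC.ex]; exact ⟨x, rfl⟩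
  exact this

theorem IsRes.εd (hC : IsRes dC εC) (x) : εC (dC 0 x) = 0 := by
  have : dC 0 x ∈ LinearMap.ker εC := by rw [← hC.ex0]; exact ⟨x, rfl⟩
  exact this

theorem chainMap (hC : IsRes dC εC) (hD : IsRes dD εD) :
    ∃ f : ∀ n, C n →ₗ[R] D n, (∀ x, εD (f 0 x) = εC x) ∧
      ∀ n x, dD n (f (n + 1) x) = f n (dC n x) := by
  have := hC.proj
  let S : ℕ → Type := fun n => {f : C n →ₗ[R] D n // ∀ x, f (dC n x) ∈ LinearMap.range (dD n)}
  obtain ⟨f0, hf0⟩ := lift εD εC (fun x => hD.surj _)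
  obtain ⟨f, h0, hf⟩ := exists_seq (S := S)
    (fun n f f' => ∀ x, dD n (f'.1 x) = f.1 (dC n x))
    ⟨f0, fun x => by rw [hD.ex0, LinearMap.mem_ker, hf0, hC.εd]⟩ (by
      rintro n ⟨f, hf⟩
      obtain ⟨f', hf'⟩ := lift (dD n) (f ∘ₗ dC n) hf
      refine ⟨⟨f', fun x => ?_⟩, hf'⟩
      rw [hD.ex, LinearMap.mem_ker, hf', LinearMap.comp_apply, hC.dd, map_zero])
  exact ⟨fun n => (f n).1, by simpa [h0] using hf0, hf⟩

theorem homotopy (hC : IsRes dC εC) (hD : IsRes dD εD) (u : ∀ n, C n →ₗ[R] D n)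
    (hu0 : ∀ x, εD (u 0 x) = 0) (hu : ∀ n x, dD n (u (n + 1) x) = u n (dC n x)) :
    ∃ h : ∀ n, C n →ₗ[R] D (n + 1), (∀ x, dD 0 (h 0 x) = u 0 x) ∧
      ∀ n x, dD (n + 1) (h (n + 1) x) + h n (dC n x) = u (n + 1) x := by
  have := hC.proj
  let S : ℕ → Type := fun n => {h : C n →ₗ[R] D (n + 1) //
    ∀ x, dD n (h (dC n x)) = u n (dC n x)}
  obtain ⟨h0, hh0⟩ := lift (dD 0) (u 0) (fun x => by rw [hD.ex0]; exact hu0 x)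
  obtain ⟨h, h0', hh⟩ := exists_seq (S := S)
    (fun n h h' => ∀ x, dD (n + 1) (h'.1 x) + h.1 (dC n x) = u (n + 1) x)
    ⟨h0, fun x => hh0 _⟩ (by
      rintro n ⟨h, hh⟩
      obtain ⟨h', hh'⟩ := lift (dD (n + 1)) (u (n + 1) - h ∘ₗ dC n) (fun x => by
        rw [hD.ex, LinearMap.mem_ker]
        simp [hu, hh])
      refine ⟨⟨h', fun x => ?_⟩, fun x => ?_⟩
      · rw [hh']; simp [hC.dd]
      · rw [hh']; simp)
  exact ⟨fun n => (h n).1, by simpa [h0'] using hh0, hh⟩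

end Complex

section RM
variable {R A : Type} [Ring R] [Ring A] [Module R A] [IsScalarTower R A A]
  {N : Type} [AddCommGroup N] [Module R N] {C D : ℕ → Type}
    [∀ i, AddCommGroup (C i)] [∀ i, Module R (C i)]
    [∀ i, AddCommGroup (D i)] [∀ i, Module R (D i)]
  {MC MD : Type} [AddCommGroup MC] [AddCommGroup MD] [Module A MC] [Module A MD]
  [Module R MC] [Module R MD] [IsScalarTower R A MC] [IsScalarTower R A MD]

/-- The module `M` is `M(C, ∞)` -/
structure IsRM (p : ℕ) (hp : 2 ≤ p) (Z : A) (dC : ∀ i, C (i + 1) →ₗ[R] C i)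
    (e : ∀ j, C (2 * j) →ₗ[R] MC) (o : ∀ j, Fin (p - 1) → (C (2 * j + 1) →ₗ[R] MC)) : Prop where
  bij : Function.Bijective
      (DirectSum.toModule R ℕ MC
        (fun j => LinearMap.coprod (e j)
          (LinearMap.lsum R
            (fun _ : Fin (p - 1) => C (2 * j + 1)) ℕ (fun t => o j t))))
  z0 : ∀ m : C (2 * 0), Z • e 0 m = 0
  ze : ∀ (j : ℕ) (m : C (2 * (j + 1))),
      Z • e (j + 1) m = o j ⟨0, by omega⟩ (dC (2 * j + 1) m)
  zo : ∀ (j : ℕ) (t : Fin (p - 1)) (ht : (t : ℕ) + 1 < p - 1) (m : C (2 * j + 1)),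
      Z • o j t m = o j ⟨(t : ℕ) + 1, ht⟩ m
  zl : ∀ (j : ℕ) (hl : p - 2 < p - 1) (m : C (2 * j + 1)),
      Z • o j ⟨p - 2, hl⟩ m = e j (dC (2 * j) m)

variable {p : ℕ} {hp : 2 ≤ p} {Z : A}
  {dC : ∀ i, C (i + 1) →ₗ[R] C i} {dD : ∀ i, D (i + 1) →ₗ[R] D i}
  {εC : C 0 →ₗ[R] N} {εD : D 0 →ₗ[R] N}
  {e : ∀ j, C (2 * j) →ₗ[R] MC} {o : ∀ j, Fin (p - 1) → (C (2 * j + 1) →ₗ[R] MC)}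
  {e' : ∀ j, D (2 * j) →ₗ[R] MD} {o' : ∀ j, Fin (p - 1) → (D (2 * j + 1) →ₗ[R] MD)}

omit [IsScalarTower R A A] [IsScalarTower R A MC] in
theorem IsRM.proj (h : IsRM p hp Z dC e o) (hC : ∀ i, Module.Projective R (C i)) :
    Module.Projective R MC := by
  have h1 : ∀ j, Module.Projective R (Fin (p - 1) → C (2 * j + 1)) := fun j =>
    Module.Projective.of_equiv
      (DirectSum.linearEquivFunOnFintype R (Fin (p - 1)) (fun _ => C (2 * j + 1)) :
        (Π₀ _ : Fin (p - 1), C (2 * j + 1)) ≃ₗ[R] _)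
  have h2 : Module.Projective R
      (DirectSum ℕ fun i => C (2 * i) × (Fin (p - 1) → C (2 * i + 1))) :=
    inferInstanceAs (Module.Projective R (Π₀ i, C (2 * i) × (Fin (p - 1) → C (2 * i + 1))))
  exact Module.Projective.of_equiv (LinearEquiv.ofBijective _ h.bij)

omit [IsScalarTower R A A] [IsScalarTower R A MC] in
theorem IsRM.ind (h : IsRM p hp Z dC e o) {F G : MC →+ MD}
    (h1 : ∀ j m, F (e j m) = G (e j m)) (h2 : ∀ j t m, F (o j t m) = G (o j t m)) (x : MC) :
    F x = G x := by
  obtain ⟨y, rfl⟩ := h.bij.2 x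
  induction y using DirectSum.induction_on with
  | zero => simp
  | add x y hx hy => simp only [map_add, hx, hy]
  | of j x =>
    have : (DirectSum.of (fun j => C (2 * j) × (Fin (p - 1) → C (2 * j + 1))) j x) =
      DirectSum.lof R ℕ (fun j => C (2 * j) × (Fin (p - 1) → C (2 * j + 1))) j x := rfl
    rw [this, DirectSum.toModule_lof]
    simp only [LinearMap.coprod_apply, map_add, h1, LinearMap.lsum_apply, LinearMap.sum_apply,
      map_sum, LinearMap.comp_apply, h2]

omit [IsScalarTower R A A] [IsScalarTower R A MC] in
theorem IsRM.desc (h : IsRM p hp Z dC e o) (a : ∀ j, C (2 * j) →ₗ[R] MD)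
    (b : ∀ j, Fin (p - 1) → (C (2 * j + 1) →ₗ[R] MD)) :
    ∃ F : MC →ₗ[R] MD, (∀ j m, F (e j m) = a j m) ∧ ∀ j t m, F (o j t m) = b j t m := by
  let E := LinearEquiv.ofBijective _ h.bij
  let L := DirectSum.toModule R ℕ MD
        (fun j => LinearMap.coprod (a j)
          (LinearMap.lsum R
            (fun _ : Fin (p - 1) => C (2 * j + 1)) ℕ (fun t => b j t)))
  have hE : ∀ j x, E (DirectSum.lof R ℕ
      (fun j => C (2 * j) × (Fin (p - 1) → C (2 * j + 1))) j x) =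
      e j x.1 + ∑ t, o j t (x.2 t) := by
    intro j x
    simp [E]
  have hL : ∀ j x, L (DirectSum.lof R ℕ
      (fun j => C (2 * j) × (Fin (p - 1) → C (2 * j + 1))) j x) =
      a j x.1 + ∑ t, b j t (x.2 t) := by
    intro j x
    simp [L]
  refine ⟨L ∘ₗ E.symm.toLinearMap, fun j m => ?_, fun j t m => ?_⟩
  · have h1 : e j m = E (DirectSum.lof R ℕ
      (fun j => C (2 * j) × (Fin (p - 1) → C (2 * j + 1))) j (m, 0)) := by rw [hE]; simp
    rw [h1, LinearMap.comp_apply, LinearEquiv.coe_coe, E.symm_apply_apply, hL]; simp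
  · have key : ∀ (f : Fin (p - 1) → (C (2 * j + 1) →ₗ[R] MC)),
        ∑ s, f s ((Pi.single t m : Fin (p - 1) → C (2 * j + 1)) s) = f t m := by
      intro f
      rw [Finset.sum_eq_single t]
      · simp
      · intro s _ hs; simp [Pi.single_eq_of_ne hs]
      · simp
    have key' : ∀ (f : Fin (p - 1) → (C (2 * j + 1) →ₗ[R] MD)),
        ∑ s, f s ((Pi.single t m : Fin (p - 1) → C (2 * j + 1)) s) = f t m := by
      intro f
      rw [Finset.sum_eq_single t]
      · simp
      · intro s _ hs; simp [Pi.single_eq_of_ne hs]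
      · simp
    have h1 : o j t m = E (DirectSum.lof R ℕ
      (fun j => C (2 * j) × (Fin (p - 1) → C (2 * j + 1))) j (0, Pi.single t m)) := by
      rw [hE, key]; simp
    rw [h1, LinearMap.comp_apply, LinearEquiv.coe_coe, E.symm_apply_apply, hL, key']; simp

/-- functoriality -/
theorem IsRM.map (hZ : GoodZ R p Z) (h : IsRM p hp Z dC e o) (h' : IsRM p hp Z dD e' o')
    (f : ∀ n, C n →ₗ[R] D n) (hf : ∀ n x, dD n (f (n + 1) x) = f n (dC n x)) :
    ∃ F : MC →ₗ[A] MD, (∀ j m, F (e j m) = e' j (f _ m)) ∧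
      ∀ j t m, F (o j t m) = o' j t (f _ m) := by
  obtain ⟨F, h1, h2⟩ := h.desc (fun j => e' j ∘ₗ f _) (fun j t => o' j t ∘ₗ f _)
  simp only [LinearMap.comp_apply] at h1 h2
  have hc : ∀ m, F (Z • m) = Z • F m := by
    refine h.ind (F := F.toAddMonoidHom.comp (DistribSMul.toAddMonoidHom MC Z))
      (G := (DistribSMul.toAddMonoidHom MD Z).comp F.toAddMonoidHom) ?_ ?_
    · intro j m
      change F (Z • e j m) = Z • F (e j m)
      rw [h1]
      cases j with
      | zero => rw [h.z0, map_zero]; exact (h'.z0 _).symm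
      | succ j =>
        rw [h.ze, h2, ← hf]
        exact (h'.ze j _).symm
    · intro j t m
      change F (Z • o j t m) = Z • F (o j t m)
      rw [h2]
      by_cases ht : (t : ℕ) + 1 < p - 1
      · rw [h.zo j t ht, h2, h'.zo j t ht]
      · obtain ⟨t, htp⟩ := t
        obtain rfl : t = p - 2 := by simp at ht; omega
        rw [h.zl, h1, h'.zl, hf]
  exact ⟨hZ.lin F hc, h1, h2⟩

omit [Module R A] [IsScalarTower R A A] [IsScalarTower R A MC] in
theorem IsRM.pow_o (h : IsRM p hp Z dC e o) (j : ℕ) (t : Fin (p - 1)) (s : ℕ)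
    (hs : (t : ℕ) + s < p - 1) (m) : Z ^ s • o j t m = o j ⟨t + s, hs⟩ m := by
  induction s with
  | zero => simp
  | succ s ih => 
    rw [pow_succ', mul_smul, ih (by omega), h.zo j ⟨t + s, by omega⟩ (by simp; omega)]
    rfl

omit [Module R A] [IsScalarTower R A A] [IsScalarTower R A MC] in
theorem IsRM.pow_o_last (h : IsRM p hp Z dC e o) (j : ℕ) (t : Fin (p - 1)) (m) :
    Z ^ (p - 1 - t) • o j t m = e j (dC _ m) := by
  have := t.2
  rw [show p - 1 - t = (p - 2 - t) + 1 by omega, pow_succ', mul_smul,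
    h.pow_o j t _ (by omega) m, ← h.zl j (by omega)]
  congr 3
  ext; simp; omega

omit [Module R A] [IsScalarTower R A A] [IsScalarTower R A MC] in
theorem IsRM.z_ed (h : IsRM p hp Z dC e o) (hC : IsRes dC εC) (j : ℕ) (m) :
    Z • e j (dC (2 * j) m) = 0 := by
  cases j with
  | zero => exact h.z0 _
  | succ j =>
    have h1 := hC.dd (2 * j + 1) m
    exact (h.ze j _).trans ((congrArg _ h1).trans (map_zero _))

omit [Module R A] [IsScalarTower R A A] [IsScalarTower R A MC] in
theorem IsRM.pow_o_big (h : IsRM p hp Z dC e o) (hC : IsRes dC εC) (j : ℕ) (t : Fin (p - 1))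
    (s : ℕ) (hs : p - 1 < t + s) (m) :
    Z ^ s • o j t m = 0 := by
  have := t.2
  obtain ⟨c, rfl⟩ : ∃ c, s = c + 1 + (p - 1 - t) := ⟨s - (p - 1 - t) - 1, by omega⟩
  rw [pow_add, mul_smul, h.pow_o_last, pow_succ, mul_smul, h.z_ed hC, smul_zero]

/-- null-homotopic maps are traces -/
theorem IsRM.null (hZ : GoodZ R p Z) (h : IsRM p hp Z dC e o) (h' : IsRM p hp Z dD e' o')
    (hC : IsRes dC εC) (hD : IsRes dD εD)
    (u : ∀ n, C n →ₗ[R] D n) (hu0 : ∀ x, εD (u 0 x) = 0)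
    (hu : ∀ n x, dD n (u (n + 1) x) = u n (dC n x))
    (F : MC →ₗ[A] MD) (hF1 : ∀ j m, F (e j m) = e' j (u _ m))
    (hF2 : ∀ j t m, F (o j t m) = o' j t (u _ m)) :
    ∃ (a : MC →ₗ[A] (MC →₀ A)) (b : (MC →₀ A) →ₗ[A] MD), ∀ m, F m = b (a m) := by
  obtain ⟨k, hk0, hk⟩ := homotopy hC hD u hu0 hu
  have hP := h.proj hC.proj
  obtain ⟨φ, h1, h2⟩ := h.desc (MD := MD) (fun j => o' j ⟨0, by omega⟩ ∘ₗ k (2 * j))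
    (fun j t => if (t : ℕ) = p - 2 then e' (j + 1) ∘ₗ k (2 * j + 1) else 0)
  simp only [LinearMap.comp_apply] at h1
  have h2l : ∀ j (t : Fin (p - 1)) m, (t : ℕ) = p - 2 → φ (o j t m) = e' (j + 1) (k (2 * j + 1) m) := by
    intro j t m ht
    rw [h2, if_pos ht]; rfl
  have h2z : ∀ j (t : Fin (p - 1)) m, (t : ℕ) ≠ p - 2 → φ (o j t m) = 0 := by
    intro j t m ht
    rw [h2, if_neg ht]; rfl
  obtain ⟨a, b, hab⟩ := hZ.trace φ
  have hpl : ∀ j m, Z ^ (p - 1) • o' j ⟨0, by omega⟩ m = e' j (dD _ m) := fun j m =>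
    h'.pow_o_last j ⟨0, by omega⟩ m
  refine ⟨a, b, h.ind (F := F.toAddMonoidHom) (G := (b ∘ₗ a).toAddMonoidHom) ?_ ?_⟩
  · intro j m
    change F (e j m) = b (a (e j m))
    rw [hF1, hab]
    cases j with
    | zero =>
      rw [Finset.sum_eq_single (p - 1)]
      · rw [Nat.sub_self, pow_zero, one_smul, h1, hpl]
        exact congrArg _ (hk0 m).symm
      · intro i hi hne
        have := Finset.mem_range.1 hi
        rw [show p - 1 - i = (p - 2 - i) + 1 by omega, pow_succ, mul_smul, h.z0]
        simp
      · intro hh; exact absurd (Finset.mem_range.2 (by omega)) hh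
    | succ j =>
      rw [Finset.sum_eq_add_of_mem (p - 1) 0 (Finset.mem_range.2 (by omega))
        (Finset.mem_range.2 (by omega)) (by omega)]
      · rw [Nat.sub_self, pow_zero, one_smul, h1, hpl, one_smul, Nat.sub_zero,
          show p - 1 = (p - 2) + 1 by omega, pow_succ, mul_smul, h.ze,
          h.pow_o j _ _ (by simp; omega), h2l _ _ _ (by simp), ← map_add]
        exact congrArg _ (hk (2 * j + 1) m).symm
      · intro i hi hne
        have := Finset.mem_range.1 hi
        rw [show p - 1 - i = (p - 2 - i) + 1 by omega, pow_succ, mul_smul, h.ze,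
          h.pow_o j _ _ (by simp; omega), h2z _ _ _ (by simp; omega), smul_zero]
  · intro j t m
    have ht := t.2
    change F (o j t m) = b (a (o j t m))
    rw [hF2, hab]
    rw [Finset.sum_eq_add_of_mem ((t : ℕ) + 1) (t : ℕ) (Finset.mem_range.2 (by omega))
        (Finset.mem_range.2 (by omega)) (by omega)]
    · rw [h.pow_o_last, h1, h'.pow_o _ _ _ (by simp), h.pow_o _ _ _ (by omega),
        h2l _ _ _ (by simp; omega), pow_succ, mul_smul, h'.ze, h'.pow_o _ _ _ (by simp),
        ← hk (2 * j) m, map_add]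
      simp
    · intro i hi hne
      have := Finset.mem_range.1 hi
      by_cases hi' : i < t
      · rw [h.pow_o_big hC _ _ _ (by omega)]; simp
      · rw [h.pow_o _ _ _ (by omega), h2z _ _ _ (by simp; omega), smul_zero]

theorem main (hZ : GoodZ R p Z) (h : IsRM p hp Z dC e o) (h' : IsRM p hp Z dD e' o')
    (hC : IsRes dC εC) (hD : IsRes dD εD) :
    ∃ (P Q : Type) (_ : AddCommGroup P) (_ : AddCommGroup Q) (_ : Module A P) (_ : Module A Q),
      Module.Projective A P ∧ Module.Projective A Q ∧ Nonempty ((MC × P) ≃ₗ[A] (MD × Q)) := by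
  obtain ⟨f, f0, hf⟩ := chainMap hC hD
  obtain ⟨g, g0, hg⟩ := chainMap hD hC
  obtain ⟨F, F1, F2⟩ := h.map hZ h' f hf
  obtain ⟨G, G1, G2⟩ := h'.map hZ h g hg
  obtain ⟨a, b, hab⟩ := h.null hZ h hC hC (fun n => g n ∘ₗ f n - LinearMap.id)
    (by intro x; simp [g0, f0]) (by intro n x; simp [hg, hf]) (G ∘ₗ F - LinearMap.id)
    (by intro j m; simp [F1, G1]) (by intro j t m; simp [F2, G2])
  obtain ⟨c, d, hcd⟩ := h'.null hZ h' hD hD (fun n => f n ∘ₗ g n - LinearMap.id)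
    (by intro x; simp [g0, f0]) (by intro n x; simp [hg, hf]) (F ∘ₗ G - LinearMap.id)
    (by intro j m; simp [F1, G1]) (by intro j t m; simp [F2, G2])
  exact stable_iso F G a b c d hab hcd

end RM

theorem goodZ (k : Type) [Field k] (p : ℕ) (hp : p.Prime) [CharP k p] (H : Type) [Group H]
    (Z : MonoidAlgebra (MonoidAlgebra k H) (Multiplicative (ZMod p)))
    (hZ : Z = MonoidAlgebra.single (Multiplicative.ofAdd (1 : ZMod p))
      (1 : MonoidAlgebra k H) - 1) : GoodZ (MonoidAlgebra k H) p Z := by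
  have := Fact.mk hp
  have hch : CharP (MonoidAlgebra (MonoidAlgebra k H) (Multiplicative (ZMod p))) p :=
    charP_of_injective_algebraMap (R := k) (algebraMap k _).injective p
  have h1 : (1 : MonoidAlgebra (MonoidAlgebra k H) (Multiplicative (ZMod p))) =
    MonoidAlgebra.single 1 (1 : MonoidAlgebra k H) := MonoidAlgebra.one_def
  refine ⟨fun r => ?_, ?_, ?_⟩
  · rw [hZ, sub_mul, smul_sub, one_mul, h1, MonoidAlgebra.smul_single,
      MonoidAlgebra.smul_single, MonoidAlgebra.single_mul_single]
    simp
  · rw [hZ, sub_pow_char_of_commute p (Commute.one_right _), one_pow, MonoidAlgebra.single_pow,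
      ← ofAdd_nsmul, one_pow, h1, sub_eq_zero]
    simp
  · rw [eq_top_iff]
    rintro x -
    have hg : MonoidAlgebra.single (Multiplicative.ofAdd (1 : ZMod p)) (1 : MonoidAlgebra k H) ∈
        Subring.closure (Set.range (fun r : MonoidAlgebra k H =>
          r • (1 : MonoidAlgebra (MonoidAlgebra k H) (Multiplicative (ZMod p)))) ∪ {Z}) := by
      have : MonoidAlgebra.single (Multiplicative.ofAdd (1 : ZMod p)) (1 : MonoidAlgebra k H)
        = Z + 1 := by rw [hZ]; simp
      rw [this]
      exact add_mem (Subring.subset_closure (Or.inr rfl)) (one_mem _)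
    have hs : ∀ (g : Multiplicative (ZMod p)) (r : MonoidAlgebra k H), MonoidAlgebra.single g r ∈
        Subring.closure (Set.range (fun r : MonoidAlgebra k H =>
          r • (1 : MonoidAlgebra (MonoidAlgebra k H) (Multiplicative (ZMod p)))) ∪ {Z}) := by
      intro g r
      have h5 : MonoidAlgebra.single g r = (r • (1 : MonoidAlgebra (MonoidAlgebra k H)
          (Multiplicative (ZMod p)))) * (MonoidAlgebra.single (Multiplicative.ofAdd (1 : ZMod p))
            (1 : MonoidAlgebra k H)) ^ (Multiplicative.toAdd g).val := by
        rw [MonoidAlgebra.single_pow, ← ofAdd_nsmul, h1,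
          MonoidAlgebra.smul_single, MonoidAlgebra.single_mul_single]
        simp
      rw [h5]
      exact mul_mem (Subring.subset_closure (Or.inl ⟨r, rfl⟩)) (pow_mem hg _)
    induction x using MonoidAlgebra.induction_linear with
    | zero => exact zero_mem _
    | add x y hx hy => exact add_mem hx hy
    | single g r => exact hs g r

end ResMod

/-- If `C_*` and `D_*` are two projective resolutions of the same
`kH`-module `N`, then `M(C_*, ∞)` and `M(D_*, ∞)` are isomorphic in the stable
module category of `kG` (`kG = kH ⊗ k[Z]/(Z^p)`), i.e.
`M(C_*, ∞) ⊕ P ≅ M(D_*, ∞) ⊕ Q` for some projective `kG`-modules `P` and `Q`. -/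
theorem resolution_module_independent_of_resolution
    (k : Type) [Field k] (p : ℕ) (hp : p.Prime) [CharP k p]
    (H : Type) [Group H] [Finite H]
    (N : Type) [AddCommGroup N] [Module (MonoidAlgebra k H) N]
    (C D : ℕ → Type) [∀ i, AddCommGroup (C i)] [∀ i, Module (MonoidAlgebra k H) (C i)]
    [∀ i, AddCommGroup (D i)] [∀ i, Module (MonoidAlgebra k H) (D i)]
    (dC : ∀ i, C (i + 1) →ₗ[MonoidAlgebra k H] C i)
    (dD : ∀ i, D (i + 1) →ₗ[MonoidAlgebra k H] D i)
    -- `C_*` is a projective resolution of `N`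
    (hprojC : ∀ i, Module.Projective (MonoidAlgebra k H) (C i))
    (εC : C 0 →ₗ[MonoidAlgebra k H] N)
    (hsurjC : Function.Surjective εC)
    (hexactC0 : LinearMap.range (dC 0) = LinearMap.ker εC)
    (hexactC : ∀ i, LinearMap.range (dC (i + 1)) = LinearMap.ker (dC i))
    -- `D_*` is a projective resolution of `N`
    (hprojD : ∀ i, Module.Projective (MonoidAlgebra k H) (D i))
    (εD : D 0 →ₗ[MonoidAlgebra k H] N)
    (hsurjD : Function.Surjective εD)
    (hexactD0 : LinearMap.range (dD 0) = LinearMap.ker εD)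
    (hexactD : ∀ i, LinearMap.range (dD (i + 1)) = LinearMap.ker (dD i))
    (Z : MonoidAlgebra (MonoidAlgebra k H) (Multiplicative (ZMod p)))
    (hZ : Z = MonoidAlgebra.single (Multiplicative.ofAdd (1 : ZMod p))
      (1 : MonoidAlgebra k H) - 1)
    -- `MC = M(C_*, ∞)`
    (MC : Type) [AddCommGroup MC]
    [Module (MonoidAlgebra (MonoidAlgebra k H) (Multiplicative (ZMod p))) MC]
    [Module (MonoidAlgebra k H) MC]
    [IsScalarTower (MonoidAlgebra k H)
      (MonoidAlgebra (MonoidAlgebra k H) (Multiplicative (ZMod p))) MC]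
    (ιe : (j : ℕ) → (C (2 * j) →ₗ[MonoidAlgebra k H] MC))
    (ιo : (j : ℕ) → Fin (p - 1) → (C (2 * j + 1) →ₗ[MonoidAlgebra k H] MC))
    (hdecompC : Function.Bijective
      (DirectSum.toModule (MonoidAlgebra k H) ℕ MC
        (fun j => LinearMap.coprod (ιe j)
          (LinearMap.lsum (MonoidAlgebra k H)
            (fun _ : Fin (p - 1) => C (2 * j + 1)) ℕ (fun t => ιo j t)))))
    (hZ0C : ∀ m : C (2 * 0), Z • ιe 0 m = 0)
    (hZeC : ∀ (j : ℕ) (m : C (2 * (j + 1))),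
      Z • ιe (j + 1) m = ιo j ⟨0, by have := hp.two_le; omega⟩ (dC (2 * j + 1) m))
    (hZoC : ∀ (j : ℕ) (t : Fin (p - 1)) (ht : (t : ℕ) + 1 < p - 1) (m : C (2 * j + 1)),
      Z • ιo j t m = ιo j ⟨(t : ℕ) + 1, ht⟩ m)
    (hZlastC : ∀ (j : ℕ) (hl : p - 2 < p - 1) (m : C (2 * j + 1)),
      Z • ιo j ⟨p - 2, hl⟩ m = ιe j (dC (2 * j) m))
    -- `MD = M(D_*, ∞)`
    (MD : Type) [AddCommGroup MD]
    [Module (MonoidAlgebra (MonoidAlgebra k H) (Multiplicative (ZMod p))) MD]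
    [Module (MonoidAlgebra k H) MD]
    [IsScalarTower (MonoidAlgebra k H)
      (MonoidAlgebra (MonoidAlgebra k H) (Multiplicative (ZMod p))) MD]
    (κe : (j : ℕ) → (D (2 * j) →ₗ[MonoidAlgebra k H] MD))
    (κo : (j : ℕ) → Fin (p - 1) → (D (2 * j + 1) →ₗ[MonoidAlgebra k H] MD))
    (hdecompD : Function.Bijective
      (DirectSum.toModule (MonoidAlgebra k H) ℕ MD
        (fun j => LinearMap.coprod (κe j)
          (LinearMap.lsum (MonoidAlgebra k H)
            (fun _ : Fin (p - 1) => D (2 * j + 1)) ℕ (fun t => κo j t)))))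
    (hZ0D : ∀ m : D (2 * 0), Z • κe 0 m = 0)
    (hZeD : ∀ (j : ℕ) (m : D (2 * (j + 1))),
      Z • κe (j + 1) m = κo j ⟨0, by have := hp.two_le; omega⟩ (dD (2 * j + 1) m))
    (hZoD : ∀ (j : ℕ) (t : Fin (p - 1)) (ht : (t : ℕ) + 1 < p - 1) (m : D (2 * j + 1)),
      Z • κo j t m = κo j ⟨(t : ℕ) + 1, ht⟩ m)
    (hZlastD : ∀ (j : ℕ) (hl : p - 2 < p - 1) (m : D (2 * j + 1)),
      Z • κo j ⟨p - 2, hl⟩ m = κe j (dD (2 * j) m)) :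
    ∃ (P Q : Type) (_ : AddCommGroup P) (_ : AddCommGroup Q)
      (_ : Module (MonoidAlgebra (MonoidAlgebra k H) (Multiplicative (ZMod p))) P)
      (_ : Module (MonoidAlgebra (MonoidAlgebra k H) (Multiplicative (ZMod p))) Q),
      Module.Projective (MonoidAlgebra (MonoidAlgebra k H) (Multiplicative (ZMod p))) P ∧
      Module.Projective (MonoidAlgebra (MonoidAlgebra k H) (Multiplicative (ZMod p))) Q ∧
      Nonempty ((MC × P) ≃ₗ[MonoidAlgebra (MonoidAlgebra k H) (Multiplicative (ZMod p))]
        (MD × Q)) := by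
  exact ResMod.main (hp := hp.two_le) (ResMod.goodZ k p hp H Z hZ)
    ⟨hdecompC, hZ0C, hZeC, hZoC, hZlastC⟩ ⟨hdecompD, hZ0D, hZeD, hZoD, hZlastD⟩
    ⟨hprojC, hsurjC, hexactC0, hexactC⟩ ⟨hprojD, hsurjD, hexactD0, hexactD⟩
end

section
/- Let P_* be a projective resolution of the trivial kH-module k, and define N(P_*, n) to be the kG-module whose underlying kH-module is k ⊕ P_0^{p-1} ⊕ P_1 ⊕ P_2^{p-1} ⊕ ⋯ ⊕ P_{2n-1}, with Z-action: Z annihilates the summand k; for (m_1,…,m_{p-1}) ∈ P_0^{p-1}, Z·(m_1,…,m_{p-1}) = −ε(m_{p-1}) + (0, m_1,…,m_{p-2}); for (m_1,…,m_{p-1}) ∈ P_{2i}^{p-1} with i > 0, Z·(m_1,…,m_{p-1}) = −∂(m_{p-1}) + (0, m_1,…,m_{p-2}); and for m ∈ P_{2i-1}, Z·m = −(∂m, 0,…,0) ∈ P_{2i-2}^{p-1}. Then there is a projective kG-module Q and a short exact sequence of kG-modules 0 → M(P_*, n) →^θ k ⊕ Q →^μ N(P_*, n) → 0. -/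
open MonoidAlgebra

namespace ResMod

/-- drop the last entry of a tuple -/
def dropLast {X : Type} {q : ℕ} (f : Fin (q + 1) → X) : Fin q → X := fun t => f t.castSucc

lemma add_one_pow {S : Type} [Ring S] {p : ℕ} (hp : p.Prime) (h0 : (p : S) = 0) (x : S) :
    (x + 1) ^ p = x ^ p + 1 := by
  obtain ⟨c, hc⟩ := (Commute.one_right x).exists_add_pow_prime_eq hp
  rw [hc, h0]; simp

section
variable {R : Type} [Ring R] {p : ℕ}

/-- The element `z - 1`. -/
noncomputable def ZZ (R : Type) [Ring R] (p : ℕ) : MonoidAlgebra R (Multiplicative (ZMod p)) :=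
  MonoidAlgebra.single (Multiplicative.ofAdd (1 : ZMod p)) (1 : R) - 1

lemma smul_eq {X : Type} [AddCommGroup X] [Module (MonoidAlgebra R (Multiplicative (ZMod p))) X]
    [Module R X] [IsScalarTower R (MonoidAlgebra R (Multiplicative (ZMod p))) X] (r : R) (x : X) :
    (MonoidAlgebra.single 1 r : MonoidAlgebra R (Multiplicative (ZMod p))) • x = r • x := by
  have : (MonoidAlgebra.single 1 r : MonoidAlgebra R (Multiplicative (ZMod p))) = r • 1 := by
    rw [MonoidAlgebra.one_def, MonoidAlgebra.smul_single]; simp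
  rw [this, smul_assoc, one_smul]

lemma ZZ_comm {X : Type} [AddCommGroup X] [Module (MonoidAlgebra R (Multiplicative (ZMod p))) X]
    [Module R X] [IsScalarTower R (MonoidAlgebra R (Multiplicative (ZMod p))) X] (r : R) (x : X) :
    ZZ R p • r • x = r • ZZ R p • x := by
  rw [← smul_eq (p := p) r x, ← smul_eq (p := p) r (ZZ R p • x), smul_smul, smul_smul]
  congr 1
  simp [ZZ, sub_mul, mul_sub, MonoidAlgebra.single_mul_single]

/-- multiplication by `Z` as an `R`-linear map -/
noncomputable def ZL (R : Type) [Ring R] (p : ℕ) (X : Type) [AddCommGroup X]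
    [Module (MonoidAlgebra R (Multiplicative (ZMod p))) X]
    [Module R X] [IsScalarTower R (MonoidAlgebra R (Multiplicative (ZMod p))) X] : X →ₗ[R] X where
  toFun x := ZZ R p • x
  map_add' := smul_add _
  map_smul' r x := ZZ_comm r x

lemma ZZ_pow (hp : p.Prime) (h0 : (p : R) = 0) : (ZZ R p) ^ p = 0 := by
  have h1 : (p : MonoidAlgebra R (Multiplicative (ZMod p))) = 0 := by
    rw [← nsmul_one, MonoidAlgebra.one_def]
    ext c
    simp [h0]
  have h2 := add_one_pow hp h1 (ZZ R p)
  have h3 : (ZZ R p + 1) ^ p = 1 := by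
    simp only [ZZ, sub_add_cancel, MonoidAlgebra.single_pow, one_pow, MonoidAlgebra.one_def]
    congr 1
    rw [← ofAdd_nsmul]; simp
  rw [h3] at h2
  simpa using h2.symm

/-- An `R`-linear map commuting with `Z` is linear over the group algebra. -/
noncomputable def mkLin [NeZero p] {X Y : Type} [AddCommGroup X]
    [Module (MonoidAlgebra R (Multiplicative (ZMod p))) X]
    [Module R X] [IsScalarTower R (MonoidAlgebra R (Multiplicative (ZMod p))) X]
    [AddCommGroup Y] [Module (MonoidAlgebra R (Multiplicative (ZMod p))) Y]
    [Module R Y] [IsScalarTower R (MonoidAlgebra R (Multiplicative (ZMod p))) Y]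
    (f : X →ₗ[R] Y) (hf : ∀ x, f (ZZ R p • x) = ZZ R p • f x) :
    X →ₗ[MonoidAlgebra R (Multiplicative (ZMod p))] Y where
  toFun := f
  map_add' := f.map_add
  map_smul' a x := by
    have hz : ∀ x, f ((MonoidAlgebra.single (Multiplicative.ofAdd (1 : ZMod p)) (1 : R) :
        MonoidAlgebra R (Multiplicative (ZMod p))) • x) =
        (MonoidAlgebra.single (Multiplicative.ofAdd (1 : ZMod p)) (1 : R) :
        MonoidAlgebra R (Multiplicative (ZMod p))) • f x := by
      intro x
      have := hf x
      simp only [ZZ, sub_smul, one_smul, map_sub] at this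
      exact sub_left_injective this
    have hzn : ∀ (n : ℕ) x, f ((MonoidAlgebra.single (Multiplicative.ofAdd (1 : ZMod p)) (1 : R) :
        MonoidAlgebra R (Multiplicative (ZMod p))) ^ n • x) =
        (MonoidAlgebra.single (Multiplicative.ofAdd (1 : ZMod p)) (1 : R) :
        MonoidAlgebra R (Multiplicative (ZMod p))) ^ n • f x := by
      intro n
      induction n with
      | zero => intro x; simp
      | succ n ih => intro x; rw [pow_succ, mul_smul, ih, hz, mul_smul]
    simp only [RingHom.id_apply]
    induction a using MonoidAlgebra.induction_linear with
    | zero => simp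
    | add a b ha hb => simp only [add_smul, map_add, ha, hb]
    | single c r =>
      have hc : (MonoidAlgebra.single c r : MonoidAlgebra R (Multiplicative (ZMod p))) =
          MonoidAlgebra.single 1 r *
          (MonoidAlgebra.single (Multiplicative.ofAdd (1 : ZMod p)) (1 : R)) ^
            (c.toAdd.val) := by
        rw [MonoidAlgebra.single_pow, MonoidAlgebra.single_mul_single, one_mul, one_pow, mul_one,
          ← ofAdd_nsmul]
        simp
      rw [hc, mul_smul, mul_smul, smul_eq, smul_eq, map_smul, hzn]

/-- An `R`-linear endomorphism `S` with `S ^ p = 0` gives a module over the group algebra. -/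
lemma exists_module (hp : p.Prime) (h0 : (p : R) = 0) {X : Type} [AddCommGroup X] [Module R X]
    (S : X →ₗ[R] X) (hS : S ^ p = 0) :
    ∃ (_ : Module (MonoidAlgebra R (Multiplicative (ZMod p))) X),
      IsScalarTower R (MonoidAlgebra R (Multiplicative (ZMod p))) X ∧
      ∀ x : X, ZZ R p • x = S x := by
  have : NeZero p := ⟨hp.ne_zero⟩
  have hu : (S + 1) ^ p = 1 := by
    obtain ⟨c, hc⟩ := (Commute.one_right S).exists_add_pow_prime_eq hp
    rw [hc, hS]
    ext x
    have : ∀ y : X, (p : X →ₗ[R] X) y = 0 := by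
      intro y
      rw [Module.End.natCast_apply, ← Nat.cast_smul_eq_nsmul R, h0, zero_smul]
    simp [this, mul_assoc]
  let u : Multiplicative (ZMod p) →* AddMonoid.End X :=
    { toFun := fun c => ((S + 1) ^ (c.toAdd.val)).toAddMonoidHom
      map_one' := by ext x; simp; rfl
      map_mul' := by
        intro a b
        rw [toAdd_mul, ZMod.val_add, ← pow_eq_pow_mod _ hu, pow_add]
        rfl }
  let F : MonoidAlgebra R (Multiplicative (ZMod p)) →+* AddMonoid.End X :=
    MonoidAlgebra.liftNCRingHom (Module.toAddMonoidEnd R X) u (by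
      intro r c
      ext x
      exact (map_smul ((S + 1) ^ (c.toAdd.val)) r x).symm)
  let m : Module (MonoidAlgebra R (Multiplicative (ZMod p))) X := Module.compHom X F
  have hsm : ∀ (a : MonoidAlgebra R (Multiplicative (ZMod p))) (x : X), a • x = F a x :=
    fun _ _ => rfl
  have hF : ∀ c r (x : X), F (MonoidAlgebra.single c r) x = r • (((S + 1) ^ (c.toAdd.val)) x) := by
    intro c r x
    have : F (MonoidAlgebra.single c r) = Module.toAddMonoidEnd R X r * u c :=
      MonoidAlgebra.liftNCRingHom_single _ _ _ _ _
    rw [this]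
    rfl
  refine ⟨m, ⟨?_⟩, ?_⟩
  · intro r a x
    have : r • a = MonoidAlgebra.single 1 r * a := by
      ext c; simp
    rw [this, mul_smul, hsm _ (a • x), hF]
    simp
  · intro x
    rw [ZZ, sub_smul, one_smul, hsm, hF]
    have : Fact (1 < p) := ⟨hp.one_lt⟩
    simp [ZMod.val_one]

end

section
variable {R : Type} [Ring R] {q : ℕ}

/-- shift -/
def shift (R : Type) [Ring R] (q : ℕ) (X : Type) [AddCommGroup X] [Module R X] :
    (Fin (q + 1) → X) →ₗ[R] (Fin (q + 1) → X) where
  toFun f := Fin.cons 0 (ResMod.dropLast f)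
  map_add' f g := by
    ext t; refine Fin.cases ?_ (fun t => ?_) t <;> simp [ResMod.dropLast]
  map_smul' r f := by
    ext t; refine Fin.cases ?_ (fun t => ?_) t <;> simp [ResMod.dropLast]

lemma shift_apply {X : Type} [AddCommGroup X] [Module R X] (f : Fin (q + 1) → X) :
    shift R q X f = Fin.cons 0 (ResMod.dropLast f) := rfl

lemma shift_pow {X : Type} [AddCommGroup X] [Module R X] (s : ℕ) (f : Fin (q + 1) → X)
    (t : Fin (q + 1)) (ht : t.val < s) : ((shift R q X) ^ s) f t = 0 := by
  induction s generalizing t with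
  | zero => omega
  | succ s ih =>
    rw [pow_succ', Module.End.mul_apply, shift_apply]
    revert ht
    refine Fin.cases ?_ (fun t => ?_) t
    · intro _; simp
    · intro ht
      simp only [Fin.cons_succ, ResMod.dropLast]
      apply ih
      simp at ht ⊢; omega

lemma shift_pow_top {X : Type} [AddCommGroup X] [Module R X] :
    (shift R q X) ^ (q + 1) = 0 := by
  exact LinearMap.ext fun f => funext fun t => shift_pow _ _ _ t.2

lemma projective_shift (hp : (q + 1).Prime) (h0 : ((q + 1 : ℕ) : R) = 0)
    {X : Type} [AddCommGroup X] [Module R X]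
    [Module.Projective R X]
    [Module (MonoidAlgebra R (Multiplicative (ZMod (q + 1)))) (Fin (q + 1) → X)]
    [IsScalarTower R (MonoidAlgebra R (Multiplicative (ZMod (q + 1)))) (Fin (q + 1) → X)]
    (hZ : ∀ f : Fin (q + 1) → X, ZZ R (q + 1) • f = Fin.cons 0 (ResMod.dropLast f)) :
    Module.Projective (MonoidAlgebra R (Multiplicative (ZMod (q + 1)))) (Fin (q + 1) → X) := by
  refine Module.Projective.of_lifting_property'' fun f hf => ?_
  obtain ⟨g, hg⟩ := Module.projective_lifting_property (f.restrictScalars R)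
    (LinearMap.single R (fun _ : Fin (q + 1) => X) 0) hf
  have hg' : ∀ x, f (g x) = Pi.single 0 x := fun x => LinearMap.congr_fun hg x
  let Y := (Fin (q + 1) → X) →₀ MonoidAlgebra R (Multiplicative (ZMod (q + 1)))
  let h : (Fin (q + 1) → X) →ₗ[R] Y :=
    LinearMap.lsum R (fun _ : Fin (q + 1) => X) ℕ
      (fun t => ((ZL R (q + 1) Y) ^ (t : ℕ)) ∘ₗ g)
  have hpow : ∀ (n : ℕ) (y : Y), ((ZL R (q + 1) Y) ^ n) y = (ZZ R (q + 1)) ^ n • y := by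
    intro n
    induction n with
    | zero => intro y; simp
    | succ n ih =>
      intro y
      rw [pow_succ', Module.End.mul_apply, ih, pow_succ', mul_smul]; rfl
  have happ : ∀ x, h x = ∑ t : Fin (q + 1), (ZZ R (q + 1)) ^ (t : ℕ) • g (x t) := by
    intro x
    simp [h, LinearMap.lsum_apply, hpow]
  have hcomm : ∀ x, h (ZZ R (q + 1) • x) = ZZ R (q + 1) • h x := by
    intro x
    rw [happ, happ, hZ, Fin.sum_univ_succ, Fin.sum_univ_castSucc, smul_add, Finset.smul_sum]
    simp only [Fin.cons_zero, map_zero, smul_zero, zero_add, Fin.cons_succ, Fin.val_succ,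
      Fin.val_castSucc, Fin.val_last, smul_smul, ← pow_succ', ZZ_pow hp h0, zero_smul, add_zero]
    rfl
  refine ⟨mkLin h hcomm, ?_⟩
  have hsing : ∀ (n : ℕ) (hn : n < q + 1) (x : X),
      (ZZ R (q + 1)) ^ n • (Pi.single 0 x : Fin (q + 1) → X) = Pi.single ⟨n, hn⟩ x := by
    intro n
    induction n with
    | zero => intro hn x; simp
    | succ n ih =>
      intro hn x
      rw [pow_succ', mul_smul, ih (by omega), hZ]
      ext t
      refine Fin.cases ?_ (fun t => ?_) t
      · rw [Fin.cons_zero, Pi.single_eq_of_ne]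
        simp [Fin.ext_iff]
      · simp [ResMod.dropLast, Pi.single_apply, Fin.ext_iff]
  ext x : 1
  change f (h x) = x
  rw [happ, map_sum]
  simp only [map_smul, hg', hsing _ (Fin.is_lt _)]
  exact Finset.univ_sum_single x

end

section
variable {R : Type} [Ring R] {r : ℕ}

lemma abstract_main (hp : (r + 2).Prime) (h0 : ((r + 2 : ℕ) : R) = 0)
    {E O T M N : Type} [AddCommGroup E] [AddCommGroup O] [AddCommGroup T]
    [AddCommGroup M] [AddCommGroup N] [Module R E] [Module R O] [Module R T] [Module R M]
    [Module R N]
    [Module.Projective R E] [Module.Projective R O]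
    [Module (MonoidAlgebra R (Multiplicative (ZMod (r + 2)))) T]
    [IsScalarTower R (MonoidAlgebra R (Multiplicative (ZMod (r + 2)))) T]
    [Module (MonoidAlgebra R (Multiplicative (ZMod (r + 2)))) M]
    [IsScalarTower R (MonoidAlgebra R (Multiplicative (ZMod (r + 2)))) M]
    [Module (MonoidAlgebra R (Multiplicative (ZMod (r + 2)))) N]
    [IsScalarTower R (MonoidAlgebra R (Multiplicative (ZMod (r + 2)))) N]
    (α : E →ₗ[R] O) (β : O →ₗ[R] E) (ε : E →ₗ[R] T)
    (hab : ∀ o, α (β o) = 0) (hba : ∀ e, β (α e) = 0) (heb : ∀ o, ε (β o) = 0)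
    (hT : ∀ t : T, ZZ R (r + 2) • t = 0)
    (ψM : (E × (Fin (r + 1) → O)) ≃ₗ[R] M)
    (hM : ∀ e o, ZZ R (r + 2) • ψM (e, o) =
      ψM (β (o (Fin.last r)), Fin.cons (α e) (ResMod.dropLast o)))
    (ψN : (T × (Fin (r + 1) → E) × O) ≃ₗ[R] N)
    (hN : ∀ t b o, ZZ R (r + 2) • ψN (t, b, o) =
      ψN (-ε (b (Fin.last r)), Fin.cons (-β o) (ResMod.dropLast b), -α (b (Fin.last r)))) :
    ∃ (Q : Type) (_ : AddCommGroup Q)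
      (_ : Module (MonoidAlgebra R (Multiplicative (ZMod (r + 2)))) Q),
      Module.Projective (MonoidAlgebra R (Multiplicative (ZMod (r + 2)))) Q ∧
      ∃ (θ : M →ₗ[MonoidAlgebra R (Multiplicative (ZMod (r + 2)))] (T × Q))
        (μ : (T × Q) →ₗ[MonoidAlgebra R (Multiplicative (ZMod (r + 2)))] N),
        Function.Injective θ ∧ Function.Surjective μ ∧
        LinearMap.range θ = LinearMap.ker μ := by
  obtain ⟨mE, tE, zE⟩ := exists_module hp h0 (shift R (r + 1) E) shift_pow_top
  obtain ⟨mO, tO, zO⟩ := exists_module hp h0 (shift R (r + 1) O) shift_pow_top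
  have pE := projective_shift hp h0 zE
  have pO := projective_shift hp h0 zO
  simp only [shift_apply] at zE zO
  -- coordinates of `θ`
  let θ₀ : (E × (Fin (r + 1) → O)) →ₗ[R] (T × (Fin (r + 2) → E) × (Fin (r + 2) → O)) :=
    { toFun := fun x => (ε x.1, Fin.snoc (α := fun _ => E) (fun t => β (x.2 t)) x.1,
        Fin.cons (α := fun _ => O) (α x.1) x.2)
      map_add' := by
        intro x y
        refine Prod.ext (by simp) (Prod.ext ?_ ?_)
        · ext t; refine Fin.lastCases ?_ (fun t => ?_) t <;> simp
        · ext t; refine Fin.cases ?_ (fun t => ?_) t <;> simp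
      map_smul' := by
        intro c x
        refine Prod.ext (by simp) (Prod.ext ?_ ?_)
        · ext t; refine Fin.lastCases ?_ (fun t => ?_) t <;> simp
        · ext t; refine Fin.cases ?_ (fun t => ?_) t <;> simp }
  let μ₀ : (T × (Fin (r + 2) → E) × (Fin (r + 2) → O)) →ₗ[R] (T × (Fin (r + 1) → E) × O) :=
    { toFun := fun x => (x.1 - ε (x.2.1 (Fin.last _)),
        fun t => x.2.1 t.castSucc - β (x.2.2 t.succ), x.2.2 0 - α (x.2.1 (Fin.last _)))
      map_add' := by
        intro x y
        refine Prod.ext ?_ (Prod.ext ?_ ?_)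
        · simp; abel
        · ext t; simp; abel
        · simp; abel
      map_smul' := by
        intro c x
        refine Prod.ext ?_ (Prod.ext ?_ ?_)
        · simp [smul_sub]
        · ext t; simp [smul_sub]
        · simp [smul_sub] }
  have hθ₀ : ∀ e o, θ₀ (e, o) = (ε e, Fin.snoc (α := fun _ => E) (fun t => β (o t)) e,
        Fin.cons (α := fun _ => O) (α e) o) := fun _ _ => rfl
  have hμ₀ : ∀ t f g, μ₀ (t, f, g) = (t - ε (f (Fin.last _)),
        fun t => f t.castSucc - β (g t.succ), g 0 - α (f (Fin.last _))) := fun _ _ _ => rfl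
  have hcθ : ∀ m, (θ₀ ∘ₗ ψM.symm.toLinearMap) (ZZ R (r + 2) • m) =
      ZZ R (r + 2) • (θ₀ ∘ₗ ψM.symm.toLinearMap) m := by
    intro m
    obtain ⟨⟨e, o⟩, rfl⟩ := ψM.surjective m
    simp only [LinearMap.comp_apply, LinearEquiv.coe_coe, hM, LinearEquiv.symm_apply_apply, hθ₀,
      Prod.smul_mk, hT, heb, zE, zO]
    refine Prod.ext rfl (Prod.ext ?_ ?_)
    · ext t
      refine Fin.cases ?_ (fun t => ?_) t
      · rw [← Fin.castSucc_zero]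
        simp [hba, -Fin.castSucc_zero]
      · refine Fin.lastCases ?_ (fun t => ?_) t
        · simp [ResMod.dropLast]
        · simp only [Fin.cons_succ]
          rw [Fin.succ_castSucc, Fin.snoc_castSucc]
          simp [ResMod.dropLast]
    · ext t
      refine Fin.cases ?_ (fun t => ?_) t
      · simp [hab]
      · refine Fin.cases ?_ (fun t => ?_) t
        · simp [ResMod.dropLast]
        · simp [ResMod.dropLast]
  have hcμ : ∀ x, (ψN.toLinearMap ∘ₗ μ₀) (ZZ R (r + 2) • x) =
      ZZ R (r + 2) • (ψN.toLinearMap ∘ₗ μ₀) x := by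
    rintro ⟨t, f, g⟩
    simp only [LinearMap.comp_apply, LinearEquiv.coe_coe, Prod.smul_mk, hT, zE, zO, hμ₀, hN]
    congr 1
    refine Prod.ext ?_ (Prod.ext ?_ ?_)
    · simp [-Fin.succ_last, ResMod.dropLast, heb]
    · ext t
      refine Fin.cases ?_ (fun t => ?_) t
      · simp [ResMod.dropLast, hba]
      · simp [ResMod.dropLast]
    · simp [-Fin.succ_last, ResMod.dropLast, hab]
  refine ⟨(Fin (r + 2) → E) × (Fin (r + 2) → O), inferInstance, inferInstance, inferInstance,
    mkLin (θ₀ ∘ₗ ψM.symm.toLinearMap) hcθ, mkLin (ψN.toLinearMap ∘ₗ μ₀) hcμ, ?_, ?_, ?_⟩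
  · change Function.Injective (θ₀ ∘ ψM.symm)
    refine Function.Injective.comp ?_ ψM.symm.injective
    rintro ⟨e, o⟩ ⟨e', o'⟩ h
    rw [hθ₀, hθ₀, Prod.mk.injEq, Prod.mk.injEq] at h
    obtain ⟨-, h1, h2⟩ := h
    have h3 := congrFun h1 (Fin.last _)
    simp only [Fin.snoc_last] at h3
    refine Prod.ext h3 ?_
    ext t
    simpa using congrFun h2 t.succ
  · change Function.Surjective (ψN ∘ μ₀)
    refine ψN.surjective.comp ?_
    rintro ⟨t, b, o⟩
    refine ⟨(t, Fin.snoc (α := fun _ => E) b 0, Fin.cons (α := fun _ => O) o 0), ?_⟩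
    rw [hμ₀]
    simp
  · ext ⟨t, f, g⟩
    rw [LinearMap.mem_range, LinearMap.mem_ker]
    change (∃ m, θ₀ (ψM.symm m) = _) ↔ ψN (μ₀ (t, f, g)) = 0
    rw [LinearEquiv.map_eq_zero_iff, hμ₀]
    constructor
    · rintro ⟨m, hm⟩
      obtain ⟨⟨e, o⟩, rfl⟩ := ψM.surjective m
      rw [LinearEquiv.symm_apply_apply, hθ₀, Prod.mk.injEq, Prod.mk.injEq] at hm
      obtain ⟨rfl, rfl, rfl⟩ := hm
      refine Prod.ext ?_ (Prod.ext ?_ ?_)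
      · simp
      · ext t; simp
      · simp
    · intro h
      rw [Prod.ext_iff, Prod.ext_iff] at h
      obtain ⟨h1, h2, h3⟩ := h
      simp only [Prod.fst_zero, Prod.snd_zero, sub_eq_zero] at h1 h3
      refine ⟨ψM (f (Fin.last _), fun t => g t.succ), ?_⟩
      rw [LinearEquiv.symm_apply_apply, hθ₀]
      refine Prod.ext h1.symm (Prod.ext ?_ ?_)
      · ext t
        refine Fin.lastCases ?_ (fun t => ?_) t
        · simp
        · have := congrFun h2 t
          simp [sub_eq_zero] at this
          simp [this]
      · ext t
        refine Fin.cases ?_ (fun t => ?_) t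
        · simp [h3]
        · simp
end

section
open DirectSum
variable {R : Type} [Ring R] {J : Type} [DecidableEq J] {q : ℕ}
  (X Y : J → Type) [∀ j, AddCommGroup (X j)] [∀ j, AddCommGroup (Y j)]
  [∀ j, Module R (X j)] [∀ j, Module R (Y j)]

/-- rearranging a direct sum -/
noncomputable def rearr (R : Type) [Ring R] (q : ℕ) [∀ j, Module R (X j)] [∀ j, Module R (Y j)] :
    ((⨁ j, X j) × (Fin q → ⨁ j, Y j)) ≃ₗ[R] ⨁ j, (X j × (Fin q → Y j)) :=
  LinearEquiv.ofLinearMap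
    (LinearMap.coprod (DirectSum.lmap fun j => LinearMap.inl R (X j) (Fin q → Y j))
      (LinearMap.lsum R (fun _ : Fin q => ⨁ j, Y j) ℕ fun t =>
        DirectSum.lmap fun j => LinearMap.inr R (X j) (Fin q → Y j) ∘ₗ
          LinearMap.single R (fun _ : Fin q => Y j) t))
    (LinearMap.prod (DirectSum.lmap fun j => LinearMap.fst R (X j) (Fin q → Y j))
      (LinearMap.pi fun t => DirectSum.lmap fun j =>
        LinearMap.proj t ∘ₗ LinearMap.snd R (X j) (Fin q → Y j)))
    (by
      refine LinearMap.ext fun x => DFinsupp.ext fun j => ?_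
      refine Prod.ext ?_ ?_
      · simp [LinearMap.lsum_apply, DirectSum.add_apply, DirectSum.sum_apply, Prod.fst_sum]
      · ext s
        simp [LinearMap.lsum_apply, DirectSum.add_apply, DirectSum.sum_apply, Prod.snd_sum,
          Finset.sum_apply, Pi.single_apply])
    (by
      refine LinearMap.ext fun x => ?_
      refine Prod.ext (DFinsupp.ext fun j => ?_) (funext fun s => DFinsupp.ext fun j => ?_)
      · simp [LinearMap.lsum_apply, DirectSum.add_apply, DirectSum.sum_apply, Prod.fst_sum]
      · simp [LinearMap.lsum_apply, DirectSum.add_apply, DirectSum.sum_apply, Prod.snd_sum,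
          Finset.sum_apply, Pi.single_apply])

variable {X Y}

lemma toModule_lmap {X Y : J → Type} [∀ j, AddCommGroup (X j)] [∀ j, AddCommGroup (Y j)]
    [∀ j, Module R (X j)] [∀ j, Module R (Y j)] {M : Type} [AddCommGroup M] [Module R M]
    (f : ∀ j, X j →ₗ[R] Y j) (g : ∀ j, Y j →ₗ[R] M) (x : ⨁ j, X j) :
    DirectSum.toModule R J M g (DirectSum.lmap f x) =
      DirectSum.toModule R J M (fun j => g j ∘ₗ f j) x := by
  have : DirectSum.toModule R J M g ∘ₗ DirectSum.lmap f =
      DirectSum.toModule R J M (fun j => g j ∘ₗ f j) := by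
    refine DirectSum.linearMap_ext R fun j => LinearMap.ext fun x => ?_
    simp
  exact LinearMap.congr_fun this x

lemma rearr_apply {M : Type} [AddCommGroup M] [Module R M]
    (f : ∀ j, X j →ₗ[R] M) (g : ∀ j, Fin q → (Y j →ₗ[R] M)) (x : ⨁ j, X j)
    (y : Fin q → ⨁ j, Y j) :
    DirectSum.toModule R J M (fun j => LinearMap.coprod (f j)
      (LinearMap.lsum R (fun _ : Fin q => Y j) ℕ (g j))) (rearr X Y R q (x, y)) =
    DirectSum.toModule R J M f x + ∑ t, DirectSum.toModule R J M (fun j => g j t) (y t) := by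
  simp only [rearr, LinearEquiv.coe_ofLinearMap, LinearMap.coprod_apply, map_add,
    LinearMap.lsum_apply, LinearMap.coe_sum, Finset.sum_apply, LinearMap.comp_apply, map_sum,
    toModule_lmap]
  congr 1
  · congr 2
    ext j x
    simp
  · refine Finset.sum_congr rfl fun t _ => ?_
    change DirectSum.toModule R J M _ (y t) = _
    congr 2
    ext j x
    simp [Pi.single_apply, apply_ite]

/-- rearranging, other order -/
noncomputable def rearr' (X Y : J → Type) [∀ j, AddCommGroup (X j)] [∀ j, AddCommGroup (Y j)]
    (R : Type) [Ring R] (q : ℕ) [∀ j, Module R (X j)] [∀ j, Module R (Y j)] :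
    ((Fin q → ⨁ j, X j) × (⨁ j, Y j)) ≃ₗ[R] ⨁ j, ((Fin q → X j) × Y j) :=
  LinearEquiv.prodComm R _ _ ≪≫ₗ rearr Y X R q ≪≫ₗ
    DirectSum.congrLinearEquiv (fun _ => LinearEquiv.prodComm R _ _)

lemma rearr'_apply {M : Type} [AddCommGroup M] [Module R M]
    (f : ∀ j, Y j →ₗ[R] M) (g : ∀ j, Fin q → (X j →ₗ[R] M)) (y : ⨁ j, Y j)
    (x : Fin q → ⨁ j, X j) :
    DirectSum.toModule R J M (fun j => LinearMap.coprod
      (LinearMap.lsum R (fun _ : Fin q => X j) ℕ (g j)) (f j)) (rearr' X Y R q (x, y)) =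
    DirectSum.toModule R J M f y + ∑ t, DirectSum.toModule R J M (fun j => g j t) (x t) := by
  rw [← rearr_apply]
  simp only [rearr', LinearEquiv.trans_apply, DirectSum.coe_congrLinearEquiv, toModule_lmap]
  congr 2
  ext j x <;> simp
end

end ResMod

/-- Let `P_*` be a projective resolution of the trivial `kH`-module `k`
(realized as `T`), let `M = M(P_*, n)` and let `N = N(P_*, n)` be the `kG`-module
`k ⊕ P_0^{p-1} ⊕ P_1 ⊕ P_2^{p-1} ⊕ ⋯ ⊕ P_{2n-1}` with the `Z = z - 1` action:
`Z` annihilates the summand `k`; on `P_{2i}^{p-1}` it shifts the tuple and sends the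
last entry by `-ε` (if `i = 0`) resp. `-∂` (if `i > 0`); and it sends `m ∈ P_{2i+1}`
to `-(∂m, 0, …, 0) ∈ P_{2i}^{p-1}`.  Then there is a projective `kG`-module `Q` and a
short exact sequence of `kG`-modules `0 → M(P_*,n) → k ⊕ Q → N(P_*,n) → 0`.
Here `kG = kH ⊗ k[Z]/(Z^p)` and `n` is an extended natural number (`n = ∞` allowed). -/
theorem resolution_module_short_exact_sequence
    (k : Type) [Field k] (p : ℕ) (hp : p.Prime) [CharP k p]
    (H : Type) [Group H] [Finite H]
    -- the trivial `kG`-module `k`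
    (T : Type) [AddCommGroup T] [Module k T]
    [Module (MonoidAlgebra (MonoidAlgebra k H) (Multiplicative (ZMod p))) T]
    [Module (MonoidAlgebra k H) T]
    [IsScalarTower (MonoidAlgebra k H)
      (MonoidAlgebra (MonoidAlgebra k H) (Multiplicative (ZMod p))) T]
    (e0 : T ≃ₗ[k] k)
    (htrivH : ∀ (h : H) (t : T), (MonoidAlgebra.single h (1 : k) : MonoidAlgebra k H) • t = t)
    (htrivC : ∀ (c : Multiplicative (ZMod p)) (t : T),
      (MonoidAlgebra.single c (1 : MonoidAlgebra k H) :
        MonoidAlgebra (MonoidAlgebra k H) (Multiplicative (ZMod p))) • t = t)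
    -- `P_*` is a projective resolution of `T` over `kH`
    (P : ℕ → Type) [∀ i, AddCommGroup (P i)] [∀ i, Module (MonoidAlgebra k H) (P i)]
    (d : ∀ i, P (i + 1) →ₗ[MonoidAlgebra k H] P i)
    (hproj : ∀ i, Module.Projective (MonoidAlgebra k H) (P i))
    (ε : P 0 →ₗ[MonoidAlgebra k H] T)
    (hsurj : Function.Surjective ε)
    (hexact0 : LinearMap.range (d 0) = LinearMap.ker ε)
    (hexact : ∀ i, LinearMap.range (d (i + 1)) = LinearMap.ker (d i))
    (n : ℕ∞) (hn : 0 < n)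
    (Z : MonoidAlgebra (MonoidAlgebra k H) (Multiplicative (ZMod p)))
    (hZ : Z = MonoidAlgebra.single (Multiplicative.ofAdd (1 : ZMod p))
      (1 : MonoidAlgebra k H) - 1)
    -- `M = M(P_*, n)`
    (M : Type) [AddCommGroup M]
    [Module (MonoidAlgebra (MonoidAlgebra k H) (Multiplicative (ZMod p))) M]
    [Module (MonoidAlgebra k H) M]
    [IsScalarTower (MonoidAlgebra k H)
      (MonoidAlgebra (MonoidAlgebra k H) (Multiplicative (ZMod p))) M]
    (ae : (j : ℕ) → ((j : ℕ∞) < n) → (P (2 * j) →ₗ[MonoidAlgebra k H] M))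
    (ao : (j : ℕ) → ((j : ℕ∞) < n) → Fin (p - 1) →
      (P (2 * j + 1) →ₗ[MonoidAlgebra k H] M))
    (hdecompM : Function.Bijective
      (DirectSum.toModule (MonoidAlgebra k H) {j : ℕ // (j : ℕ∞) < n} M
        (fun j => LinearMap.coprod (ae j.1 j.2)
          (LinearMap.lsum (MonoidAlgebra k H)
            (fun _ : Fin (p - 1) => P (2 * j.1 + 1)) ℕ (fun t => ao j.1 j.2 t)))))
    (hZ0M : ∀ (h : ((0 : ℕ) : ℕ∞) < n) (m : P (2 * 0)), Z • ae 0 h m = 0)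
    (hZeM : ∀ (j : ℕ) (hj1 : ((j + 1 : ℕ) : ℕ∞) < n) (hj : ((j : ℕ) : ℕ∞) < n)
      (m : P (2 * (j + 1))),
      Z • ae (j + 1) hj1 m = ao j hj ⟨0, by have := hp.two_le; omega⟩ (d (2 * j + 1) m))
    (hZoM : ∀ (j : ℕ) (hj : ((j : ℕ) : ℕ∞) < n) (t : Fin (p - 1))
      (ht : (t : ℕ) + 1 < p - 1) (m : P (2 * j + 1)),
      Z • ao j hj t m = ao j hj ⟨(t : ℕ) + 1, ht⟩ m)
    (hZlastM : ∀ (j : ℕ) (hj : ((j : ℕ) : ℕ∞) < n) (hl : p - 2 < p - 1)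
      (m : P (2 * j + 1)),
      Z • ao j hj ⟨p - 2, hl⟩ m = ae j hj (d (2 * j) m))
    -- `Nn = N(P_*, n)`
    (Nn : Type) [AddCommGroup Nn]
    [Module (MonoidAlgebra (MonoidAlgebra k H) (Multiplicative (ZMod p))) Nn]
    [Module (MonoidAlgebra k H) Nn]
    [IsScalarTower (MonoidAlgebra k H)
      (MonoidAlgebra (MonoidAlgebra k H) (Multiplicative (ZMod p))) Nn]
    (lN : T →ₗ[MonoidAlgebra k H] Nn)
    (bo : (j : ℕ) → ((j : ℕ∞) < n) → Fin (p - 1) →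
      (P (2 * j) →ₗ[MonoidAlgebra k H] Nn))
    (be : (j : ℕ) → ((j : ℕ∞) < n) → (P (2 * j + 1) →ₗ[MonoidAlgebra k H] Nn))
    (hdecompN : Function.Bijective
      (LinearMap.coprod lN
        (DirectSum.toModule (MonoidAlgebra k H) {j : ℕ // (j : ℕ∞) < n} Nn
          (fun j => LinearMap.coprod
            (LinearMap.lsum (MonoidAlgebra k H)
              (fun _ : Fin (p - 1) => P (2 * j.1)) ℕ (fun t => bo j.1 j.2 t))
            (be j.1 j.2)))))
    (hZlN : ∀ t : T, Z • lN t = 0)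
    (hZoN : ∀ (j : ℕ) (hj : ((j : ℕ) : ℕ∞) < n) (t : Fin (p - 1))
      (ht : (t : ℕ) + 1 < p - 1) (m : P (2 * j)),
      Z • bo j hj t m = bo j hj ⟨(t : ℕ) + 1, ht⟩ m)
    (hZlast0N : ∀ (h0 : ((0 : ℕ) : ℕ∞) < n) (hl : p - 2 < p - 1) (m : P (2 * 0)),
      Z • bo 0 h0 ⟨p - 2, hl⟩ m = - lN (ε m))
    (hZlastN : ∀ (j : ℕ) (hj1 : ((j + 1 : ℕ) : ℕ∞) < n) (hj : ((j : ℕ) : ℕ∞) < n)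
      (hl : p - 2 < p - 1) (m : P (2 * (j + 1))),
      Z • bo (j + 1) hj1 ⟨p - 2, hl⟩ m = - be j hj (d (2 * j + 1) m))
    (hZeN : ∀ (j : ℕ) (hj : ((j : ℕ) : ℕ∞) < n) (m : P (2 * j + 1)),
      Z • be j hj m = - bo j hj ⟨0, by have := hp.two_le; omega⟩ (d (2 * j) m)) :
    ∃ (Q : Type) (_ : AddCommGroup Q)
      (_ : Module (MonoidAlgebra (MonoidAlgebra k H) (Multiplicative (ZMod p))) Q),
      Module.Projective (MonoidAlgebra (MonoidAlgebra k H) (Multiplicative (ZMod p))) Q ∧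
      ∃ (θ : M →ₗ[MonoidAlgebra (MonoidAlgebra k H) (Multiplicative (ZMod p))] (T × Q))
        (μ : (T × Q) →ₗ[MonoidAlgebra (MonoidAlgebra k H) (Multiplicative (ZMod p))] Nn),
        Function.Injective θ ∧ Function.Surjective μ ∧
        LinearMap.range θ = LinearMap.ker μ := by
  
  obtain ⟨r, rfl⟩ : ∃ r, p = r + 2 := ⟨p - 2, by have := hp.two_le; omega⟩
  have hZ' : Z = ResMod.ZZ (MonoidAlgebra k H) (r + 2) := hZ
  clear hZ
  subst hZ'
  have h0 : ((r + 2 : ℕ) : MonoidAlgebra k H) = 0 := by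
    rw [← nsmul_one, MonoidAlgebra.one_def]
    ext c
    have : ((r + 2 : ℕ) : k) = 0 := CharP.cast_eq_zero k (r + 2)
    push_cast at this
    simp [this]
  have hdd0 : ∀ x, ε (d 0 x) = 0 := fun x => by
    have : d 0 x ∈ LinearMap.ker ε := hexact0 ▸ LinearMap.mem_range_self _ x
    exact this
  have hdd : ∀ i x, d i (d (i + 1) x) = 0 := fun i x => by
    have : d (i + 1) x ∈ LinearMap.ker (d i) := hexact i ▸ LinearMap.mem_range_self _ x
    exact this
  have hT : ∀ t : T, ResMod.ZZ (MonoidAlgebra k H) (r + 2) • t = 0 := by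
    intro t
    rw [ResMod.ZZ, sub_smul, htrivC, one_smul, sub_self]
  have hlt : ∀ j : ℕ, ((j + 1 : ℕ) : ℕ∞) < n → (j : ℕ∞) < n := fun j hj =>
    lt_trans (by exact_mod_cast Nat.lt_succ_self j) hj
  let J := {j : ℕ // (j : ℕ∞) < n}
  let R := MonoidAlgebra k H
  let E := DirectSum J (fun j => P (2 * j.1))
  let O := DirectSum J (fun j => P (2 * j.1 + 1))
  let α : E →ₗ[R] O := DirectSum.toModule R J O (fun j => match j with
    | ⟨0, _⟩ => 0
    | ⟨j + 1, h⟩ => DirectSum.lof R J (fun j => P (2 * j.1 + 1)) ⟨j, hlt j h⟩ ∘ₗ d (2 * j + 1))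
  let β : O →ₗ[R] E := DirectSum.toModule R J E (fun j =>
    DirectSum.lof R J (fun j => P (2 * j.1)) j ∘ₗ d (2 * j.1))
  let εE : E →ₗ[R] T := DirectSum.toModule R J T (fun j => match j with
    | ⟨0, _⟩ => ε
    | ⟨_ + 1, _⟩ => 0)
  have lE : ∀ (W : Type) [AddCommGroup W] [Module R W] (f : ∀ j : J, P (2 * j.1) →ₗ[R] W) (j : J)
      (x : P (2 * j.1)), DirectSum.toModule R J W f
        (DirectSum.lof R J (fun j => P (2 * j.1)) j x) = f j x := fun W _ _ f j x =>
    DirectSum.toModule_lof (M := fun j : J => P (2 * j.1)) R j x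
  have lO : ∀ (W : Type) [AddCommGroup W] [Module R W] (f : ∀ j : J, P (2 * j.1 + 1) →ₗ[R] W) (j : J)
      (x : P (2 * j.1 + 1)), DirectSum.toModule R J W f
        (DirectSum.lof R J (fun j => P (2 * j.1 + 1)) j x) = f j x := fun W _ _ f j x =>
    DirectSum.toModule_lof (M := fun j : J => P (2 * j.1 + 1)) R j x
  have hα0 : ∀ h x, α (DirectSum.lof R J (fun j => P (2 * j.1)) ⟨0, h⟩ x) = 0 := by
    intro h x
    exact lE _ _ _ x
  have hαs : ∀ j h x, α (DirectSum.lof R J (fun j => P (2 * j.1)) ⟨j + 1, h⟩ x) =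
      DirectSum.lof R J (fun j => P (2 * j.1 + 1)) ⟨j, hlt j h⟩ (d (2 * j + 1) x) := by
    intro j h x
    exact lE _ _ _ x
  have hβ : ∀ j x, β (DirectSum.lof R J (fun j => P (2 * j.1 + 1)) j x) =
      DirectSum.lof R J (fun j => P (2 * j.1)) j (d (2 * j.1) x) := by
    intro j x
    exact lO _ _ _ x
  have hε0 : ∀ h x, εE (DirectSum.lof R J (fun j => P (2 * j.1)) ⟨0, h⟩ x) = ε x := by
    intro h x
    exact lE _ _ _ x
  have hεs : ∀ j h x, εE (DirectSum.lof R J (fun j => P (2 * j.1)) ⟨j + 1, h⟩ x) = 0 := by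
    intro j h x
    exact lE _ _ _ x
  have hab : ∀ o, α (β o) = 0 := by
    have : α ∘ₗ β = 0 := by
      refine DirectSum.linearMap_ext R fun j => LinearMap.ext fun x => ?_
      obtain ⟨_ | j, hj⟩ := j
      · simp only [LinearMap.comp_apply, hβ, hα0]; rfl
      · simp only [LinearMap.comp_apply, hβ]
        have e : d (2 * j + 1) (d (2 * (j + 1)) x) = 0 := hdd _ x
        rw [hαs, e, map_zero]; rfl
    exact fun o => LinearMap.congr_fun this o
  have hba : ∀ o, β (α o) = 0 := by
    have : β ∘ₗ α = 0 := by
      refine DirectSum.linearMap_ext R fun j => LinearMap.ext fun x => ?_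
      obtain ⟨_ | j, hj⟩ := j
      · simp only [LinearMap.comp_apply, hα0, map_zero]; rfl
      · simp only [LinearMap.comp_apply, hαs, hβ]
        rw [hdd (2 * j), map_zero]; rfl
    exact fun o => LinearMap.congr_fun this o
  have heb : ∀ o, εE (β o) = 0 := by
    have : εE ∘ₗ β = 0 := by
      refine DirectSum.linearMap_ext R fun j => LinearMap.ext fun x => ?_
      obtain ⟨_ | j, hj⟩ := j
      · simp only [LinearMap.comp_apply, hβ, hε0]
        exact hdd0 x
      · simp only [LinearMap.comp_apply, hβ, hεs]; rfl
    exact fun o => LinearMap.congr_fun this o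
  -- the decomposition of `M`
  let AE : E →ₗ[R] M := DirectSum.toModule R J M (fun j => ae j.1 j.2)
  let AO : Fin (r + 1) → (O →ₗ[R] M) := fun t =>
    DirectSum.toModule R J M (fun j => ao j.1 j.2 t)
  have hAE : ∀ j x, AE (DirectSum.lof R J (fun j => P (2 * j.1)) j x) = ae j.1 j.2 x :=
    fun j x => lE _ _ j x
  have hAO : ∀ t j x, AO t (DirectSum.lof R J (fun j => P (2 * j.1 + 1)) j x) = ao j.1 j.2 t x :=
    fun t j x => lO _ _ j x
  let ψM : (E × (Fin (r + 1) → O)) ≃ₗ[R] M :=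
    (ResMod.rearr (fun j : J => P (2 * j.1)) (fun j : J => P (2 * j.1 + 1)) R (r + 1)).trans
      (LinearEquiv.ofBijective _ hdecompM)
  have hψM : ∀ e o, ψM (e, o) = AE e + ∑ t, AO t (o t) := fun e o =>
    ResMod.rearr_apply (fun j : J => ae j.1 j.2) (fun j : J => ao j.1 j.2) e o
  have zAE : ∀ e, ResMod.ZZ R (r + 2) • AE e = AO 0 (α e) := by
    have : ResMod.ZL R (r + 2) M ∘ₗ AE = AO 0 ∘ₗ α := by
      refine DirectSum.linearMap_ext R fun j => LinearMap.ext fun x => ?_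
      obtain ⟨_ | j, hj⟩ := j
      · simp only [LinearMap.comp_apply, hα0, map_zero, hAE]
        exact hZ0M hj x
      · simp only [LinearMap.comp_apply, hαs, hAE, hAO]
        exact hZeM j hj (hlt j hj) x
    exact fun o => LinearMap.congr_fun this o
  have zAO : ∀ (t : Fin r) o, ResMod.ZZ R (r + 2) • AO t.castSucc o = AO t.succ o := by
    intro t
    have : ResMod.ZL R (r + 2) M ∘ₗ AO t.castSucc = AO t.succ := by
      refine DirectSum.linearMap_ext R fun j => LinearMap.ext fun x => ?_
      simp only [LinearMap.comp_apply, hAO]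
      exact hZoM j.1 j.2 t.castSucc (by simp) x
    exact fun o => LinearMap.congr_fun this o
  have zAl : ∀ o, ResMod.ZZ R (r + 2) • AO (Fin.last r) o = AE (β o) := by
    have : ResMod.ZL R (r + 2) M ∘ₗ AO (Fin.last r) = AE ∘ₗ β := by
      refine DirectSum.linearMap_ext R fun j => LinearMap.ext fun x => ?_
      simp only [LinearMap.comp_apply, hβ, hAO, hAE]
      exact hZlastM j.1 j.2 (by omega) x
    exact fun o => LinearMap.congr_fun this o
  have hM : ∀ e o, ResMod.ZZ R (r + 2) • ψM (e, o) =
      ψM (β (o (Fin.last r)), Fin.cons (α e) (ResMod.dropLast o)) := by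
    intro e o
    rw [hψM, hψM, smul_add, Finset.smul_sum, Fin.sum_univ_castSucc, Fin.sum_univ_succ]
    simp only [zAE, zAO, zAl, Fin.cons_zero, Fin.cons_succ, ResMod.dropLast]
    abel
  -- the decomposition of `N`
  let BE : O →ₗ[R] Nn := DirectSum.toModule R J Nn (fun j => be j.1 j.2)
  let BO : Fin (r + 1) → (E →ₗ[R] Nn) := fun t =>
    DirectSum.toModule R J Nn (fun j => bo j.1 j.2 t)
  have hBE : ∀ j x, BE (DirectSum.lof R J (fun j => P (2 * j.1 + 1)) j x) = be j.1 j.2 x :=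
    fun j x => lO _ _ j x
  have hBO : ∀ t j x, BO t (DirectSum.lof R J (fun j => P (2 * j.1)) j x) = bo j.1 j.2 t x :=
    fun t j x => lE _ _ j x
  let ψN : (T × (Fin (r + 1) → E) × O) ≃ₗ[R] Nn :=
    (LinearEquiv.prodCongr (LinearEquiv.refl R T)
      (ResMod.rearr' (fun j : J => P (2 * j.1)) (fun j : J => P (2 * j.1 + 1)) R (r + 1))).trans
      (LinearEquiv.ofBijective _ hdecompN)
  have hψN : ∀ t b o, ψN (t, b, o) = lN t + (BE o + ∑ s, BO s (b s)) := fun t b o =>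
    congrArg (lN t + ·)
      (ResMod.rearr'_apply (fun j : J => be j.1 j.2) (fun j : J => bo j.1 j.2) o b)
  have zBE : ∀ o, ResMod.ZZ R (r + 2) • BE o = - BO 0 (β o) := by
    have : ResMod.ZL R (r + 2) Nn ∘ₗ BE = - (BO 0 ∘ₗ β) := by
      refine DirectSum.linearMap_ext R fun j => LinearMap.ext fun x => ?_
      simp only [LinearMap.comp_apply, LinearMap.neg_apply, hβ, hBO, hBE]
      exact hZeN j.1 j.2 x
    exact fun o => LinearMap.congr_fun this o
  have zBO : ∀ (t : Fin r) e, ResMod.ZZ R (r + 2) • BO t.castSucc e = BO t.succ e := by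
    intro t
    have : ResMod.ZL R (r + 2) Nn ∘ₗ BO t.castSucc = BO t.succ := by
      refine DirectSum.linearMap_ext R fun j => LinearMap.ext fun x => ?_
      simp only [LinearMap.comp_apply, hBO]
      exact hZoN j.1 j.2 t.castSucc (by simp) x
    exact fun o => LinearMap.congr_fun this o
  have zBl : ∀ e, ResMod.ZZ R (r + 2) • BO (Fin.last r) e = - lN (εE e) - BE (α e) := by
    have : ResMod.ZL R (r + 2) Nn ∘ₗ BO (Fin.last r) = - (lN ∘ₗ εE) - BE ∘ₗ α := by
      refine DirectSum.linearMap_ext R fun j => LinearMap.ext fun x => ?_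
      obtain ⟨_ | j, hj⟩ := j
      · simp only [LinearMap.comp_apply, LinearMap.sub_apply, LinearMap.neg_apply, hα0, hε0,
          map_zero, sub_zero, hBO]
        exact hZlast0N hj (by omega) x
      · simp only [LinearMap.comp_apply, LinearMap.sub_apply, LinearMap.neg_apply, hαs, hεs,
          map_zero, neg_zero, zero_sub, hBO, hBE]
        exact hZlastN j hj (hlt j hj) (by omega) x
    exact fun o => LinearMap.congr_fun this o
  have hN : ∀ t b o, ResMod.ZZ R (r + 2) • ψN (t, b, o) =
      ψN (-εE (b (Fin.last r)), Fin.cons (-β o) (ResMod.dropLast b), -α (b (Fin.last r))) := by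
    intro t b o
    rw [hψN, hψN, smul_add, smul_add, Finset.smul_sum, Fin.sum_univ_castSucc, Fin.sum_univ_succ,
      hZlN]
    simp only [zBE, zBO, zBl, Fin.cons_zero, Fin.cons_succ, ResMod.dropLast, map_neg]
    abel
  exact ResMod.abstract_main hp h0 α β εE hab hba heb hT ψM hM ψN hN
end

section
/- Let G = ⟨y, z⟩ be elementary abelian of order p², H = ⟨y⟩, k a field of characteristic p, Y = y − 1, Z = z − 1. Let N be the kG-module with basis (over kH·k[Z]-generators) u_0, …, u_{2n-1} subject to the relations Y·u_{2i} = −Z·u_{2i+1} for 0 ≤ i ≤ n−1 and Y^{p-1}·u_{2i-1} = −Z^{p-1}·u_{2i} for 1 ≤ i ≤ n−1 (i.e., N = N(P_*, n) for the minimal resolution P_*). Then N is isomorphic to Ω^{-2n}(k), the 2n-th cosyzygy of the trivial kG-module. -/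
open MonoidAlgebra

namespace CosyzAux

/-- Exponents in the periodic resolution. -/
def cexp (p a : ℕ) : ℕ := if Even a then 1 else p - 1

lemma cexp_add (p : ℕ) (hp : 2 ≤ p) (a : ℕ) : cexp p a + cexp p (a + 1) = p := by
  unfold cexp
  by_cases h : Even a
  · have : ¬ Even (a + 1) := by simpa [Nat.even_add_one] using h
    simp [h, this]; omega
  · have : Even (a + 1) := by simpa [Nat.even_add_one] using h
    simp [h, this]; omega

lemma cexp_pos (p : ℕ) (hp : 2 ≤ p) (a : ℕ) : 1 ≤ cexp p a := by
  unfold cexp; split_ifs <;> omega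

lemma cexp_lt (p : ℕ) (hp : 2 ≤ p) (a : ℕ) : cexp p a < p := by
  unfold cexp; split_ifs <;> omega

/-- The ring facts used. -/
structure Good {A : Type} [CommRing A] (p : ℕ) (Y Z : A) : Prop where
  hp : 2 ≤ p
  hY : Y ^ p = 0
  hZ : Z ^ p = 0
  F1 : ∀ (c : ℕ) (x : A), 1 ≤ c → c < p → Z ^ c * x = 0 → ∃ w, x = Z ^ (p - c) * w
  F2 : ∀ (c : ℕ) (x : A), 1 ≤ c → c < p → Z * x = 0 → Y ^ c * x = 0 →
    ∃ w, x = Y ^ (p - c) * (Z ^ (p - 1) * w)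

section
variable {A : Type} [CommRing A] (p : ℕ) (Y Z : A)

/-- Differential on sequences. -/
def D (j : ℕ) (v : ℕ → A) : ℕ → A
  | 0 => (-1) ^ j * (Y ^ cexp p j * v 0)
  | a + 1 => Z ^ cexp p a * v a + (-1) ^ j * (Y ^ cexp p (j - (a + 1)) * v (a + 1))

lemma D_sub (j : ℕ) (v w : ℕ → A) : D p Y Z j (v - w) = D p Y Z j v - D p Y Z j w := by
  funext a; cases a <;> simp [D] <;> ring

variable {p Y Z}

lemma Good.powY (h : Good p Y Z) {c : ℕ} (hc : p ≤ c) : Y ^ c = 0 := by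
  obtain ⟨d, rfl⟩ := Nat.exists_eq_add_of_le hc
  rw [pow_add, h.hY, zero_mul]

lemma Good.powZ (h : Good p Y Z) {c : ℕ} (hc : p ≤ c) : Z ^ c = 0 := by
  obtain ⟨d, rfl⟩ := Nat.exists_eq_add_of_le hc
  rw [pow_add, h.hZ, zero_mul]

lemma Good.mulZ (h : Good p Y Z) (a : ℕ) (x : A) : Z ^ cexp p (a + 1) * (Z ^ cexp p a * x) = 0 := by
  rw [← mul_assoc, ← pow_add, h.powZ (by have := cexp_add p h.hp a; omega), zero_mul]

lemma Good.mulY (h : Good p Y Z) (a : ℕ) (x : A) : Y ^ cexp p (a + 1) * (Y ^ cexp p a * x) = 0 := by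
  rw [← mul_assoc, ← pow_add, h.powY (by have := cexp_add p h.hp a; omega), zero_mul]

lemma D_D (h : Good p Y Z) (j : ℕ) (v : ℕ → A) (hv : ∀ a, j < a → v a = 0) :
    D p Y Z (j + 1) (D p Y Z j v) = 0 := by
  funext a
  rcases a with _ | _ | a
  · have := h.mulY j (v 0)
    simp only [D, Pi.zero_apply]
    linear_combination ((-1) ^ (j + 1) * (-1) ^ j) * this
  · simp only [D, Pi.zero_apply]
    by_cases hj : j = 0
    · subst hj
      rw [hv 1 (by omega)]
      simp; ring
    · obtain ⟨i, rfl⟩ := Nat.exists_eq_succ_of_ne_zero hj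
      have := h.mulY i (v 1)
      simp only [Nat.succ_eq_add_one, Nat.add_sub_cancel, Nat.zero_add] at *
      linear_combination ((-1) ^ (i + 1 + 1) * (-1) ^ (i+1)) * this
  · simp only [D, Pi.zero_apply]
    have h1 := h.mulZ a (v a)
    have e1 : j + 1 - (a + 1 + 1) = j - (a + 1) := by omega
    rw [e1]
    rcases lt_or_ge j (a + 1 + 1) with hj | hj
    · rw [hv (a+1+1) hj]
      linear_combination h1
    · obtain ⟨i, hi⟩ := Nat.exists_eq_add_of_le hj
      have e2 : j - (a + 1) = i + 1 := by omega
      have e3 : j - (a + 1 + 1) = i := by omega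
      rw [e2, e3]
      have := h.mulY i (v (a + 1 + 1))
      linear_combination h1 + ((-1) ^ (j + 1) * (-1) ^ j) * this

lemma D_exact_aux (h : Good p Y Z) (j : ℕ) (l : ℕ) : l ≤ j + 1 → ∀ (v : ℕ → A),
    (∀ a, l < a → v a = 0) → D p Y Z (j + 1) v = 0 →
    ∃ w : ℕ → A, (∀ a, j < a → w a = 0) ∧ D p Y Z j w = v := by
  induction l with
  | zero =>
    intro _ v hv hD
    have h0 := congrFun hD 0
    have h1 := congrFun hD 1
    simp only [D, Pi.zero_apply, hv 1 (by omega)] at h0 h1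
    have h1' : Z * v 0 = 0 := by simpa [cexp] using h1
    have h0' : Y ^ cexp p (j + 1) * v 0 = 0 := by
      rcases neg_one_pow_eq_or A (j + 1) with e | e <;> rw [e] at h0 <;> simpa using h0
    obtain ⟨w, hw⟩ := h.F2 _ _ (cexp_pos p h.hp _) (cexp_lt p h.hp _) h1' h0'
    have e : p - cexp p (j + 1) = cexp p j := by have := cexp_add p h.hp j; omega
    rw [e] at hw
    refine ⟨Pi.single 0 ((-1) ^ j * (Z ^ (p - 1) * w)), fun a ha => by simp [show a ≠ 0 by omega], ?_⟩
    funext a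
    rcases a with _ | _ | a
    · have : ((-1 : A) ^ j) * (-1) ^ j = 1 := by rw [← mul_pow]; simp
      simp only [D, Pi.single_eq_same]
      rw [hw]
      linear_combination (Y ^ cexp p j * (Z ^ (p - 1) * w)) * this
    · have : Z ^ (1 + (p-1)) = 0 := h.powZ (by omega)
      rw [pow_add] at this
      simp only [D, hv 1 (by omega), zero_add]
      simp [cexp] at *
      linear_combination ((-1) ^ j * w) * this
    · simp [D, hv (a+1+1) (by omega)]
  | succ l ih =>
    intro hl v hv hD
    have h2 := congrFun hD (l + 1 + 1)
    simp only [D, Pi.zero_apply, hv (l + 1 + 1) (by omega), mul_zero, add_zero] at h2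
    obtain ⟨w, hw⟩ := h.F1 _ _ (cexp_pos p h.hp _) (cexp_lt p h.hp _) h2
    have e : p - cexp p (l + 1) = cexp p l := by have := cexp_add p h.hp l; omega
    rw [e] at hw
    have hs : ∀ a, j < a → (Pi.single l w : ℕ → A) a = 0 := fun a ha => by
      simp [show a ≠ l by omega]
    obtain ⟨u, hu, hDu⟩ := ih (by omega) (v - D p Y Z j (Pi.single l w)) (by
      intro a ha
      obtain ⟨b, rfl⟩ : ∃ b, a = b + 1 := ⟨a - 1, by omega⟩
      simp only [Pi.sub_apply, D]
      by_cases hb : b = l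
      · subst hb; simp [hw]
      · rw [hv _ (by omega)]
        simp [show b + 1 ≠ l by omega, hb]) (by rw [D_sub, hD, D_D h j _ hs, sub_zero])
    refine ⟨u + Pi.single l w, fun a ha => by simp [hu a ha, show a ≠ l by omega], ?_⟩
    have e2 : u + Pi.single l w - Pi.single l w = u := add_sub_cancel_right _ _
    have := D_sub p Y Z j (u + Pi.single l w) (Pi.single l w)
    rw [e2, hDu] at this
    exact (sub_left_injective this).symm

/-- Extension by zero. -/
def E {j : ℕ} (v : Fin j → A) : ℕ → A := fun a => if h : a < j then v ⟨a, h⟩ else 0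

lemma E_lt {j : ℕ} (v : Fin j → A) (a : ℕ) (h : a < j) : E v a = v ⟨a, h⟩ := by simp [E, h]
lemma E_ge {j : ℕ} (v : Fin j → A) (a : ℕ) (h : j ≤ a) : E v a = 0 := by simp [E, Nat.not_lt.2 h]
lemma E_add {j : ℕ} (v w : Fin j → A) (a : ℕ) : E (v + w) a = E v a + E w a := by
  by_cases h : a < j <;> simp [E, h]
lemma E_smul {j : ℕ} (r : A) (w : Fin j → A) (a : ℕ) : E (r • w) a = r * E w a := by
  by_cases h : a < j <;> simp [E, h]
lemma E_zero {j : ℕ} : E (0 : Fin j → A) = 0 := by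
  funext a; by_cases h : a < j <;> simp [E, h]
lemma E_res {j : ℕ} (v : ℕ → A) (h : ∀ a, j ≤ a → v a = 0) : E (fun a : Fin j => v a) = v := by
  funext a; by_cases h' : a < j
  · simp [E, h']
  · simp [E, h', h a (by omega)]
lemma E_single {j : ℕ} (a : ℕ) (h : a < j) (x : A) : 
    E (Pi.single (⟨a, h⟩ : Fin j) x) = Pi.single a x := by
  funext b
  by_cases hb : b < j
  · rw [E_lt _ _ hb]; simp [Pi.single_apply, Fin.ext_iff]
  · rw [E_ge _ _ (by omega), Pi.single_eq_of_ne (by omega)]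
lemma E_inj {j : ℕ} {v w : Fin j → A} (h : E v = E w) : v = w := by
  funext a
  have := congrFun h a
  simpa [E] using this

variable (p Y Z)
/-- The standard differential. -/
def dS (j : ℕ) : (Fin (j + 1) → A) →ₗ[A] (Fin (j + 1 + 1) → A) where
  toFun v := fun a => D p Y Z j (E v) a
  map_add' v w := by
    funext ⟨a, ha⟩
    rcases a with _ | a <;> simp [D, E_add] <;> ring
  map_smul' r v := by
    funext ⟨a, ha⟩
    rcases a with _ | a <;> simp [D, E_smul] <;> ring

lemma E_dS (j : ℕ) (v : Fin (j + 1) → A) : E (dS p Y Z j v) = D p Y Z j (E v) := by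
  refine E_res (D p Y Z j (E v)) ?_
  intro a ha
  obtain ⟨b, rfl⟩ : ∃ b, a = b + 1 := ⟨a - 1, by omega⟩
  simp [D, E_ge v b (by omega), E_ge v (b+1) (by omega)]

variable {p Y Z}
lemma dS_exact (h : Good p Y Z) (j : ℕ) :
    LinearMap.range (dS p Y Z j) = LinearMap.ker (dS p Y Z (j + 1)) := by
  ext v
  constructor
  · rintro ⟨w, rfl⟩
    rw [LinearMap.mem_ker]
    apply E_inj
    rw [E_dS, E_dS, D_D h j _ (fun a ha => E_ge w a (by omega)), E_zero]
  · intro hv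
    rw [LinearMap.mem_ker] at hv
    have : D p Y Z (j + 1) (E v) = 0 := by rw [← E_dS, hv, E_zero]
    obtain ⟨w, hw, hD⟩ := D_exact_aux h j (j + 1) le_rfl (E v)
      (fun a ha => E_ge v a (by omega)) this
    refine ⟨fun a => w a, ?_⟩
    apply E_inj
    rw [E_dS, E_res w (fun a ha => hw a (by omega)), hD]

lemma dS_soc (h : Good p Y Z) (j : ℕ) (b : Fin (j + 1 + 1) → A) :
    (Y ^ (p - 1) * Z ^ (p - 1)) • b ∈ LinearMap.range (dS p Y Z j) := by
  have key : ∀ (a : ℕ) (ha : a < j + 1 + 1) (x : A),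
      Pi.single (⟨a, ha⟩ : Fin (j + 1 + 1)) (Y ^ (p - 1) * Z ^ (p - 1) * x)
        ∈ LinearMap.range (dS p Y Z j) := by
    intro a ha x
    rcases a with _ | a
    · refine ⟨Pi.single (⟨0, by omega⟩ : Fin (j + 1))
        ((-1) ^ j * (Y ^ (p - 1 - cexp p j) * Z ^ (p - 1) * x)), ?_⟩
      apply E_inj
      rw [E_dS, E_single, E_single]
      have e1 : ((-1 : A) ^ j) * (-1) ^ j = 1 := by rw [← mul_pow]; simp
      have e2 : Y ^ (p - 1) = Y ^ cexp p j * Y ^ (p - 1 - cexp p j) := by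
        rw [← pow_add]; congr 1; have := cexp_lt p h.hp j; omega
      have e3 : Z ^ (1 + (p-1)) = 0 := h.powZ (by omega)
      rw [pow_add, pow_one] at e3
      funext b
      rcases b with _ | _ | b
      · simp only [D, Pi.single_eq_same, e2]
        linear_combination (Y ^ cexp p j * Y ^ (p - 1 - cexp p j) * Z ^ (p - 1) * x) * e1
      · have e4 : cexp p 0 = 1 := by simp [cexp]
        simp [D, e4]
        linear_combination ((-1) ^ j * (Y ^ (p - 1 - cexp p j) * x)) * e3
      · simp [D]
    · refine ⟨Pi.single (⟨a, by omega⟩ : Fin (j + 1))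
        (Z ^ (p - 1 - cexp p a) * Y ^ (p - 1) * x), ?_⟩
      apply E_inj
      rw [E_dS, E_single, E_single]
      have e2 : Z ^ (p - 1) = Z ^ cexp p a * Z ^ (p - 1 - cexp p a) := by
        rw [← pow_add]; congr 1; have := cexp_lt p h.hp a; omega
      have e3 : ∀ i, Y ^ cexp p i * Y ^ (p-1) = 0 := fun i => by
        rw [← pow_add]; exact h.powY (by have := cexp_pos p h.hp i; omega)
      funext b
      rcases b with _ | b
      · rcases a with _ | a
        · simp [D]
          linear_combination ((Z ^ (p - 1 - cexp p 0) * x)) * e3 j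
        · simp [D]
      · simp only [D]
        by_cases hb : b = a
        · subst hb
          simp [e2]; ring
        · by_cases hb2 : b + 1 = a
          · subst hb2
            simp 
            linear_combination ((Z ^ (p - 1 - cexp p (b+1)) * x)) * e3 (j - (b+1))
          · simp [hb, hb2]
  have : (Y ^ (p - 1) * Z ^ (p - 1)) • b =
      ∑ a, Pi.single a (Y ^ (p - 1) * Z ^ (p - 1) * b a) := by
    rw [Finset.univ_sum_single]; rfl
  rw [this]
  exact Submodule.sum_mem _ fun a _ => key a.1 a.2 _

lemma nilp_max {M : Type} [AddCommGroup M] [Module A M] (Y : A) (p : ℕ) (hY : Y ^ p = 0)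
    (x : M) (hx : x ≠ 0) : ∃ i, Y ^ i • x ≠ 0 ∧ Y • (Y ^ i • x) = 0 := by
  classical
  have hex : ∃ i, Y ^ i • x = 0 := ⟨p, by rw [hY, zero_smul]⟩
  have h0 : Nat.find hex ≠ 0 := fun h => by
    have := Nat.find_spec hex
    rw [h] at this; simp at this; exact hx this
  obtain ⟨i, hi⟩ := Nat.exists_eq_succ_of_ne_zero h0
  refine ⟨i, Nat.find_min hex (by omega), ?_⟩
  have := Nat.find_spec hex
  rw [hi, Nat.succ_eq_add_one, pow_succ', mul_smul] at this
  exact this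

lemma dS_ess (h : Good p Y Z) (j : ℕ) (x : Fin (j + 1 + 1) → A) (hx : x ≠ 0) :
    ∃ a : A, a • x ≠ 0 ∧ a • x ∈ LinearMap.range (dS p Y Z j) := by
  obtain ⟨i, hi, hi'⟩ := nilp_max Y p h.hY x hx
  obtain ⟨l, hl, hl'⟩ := nilp_max Z p h.hZ _ hi
  refine ⟨Z ^ l * Y ^ i, by rwa [mul_smul], ?_⟩
  rw [mul_smul]
  set u := Z ^ l • Y ^ i • x with hu
  have hYu : Y • u = 0 := by rw [hu, smul_comm, hi', smul_zero]
  have : ∀ a, ∃ w, u a = Y ^ (p - 1) * (Z ^ (p - 1) * w) := fun a =>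
    h.F2 1 (u a) le_rfl (by have := h.hp; omega) (congrFun hl' a) 
      (by rw [pow_one]; exact congrFun hYu a)
  choose w hw using this
  have : u = (Y ^ (p - 1) * Z ^ (p - 1)) • w := by
    funext a; rw [hw a]; simp [mul_assoc]
  rw [this]
  exact dS_soc h j w

end

lemma step {A S S' I I' : Type} [CommRing A] [AddCommGroup S] [AddCommGroup S'] [AddCommGroup I]
    [AddCommGroup I'] [Module A S] [Module A S'] [Module A I] [Module A I']
    (d : S →ₗ[A] S') (e : I →ₗ[A] I') (φ : S ≃ₗ[A] I)
    (hφ : (LinearMap.ker d).map (φ : S →ₗ[A] I) = LinearMap.ker e)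
    (hinj : ∀ (N : Submodule A S') (f : N →ₗ[A] I'), ∃ F : S' →ₗ[A] I', ∀ x : N, F x = f x)
    (hess : ∀ x : S', x ≠ 0 → ∃ a : A, a • x ≠ 0 ∧ a • x ∈ LinearMap.range d)
    (hdim : ∀ F : S' →ₗ[A] I', Function.Injective F → Function.Surjective F) :
    ∃ φ' : S' ≃ₗ[A] I', (LinearMap.range d).map (φ' : S' →ₗ[A] I') = LinearMap.range e := by
  have hle : LinearMap.ker d ≤ LinearMap.ker (e.comp (φ : S →ₗ[A] I)) := by
    intro x hx
    have : (φ : S →ₗ[A] I) x ∈ LinearMap.ker e := hφ ▸ Submodule.mem_map_of_mem hx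
    exact this
  obtain ⟨F, hF⟩ := hinj (LinearMap.range d)
    (((LinearMap.ker d).liftQ (e.comp (φ : S →ₗ[A] I)) hle).comp
      (d.quotKerEquivRange.symm : LinearMap.range d →ₗ[A] S ⧸ LinearMap.ker d))
  have hFd : ∀ v, F (d v) = e (φ v) := by
    intro v
    have := hF ⟨d v, v, rfl⟩
    rw [this]
    have h2 : d.quotKerEquivRange.symm ⟨d v, v, rfl⟩ = Submodule.Quotient.mk v := by
      rw [LinearEquiv.symm_apply_eq]; rfl
    simp [h2]
  have hFi : Function.Injective F := by
    rw [injective_iff_map_eq_zero]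
    intro x hx
    by_contra hne
    obtain ⟨a, ha, v, hv⟩ := hess x hne
    have h1 : e (φ v) = 0 := by rw [← hFd, hv, map_smul, hx, smul_zero]
    have h2 : φ v ∈ (LinearMap.ker d).map (φ : S →ₗ[A] I) := by rw [hφ]; exact h1
    obtain ⟨w, hw, hwv⟩ := h2
    have : w = v := φ.injective hwv
    subst this
    exact ha (by rw [← hv]; exact hw)
  refine ⟨LinearEquiv.ofBijective F ⟨hFi, hdim F hFi⟩, ?_⟩
  ext x
  constructor
  · rintro ⟨_, ⟨v, rfl⟩, rfl⟩
    exact ⟨φ v, (hFd v).symm⟩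
  · rintro ⟨w, rfl⟩
    exact ⟨d (φ.symm w), ⟨_, rfl⟩, (hFd _).trans (by simp)⟩

lemma range_dS_eq {A : Type} [CommRing A] (p : ℕ) (Y Z : A) (m : ℕ) :
    LinearMap.range (dS p Y Z (2 * m)) = 
    Submodule.span A
          (({v : Fin (2 * m + 2) → A |
              ∃ (j : ℕ) (h : 2 * j + 1 < 2 * m + 2),
              v = Y • (Pi.single (⟨2 * j, Nat.lt_of_succ_lt h⟩ : Fin (2 * m + 2))
                    (1 : A) : Fin (2 * m + 2) → A) +
                  Z • (Pi.single (⟨2 * j + 1, h⟩ : Fin (2 * m + 2))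
                    (1 : A) : Fin (2 * m + 2) → A)} ∪
            {v : Fin (2 * m + 2) → A |
              ∃ (j : ℕ) (h : 2 * j + 2 < 2 * m + 2),
              v = Y ^ (p - 1) • (Pi.single (⟨2 * j + 1, Nat.lt_of_succ_lt h⟩ : Fin (2 * m + 2))
                    (1 : A) : Fin (2 * m + 2) → A) +
                  Z ^ (p - 1) • (Pi.single (⟨2 * j + 2, h⟩ : Fin (2 * m + 2))
                    (1 : A) : Fin (2 * m + 2) → A)}) :
            Set (Fin (2 * m + 2) → A)) := by
  have key : ∀ (a : ℕ) (ha : a < 2 * m + 1), 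
      dS p Y Z (2 * m) (Pi.single ⟨a, ha⟩ 1) = 
      Y ^ cexp p a • (Pi.single (⟨a, by omega⟩ : Fin (2 * m + 2)) (1 : A)) +
        Z ^ cexp p a • (Pi.single (⟨a + 1, by omega⟩ : Fin (2 * m + 2)) (1 : A)) := by
    intro a ha
    have hc : cexp p (2 * m - a) = cexp p a := by
      unfold cexp
      simp only [Nat.even_sub (show a ≤ 2 * m by omega)]; simp
    apply E_inj
    rw [E_dS, E_single]
    funext b
    rw [E_add, E_smul, E_smul, E_single, E_single]
    rcases b with _ | b
    · rcases a with _ | a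
      · simp [D]; simpa using congrArg (Y ^ ·) hc
      · simp [D]
    · simp only [D]
      by_cases h1 : b = a
      · subst h1; simp
      · by_cases h2 : b + 1 = a
        · subst h2; simp [hc]
        · simp [h1, h2]
  apply le_antisymm
  · rw [LinearMap.range_eq_map, ← (Pi.basisFun A (Fin (2 * m + 1))).span_eq, Submodule.map_span,
      Submodule.span_le]
    rintro _ ⟨_, ⟨⟨a, ha⟩, rfl⟩, rfl⟩
    apply Submodule.subset_span
    rw [Pi.basisFun_apply, key]
    rcases Nat.even_or_odd' a with ⟨j, rfl | rfl⟩
    · left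
      refine ⟨j, by omega, ?_⟩
      simp [cexp]
    · right
      refine ⟨j, by omega, ?_⟩
      simp [cexp]
  · rw [Submodule.span_le]
    rintro _ (⟨j, h, rfl⟩ | ⟨j, h, rfl⟩)
    · refine ⟨Pi.single ⟨2 * j, by omega⟩ 1, ?_⟩
      rw [key]; simp [cexp]
    · refine ⟨Pi.single ⟨2 * j + 1, by omega⟩ 1, ?_⟩
      rw [key]; simp [cexp]

end CosyzAux

namespace CosyzAux

lemma selfinj {k G M : Type} [Field k] [CommGroup G] [Finite G] [AddCommGroup M] [Module k M]
    [Module (MonoidAlgebra k G) M] [IsScalarTower k (MonoidAlgebra k G) M]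
    (N : Submodule (MonoidAlgebra k G) M) (f : N →ₗ[MonoidAlgebra k G] MonoidAlgebra k G) :
    ∃ F : M →ₗ[MonoidAlgebra k G] MonoidAlgebra k G, ∀ x : N, F x = f x := by
  let lam : MonoidAlgebra k G →ₗ[k] k :=
    { toFun := fun x => x.coeff 1
      map_add' := fun x y => by simp
      map_smul' := fun r x => by simp }
  let N' : Submodule k M := N.restrictScalars k
  let f' : N' →ₗ[k] k := lam.comp (f.restrictScalars k : N →ₗ[k] MonoidAlgebra k G)
  obtain ⟨g, hg⟩ := LinearMap.exists_extend f'
  let F : M →ₗ[k] MonoidAlgebra k G :=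
    { toFun := fun m => MonoidAlgebra.ofCoeff
        (Finsupp.equivFunOnFinite.symm fun h => g (MonoidAlgebra.single h⁻¹ (1 : k) • m))
      map_add' := fun x y => by
        ext h
        simp [smul_add]
      map_smul' := fun r x => by
        ext h
        have : MonoidAlgebra.single h⁻¹ (1 : k) • r • x = r • MonoidAlgebra.single h⁻¹ (1 : k) • x :=
          smul_algebra_smul_comm _ _ _
        simp [this] }
  have hF : ∀ m h, (F m).coeff h = g (MonoidAlgebra.single h⁻¹ (1 : k) • m) := fun m h => rfl
  refine ⟨MonoidAlgebra.equivariantOfLinearOfComm F ?_, ?_⟩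
  · intro a v
    ext h
    rw [hF, smul_smul, smul_eq_mul, MonoidAlgebra.coeff_single_mul_apply, hF]
    simp [MonoidAlgebra.single_mul_single]
  · intro x
    rw [MonoidAlgebra.equivariantOfLinearOfComm_apply]
    ext h
    rw [hF]
    have := LinearMap.congr_fun hg (⟨MonoidAlgebra.single h⁻¹ (1 : k) • (x : M),
      N.smul_mem _ x.2⟩ : N')
    have h2 : f' (⟨MonoidAlgebra.single h⁻¹ (1 : k) • (x : M), N.smul_mem _ x.2⟩ : N') =
        (f (MonoidAlgebra.single h⁻¹ (1 : k) • x)).coeff 1 := rfl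
    rw [h2, map_smul] at this
    refine this.trans ?_
    rw [smul_eq_mul, MonoidAlgebra.coeff_single_mul_apply]
    simp

section mono
variable {k A : Type} [Field k] [CommRing A] [Algebra k A]

lemma shift (p c : ℕ) (hc : c ≤ p) (b : ℕ → k) (g : ℕ → A) (hg : ∀ n, p ≤ n → g n = 0) :
    ∑ j ∈ Finset.range p, b j • g (j + c) =
      ∑ j ∈ Finset.range p, (if c ≤ j then b (j - c) else 0) • g j := by
  obtain ⟨q, rfl⟩ := Nat.exists_eq_add_of_le hc
  conv_lhs => rw [Nat.add_comm c q]
  rw [Finset.sum_range_add, Finset.sum_range_add]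
  have h1 : ∑ x ∈ Finset.range c, b (q + x) • g (q + x + c) = 0 :=
    Finset.sum_eq_zero fun x _ => by rw [hg _ (by omega), smul_zero]
  have h2 : ∑ x ∈ Finset.range c, (if c ≤ x then b (x - c) else 0) • g x = 0 :=
    Finset.sum_eq_zero fun x hx => by
      rw [if_neg (by simpa using hx), zero_smul]
  rw [h1, h2, add_zero, zero_add]
  refine Finset.sum_congr rfl fun x _ => ?_
  rw [if_pos (by omega), Nat.add_comm c x, Nat.add_sub_cancel]

/-- Polynomial expression with given coefficients. -/
def Lf (p : ℕ) (Y Z : A) (a : ℕ → ℕ → k) : A :=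
  ∑ i ∈ Finset.range p, ∑ j ∈ Finset.range p, a i j • (Y ^ i * Z ^ j)

variable {p : ℕ} {Y Z : A}

lemma Lf_Z (hZ : Z ^ p = 0) (c : ℕ) (hc : c ≤ p) (a : ℕ → ℕ → k) :
    Z ^ c * Lf p Y Z a = Lf p Y Z (fun i j => if c ≤ j then a i (j - c) else 0) := by
  unfold Lf
  rw [Finset.mul_sum]
  refine Finset.sum_congr rfl fun i _ => ?_
  rw [← shift p c hc (a i) (fun n => Y ^ i * Z ^ n) (fun n hn => by
    obtain ⟨d, rfl⟩ := Nat.exists_eq_add_of_le hn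
    rw [pow_add, hZ]; ring), Finset.mul_sum]
  refine Finset.sum_congr rfl fun j _ => ?_
  rw [mul_smul_comm, pow_add]
  congr 1; ring

lemma Lf_Y (hY : Y ^ p = 0) (c : ℕ) (hc : c ≤ p) (a : ℕ → ℕ → k) :
    Y ^ c * Lf p Y Z a = Lf p Y Z (fun i j => if c ≤ i then a (i - c) j else 0) := by
  unfold Lf
  rw [Finset.sum_comm, Finset.mul_sum, Finset.sum_comm]
  rw [Finset.sum_comm]
  conv_rhs => rw [Finset.sum_comm]
  refine Finset.sum_congr rfl fun j _ => ?_
  rw [← shift p c hc (fun i => a i j) (fun n => Y ^ n * Z ^ j) (fun n hn => by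
    obtain ⟨d, rfl⟩ := Nat.exists_eq_add_of_le hn
    rw [pow_add, hY]; ring), Finset.mul_sum]
  refine Finset.sum_congr rfl fun i _ => ?_
  rw [mul_smul_comm, pow_add]
  congr 1; ring

lemma good_of_mono (hp : 2 ≤ p) (hY : Y ^ p = 0) (hZ : Z ^ p = 0)
    (hs : ∀ x : A, ∃ a : ℕ → ℕ → k, x = Lf p Y Z a)
    (hi : ∀ a : ℕ → ℕ → k, Lf p Y Z a = 0 → ∀ i j, i < p → j < p → a i j = 0) :
    Good p Y Z := by
  have kZ : ∀ (c : ℕ) (a : ℕ → ℕ → k), c ≤ p → Z ^ c * Lf p Y Z a = 0 →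
      ∀ i j, i < p → j < p - c → a i j = 0 := by
    intro c a hc h i j hi' hj
    rw [Lf_Z hZ c hc] at h
    simpa using hi _ h i (j + c) hi' (by omega)
  have kY : ∀ (c : ℕ) (a : ℕ → ℕ → k), c ≤ p → Y ^ c * Lf p Y Z a = 0 →
      ∀ i j, i < p - c → j < p → a i j = 0 := by
    intro c a hc h i j hi' hj
    rw [Lf_Y hY c hc] at h
    simpa using hi _ h (i + c) j (by omega) hj
  refine ⟨hp, hY, hZ, ?_, ?_⟩
  · intro c x h1 hc h
    obtain ⟨a, rfl⟩ := hs x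
    have := kZ c a hc.le h
    change Z ^ (p - c) ∣ _
    refine Finset.dvd_sum fun i hi => Finset.dvd_sum fun j hj => ?_
    rw [Finset.mem_range] at hi hj
    by_cases hjc : j < p - c
    · rw [this i j hi hjc]; simp
    · refine Dvd.dvd.trans ?_ (dvd_smul_of_dvd _ (dvd_refl _))
      exact Dvd.dvd.mul_left (pow_dvd_pow _ (by omega)) _
  · intro c x h1 hc h h'
    obtain ⟨a, rfl⟩ := hs x
    have e1 := kZ 1 a (by omega) (by simpa using h)
    have e2 := kY c a hc.le h'
    suffices Y ^ (p - c) * Z ^ (p - 1) ∣ Lf p Y Z a by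
      obtain ⟨w, hw⟩ := this
      exact ⟨w, by rw [hw, mul_assoc]⟩
    refine Finset.dvd_sum fun i hi => Finset.dvd_sum fun j hj => ?_
    rw [Finset.mem_range] at hi hj
    by_cases hjc : j < p - 1
    · rw [e1 i j hi hjc]; simp
    · by_cases hic : i < p - c
      · rw [e2 i j hic hj]; simp
      · refine Dvd.dvd.trans ?_ (dvd_smul_of_dvd _ (dvd_refl _))
        exact mul_dvd_mul (pow_dvd_pow _ (by omega)) (pow_dvd_pow _ (by omega))

lemma aug_of_mono (hp : 2 ≤ p) (hY : Y ^ p = 0) (hZ : Z ^ p = 0)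
    (hs : ∀ x : A, ∃ a : ℕ → ℕ → k, x = Lf p Y Z a) (w : A) :
    ∃ c : k, Y ^ (p - 1) * (Z ^ (p - 1) * w) = c • (Y ^ (p - 1) * Z ^ (p - 1)) := by
  obtain ⟨a, rfl⟩ := hs w
  refine ⟨a 0 0, ?_⟩
  rw [Lf_Z hZ _ (by omega), Lf_Y hY _ (by omega)]
  unfold Lf
  rw [Finset.sum_eq_single (p - 1), Finset.sum_eq_single (p - 1)]
  · simp
  · intro b hb hb'
    rw [Finset.mem_range] at hb
    simp [show ¬ (p - 1 ≤ b) by omega]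
  · intro h; exact absurd (Finset.mem_range.2 (by omega)) h
  · intro b hb hb'
    rw [Finset.mem_range] at hb
    simp [show ¬ (p - 1 ≤ b) by omega]
  · intro h; exact absurd (Finset.mem_range.2 (by omega)) h

end mono

section conc
variable {k : Type} [Field k] {p : ℕ}

lemma conc_facts (hp : p.Prime) [CharP k p]
    (Y Z : MonoidAlgebra k (Multiplicative (ZMod p × ZMod p)))
    (hY : Y = MonoidAlgebra.single (Multiplicative.ofAdd ((1 : ZMod p), (0 : ZMod p))) (1 : k) - 1)
    (hZ : Z = MonoidAlgebra.single (Multiplicative.ofAdd ((0 : ZMod p), (1 : ZMod p))) (1 : k) - 1) :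
    Y ^ p = 0 ∧ Z ^ p = 0 ∧ (∀ x, ∃ a : ℕ → ℕ → k, x = Lf p Y Z a) ∧
    (∀ a : ℕ → ℕ → k, Lf p Y Z a = 0 → ∀ i j, i < p → j < p → a i j = 0) := by
  have : Fact p.Prime := ⟨hp⟩
  have : CharP (MonoidAlgebra k (Multiplicative (ZMod p × ZMod p))) p :=
    charP_of_injective_algebraMap (FaithfulSMul.algebraMap_injective k _) p
  have hYp : Y ^ p = 0 := by
    rw [hY, sub_pow_char, MonoidAlgebra.single_pow, ← ofAdd_nsmul]
    simp [MonoidAlgebra.one_def]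
    exact sub_self _
  have hZp : Z ^ p = 0 := by
    rw [hZ, sub_pow_char, MonoidAlgebra.single_pow, ← ofAdd_nsmul]
    simp [MonoidAlgebra.one_def]
    exact sub_self _
  let mono : Fin p × Fin p → MonoidAlgebra k (Multiplicative (ZMod p × ZMod p)) :=
    fun ij => Y ^ (ij.1 : ℕ) * Z ^ (ij.2 : ℕ)
  let P := Submodule.span k (Set.range mono)
  have hmem : ∀ i j : ℕ, Y ^ i * Z ^ j ∈ P := by
    intro i j
    by_cases h : i < p ∧ j < p
    · exact Submodule.subset_span ⟨(⟨i, h.1⟩, ⟨j, h.2⟩), rfl⟩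
    · have : Y ^ i * Z ^ j = 0 := by
        rw [not_and_or, not_lt, not_lt] at h
        rcases h with h | h
        · rw [pow_eq_zero_of_le h hYp, zero_mul]
        · rw [pow_eq_zero_of_le h hZp, mul_zero]
      rw [this]; exact P.zero_mem
  have hPY : ∀ x ∈ P, Y * x ∈ P := by
    intro x hx
    induction hx using Submodule.span_induction with
    | mem x h =>
      obtain ⟨ij, rfl⟩ := h
      have : Y * mono ij = Y ^ (ij.1 + 1 : ℕ) * Z ^ (ij.2 : ℕ) := by simp only [mono]; ring
      rw [this]; exact hmem _ _
    | zero => simp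
    | add x y _ _ h1 h2 => rw [mul_add]; exact P.add_mem h1 h2
    | smul r x _ h => rw [mul_smul_comm]; exact P.smul_mem _ h
  have hPZ : ∀ x ∈ P, Z * x ∈ P := by
    intro x hx
    induction hx using Submodule.span_induction with
    | mem x h =>
      obtain ⟨ij, rfl⟩ := h
      have : Z * mono ij = Y ^ (ij.1 : ℕ) * Z ^ (ij.2 + 1 : ℕ) := by simp only [mono]; ring
      rw [this]; exact hmem _ _
    | zero => simp
    | add x y _ _ h1 h2 => rw [mul_add]; exact P.add_mem h1 h2
    | smul r x _ h => rw [mul_smul_comm]; exact P.smul_mem _ h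
  have hyi : ∀ i : ℕ, ∀ x ∈ P, (Y + 1) ^ i * x ∈ P := by
    intro i
    induction i with
    | zero => intro x hx; simpa using hx
    | succ i ih =>
      intro x hx
      rw [pow_succ, mul_assoc]
      apply ih
      rw [add_mul, one_mul]
      exact P.add_mem (hPY x hx) hx
  have hzi : ∀ i : ℕ, ∀ x ∈ P, (Z + 1) ^ i * x ∈ P := by
    intro i
    induction i with
    | zero => intro x hx; simpa using hx
    | succ i ih =>
      intro x hx
      rw [pow_succ, mul_assoc]
      apply ih
      rw [add_mul, one_mul]
      exact P.add_mem (hPZ x hx) hx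
  have hone : (1 : MonoidAlgebra k (Multiplicative (ZMod p × ZMod p))) ∈ P := by
    simpa using hmem 0 0
  have hsingle : ∀ (g : Multiplicative (ZMod p × ZMod p)), MonoidAlgebra.single g (1 : k) ∈ P := by
    intro g
    have h1 := hyi (g.toAdd.1.val) _ (hzi (g.toAdd.2.val) _ hone)
    rw [hY, hZ, sub_add_cancel, sub_add_cancel, MonoidAlgebra.single_pow, MonoidAlgebra.single_pow,
      mul_one, MonoidAlgebra.single_mul_single, ← ofAdd_nsmul, ← ofAdd_nsmul, ← ofAdd_add] at h1
    have e : Multiplicative.ofAdd (g.toAdd.1.val • ((1 : ZMod p), (0 : ZMod p)) +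
        g.toAdd.2.val • ((0 : ZMod p), (1 : ZMod p))) = g := by
      apply Multiplicative.toAdd.injective
      ext <;> simp
    rw [e] at h1
    simpa using h1
  have htop : ⊤ ≤ P := by
    intro x _
    induction x using MonoidAlgebra.induction_linear with
    | zero => exact P.zero_mem
    | add x y h1 h2 => exact P.add_mem (h1 trivial) (h2 trivial)
    | single g r =>
      have := P.smul_mem r (hsingle g)
      simpa using this
  have hcard : Fintype.card (Fin p × Fin p) =
      Module.finrank k (MonoidAlgebra k (Multiplicative (ZMod p × ZMod p))) := by
    rw [Module.finrank_eq_nat_card_basis (MonoidAlgebra.basis _ k)]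
    simp [Nat.card_eq_fintype_card]
  have hli := linearIndependent_of_top_le_span_of_card_eq_finrank htop hcard
  refine ⟨hYp, hZp, ?_, ?_⟩
  · intro x
    obtain ⟨c, hc⟩ := (Submodule.mem_span_range_iff_exists_fun k).1 (htop (Submodule.mem_top : x ∈ ⊤))
    refine ⟨fun i j => if h : i < p ∧ j < p then c (⟨i, h.1⟩, ⟨j, h.2⟩) else 0, ?_⟩
    rw [← hc, Fintype.sum_prod_type]
    simp [Lf, Finset.sum_range, mono]
  · intro a ha i j hi hj
    have := Fintype.linearIndependent_iff.1 hli (fun ij => a ij.1 ij.2) (by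
      rw [← ha, Fintype.sum_prod_type]
      simp [Lf, Finset.sum_range, mono]) (⟨i, hi⟩, ⟨j, hj⟩)
    exact this

end conc

lemma main_abs {k A : Type} [Field k] [CommRing A] [Algebra k A] [Module.Finite k A]
    {p : ℕ} {Y Z : A} (hG : Good p Y Z)
    (haug : ∀ w : A, ∃ c : k, Y ^ (p - 1) * (Z ^ (p - 1) * w) = c • (Y ^ (p - 1) * Z ^ (p - 1)))
    (hself : ∀ (r : ℕ) (N : Submodule A (Fin r → A)) (f : N →ₗ[A] A),
      ∃ F : (Fin r → A) →ₗ[A] A, ∀ x : N, F x = f x)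
    (m : ℕ) (T : Type) [AddCommGroup T] [Module A T] (t0 : T) (ht0 : t0 ≠ 0)
    (hTY : ∀ t : T, Y • t = 0) (hTZ : ∀ t : T, Z • t = 0)
    (I : ℕ → Type) [∀ j, AddCommGroup (I j)] [∀ j, Module A (I j)]
    (hIfree : ∀ j, Nonempty (I j ≃ₗ[A] (Fin (j + 1) → A)))
    (f0 : T →ₗ[A] I 0) (hinj : Function.Injective f0)
    (dI : ∀ j, I j →ₗ[A] I (j + 1))
    (hex0 : LinearMap.range f0 = LinearMap.ker (dI 0))
    (hex : ∀ j, j < 2 * m → LinearMap.range (dI j) = LinearMap.ker (dI (j + 1))) :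
    ∃ φ : (Fin (2 * m + 1 + 1) → A) ≃ₗ[A] I (2 * m + 1),
      (LinearMap.range (dS p Y Z (2 * m))).map (φ : (Fin (2 * m + 1 + 1) → A) →ₗ[A] I (2 * m + 1))
        = LinearMap.range (dI (2 * m)) := by
  have stp : ∀ j (φ : (Fin (j + 1) → A) ≃ₗ[A] I j),
      (LinearMap.ker (dS p Y Z j)).map (φ : (Fin (j + 1) → A) →ₗ[A] I j) = LinearMap.ker (dI j) →
      ∃ φ' : (Fin (j + 1 + 1) → A) ≃ₗ[A] I (j + 1),
        (LinearMap.range (dS p Y Z j)).map (φ' : (Fin (j + 1 + 1) → A) →ₗ[A] I (j + 1))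
          = LinearMap.range (dI j) := by
    intro j φ hφ
    obtain ⟨ψ⟩ := hIfree (j + 1)
    refine step (dS p Y Z j) (dI j) φ hφ ?_ (dS_ess hG j) ?_
    · intro N f
      have : ∀ a, ∃ F : (Fin (j + 1 + 1) → A) →ₗ[A] A, ∀ x : N, F x = ψ (f x) a := fun a =>
        hself _ N ((LinearMap.proj a).comp ((ψ : I (j + 1) →ₗ[A] (Fin (j + 1 + 1) → A)).comp f))
      choose F hF using this
      refine ⟨(ψ.symm : (Fin (j + 1 + 1) → A) →ₗ[A] I (j + 1)).comp (LinearMap.pi F), fun x => ?_⟩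
      apply ψ.injective
      funext a
      simp [hF]
    · intro F hF
      have h1 : Function.Injective
          (((ψ : I (j + 1) →ₗ[A] (Fin (j + 1 + 1) → A)).comp F).restrictScalars k) := ψ.injective.comp hF
      have h2 := LinearMap.injective_iff_surjective.1 h1
      intro y
      obtain ⟨x, hx⟩ := h2 (ψ y)
      exact ⟨x, ψ.injective hx⟩
  have mem0 : ∀ v : Fin (0 + 1) → A, v ∈ LinearMap.ker (dS p Y Z 0) ↔
      Y * v 0 = 0 ∧ Z * v 0 = 0 := by
    intro v
    have e0 : E v 0 = v 0 := rfl
    have e1 : E v 1 = 0 := rfl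
    have c0 : cexp p 0 = 1 := rfl
    rw [LinearMap.mem_ker]
    constructor
    · intro h
      have h0 := congrFun h 0
      have h1 := congrFun h 1
      have h0' : D p Y Z 0 (E v) 0 = 0 := h0
      have h1' : D p Y Z 0 (E v) (0 + 1) = 0 := h1
      simp only [D, e0, e1, c0, zero_add] at h0' h1'
      exact ⟨by simpa using h0', by simpa using h1'⟩
    · rintro ⟨h0, h1⟩
      funext a
      change D p Y Z 0 (E v) a = 0
      rcases a with ⟨_ | _ | a, ha⟩
      · simp [D, e0, c0, h0]
      · simp [D, e0, e1, c0, h1]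
      · omega
  have hker : ∀ j, j ≤ 2 * m → ∃ φ : (Fin (j + 1) → A) ≃ₗ[A] I j,
      (LinearMap.ker (dS p Y Z j)).map (φ : (Fin (j + 1) → A) →ₗ[A] I j) = LinearMap.ker (dI j) := by
    intro j
    induction j with
    | zero =>
      intro _
      obtain ⟨ψ⟩ := hIfree 0
      refine ⟨ψ.symm, ?_⟩
      rw [← hex0]
      have hin : ∀ t, ψ (f0 t) ∈ LinearMap.ker (dS p Y Z 0) := by
        intro t
        rw [mem0]
        constructor
        · have : ψ (f0 (Y • t)) 0 = 0 := by rw [hTY]; simp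
          simpa using this
        · have : ψ (f0 (Z • t)) 0 = 0 := by rw [hTZ]; simp
          simpa using this
      have form : ∀ v ∈ LinearMap.ker (dS p Y Z 0), ∃ c : k,
          v 0 = c • (Y ^ (p - 1) * Z ^ (p - 1)) := by
        intro v hv
        rw [mem0] at hv
        obtain ⟨w, hw⟩ := hG.F2 1 (v 0) le_rfl (by have := hG.hp; omega) hv.2 (by simpa using hv.1)
        rw [hw]
        exact haug w
      apply le_antisymm
      · rintro _ ⟨v, hv, rfl⟩
        obtain ⟨c, hc⟩ := form v hv
        obtain ⟨c', hc'⟩ := form _ (hin t0)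
        have hne : c' ≠ 0 := by
          rintro rfl
          apply ht0
          apply hinj
          apply ψ.injective
          funext a
          have ha : a = 0 := Fin.ext (by have := a.2; simp)
          rw [ha, hc']
          simp
        refine ⟨algebraMap k A (c / c') • t0, ?_⟩
        apply ψ.injective
        funext a
        have ha : a = 0 := Fin.ext (by have := a.2; simp)
        rw [ha, map_smul, map_smul]
        simp only [LinearEquiv.coe_coe, LinearEquiv.apply_symm_apply, Pi.smul_apply]
        rw [hc', hc, algebraMap_smul, smul_smul, div_mul_cancel₀ _ hne]
      · rintro _ ⟨t, rfl⟩
        exact ⟨_, hin t, by simp⟩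
    | succ j ih =>
      intro hj
      obtain ⟨φ, hφ⟩ := ih (by omega)
      obtain ⟨φ', hφ'⟩ := stp j φ hφ
      refine ⟨φ', ?_⟩
      rw [← dS_exact hG j, hφ', hex j (by omega)]
  obtain ⟨φ, hφ⟩ := hker (2 * m) le_rfl
  exact stp _ φ hφ

end CosyzAux

set_option synthInstance.maxHeartbeats 1000000 in
/-- Let `G = ⟨y, z⟩` be elementary abelian of order `p²`, `k` a field
of characteristic `p`, `Y = y - 1`, `Z = z - 1` in `kG ≅ k[Y,Z]/(Y^p, Z^p)`.
Let `N` be the `kG`-module presented by generators `u_0, …, u_{2n-1}` and relations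
`Y u_{2i} = -Z u_{2i+1}` (for `0 ≤ i ≤ n-1`) and `Y^{p-1} u_{2i-1} = -Z^{p-1} u_{2i}`
(for `1 ≤ i ≤ n-1`), i.e. `N = N(P_*, n)` for the minimal resolution `P_*` of `k`
over `kH`, `H = ⟨y⟩`.  Then `N` is isomorphic to `Ω^{-2n}(k)`, the `2n`-th cosyzygy
of the trivial module `k` computed from a minimal injective resolution of `k`
over `kG` (whose `j`-th term is free of rank `j + 1`).  Here `n = m + 1 ≥ 1`. -/
theorem presented_module_iso_cosyzygy
    (k : Type) [Field k] (p : ℕ) (hp : p.Prime) [CharP k p]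
    (m : ℕ)
    -- `Y` and `Z` in the group algebra `A = kG`
    (Y Z : MonoidAlgebra k (Multiplicative (ZMod p × ZMod p)))
    (hY : Y = MonoidAlgebra.single (Multiplicative.ofAdd ((1 : ZMod p), (0 : ZMod p))) (1 : k) - 1)
    (hZ : Z = MonoidAlgebra.single (Multiplicative.ofAdd ((0 : ZMod p), (1 : ZMod p))) (1 : k) - 1)
    -- the trivial `kG`-module `k`
    (T : Type) [AddCommGroup T] [Module k T]
    [Module (MonoidAlgebra k (Multiplicative (ZMod p × ZMod p))) T]
    [IsScalarTower k (MonoidAlgebra k (Multiplicative (ZMod p × ZMod p))) T]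
    (e0 : T ≃ₗ[k] k)
    (htriv : ∀ (g : Multiplicative (ZMod p × ZMod p)) (t : T),
      (MonoidAlgebra.single g (1 : k) : MonoidAlgebra k (Multiplicative (ZMod p × ZMod p))) • t = t)
    -- a minimal injective resolution `0 → k → I_0 → ⋯ → I_{2n-1} → W → 0`
    -- (`I_j` is free of rank `j+1`, which characterizes minimality)
    (I : ℕ → Type) [∀ j, AddCommGroup (I j)]
    [∀ j, Module (MonoidAlgebra k (Multiplicative (ZMod p × ZMod p))) (I j)]
    (hIfree : ∀ j, Nonempty
      (I j ≃ₗ[MonoidAlgebra k (Multiplicative (ZMod p × ZMod p))]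
        (Fin (j + 1) → MonoidAlgebra k (Multiplicative (ZMod p × ZMod p)))))
    (f0 : T →ₗ[MonoidAlgebra k (Multiplicative (ZMod p × ZMod p))] I 0)
    (hinj : Function.Injective f0)
    (dI : ∀ j, I j →ₗ[MonoidAlgebra k (Multiplicative (ZMod p × ZMod p))] I (j + 1))
    (hex0 : LinearMap.range f0 = LinearMap.ker (dI 0))
    (hex : ∀ j, j < 2 * m → LinearMap.range (dI j) = LinearMap.ker (dI (j + 1)))
    -- `W = Ω^{-2n}(k)` is the cokernel at stage `2n - 1 = 2m + 1`
    (W : Type) [AddCommGroup W]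
    [Module (MonoidAlgebra k (Multiplicative (ZMod p × ZMod p))) W]
    (π : I (2 * m + 1) →ₗ[MonoidAlgebra k (Multiplicative (ZMod p × ZMod p))] W)
    (hsurj : Function.Surjective π)
    (hker : LinearMap.ker π = LinearMap.range (dI (2 * m))) :
    Nonempty
      (((Fin (2 * m + 2) → MonoidAlgebra k (Multiplicative (ZMod p × ZMod p))) ⧸
        Submodule.span (MonoidAlgebra k (Multiplicative (ZMod p × ZMod p)))
          (({v : Fin (2 * m + 2) → MonoidAlgebra k (Multiplicative (ZMod p × ZMod p)) |
              ∃ (j : ℕ) (h : 2 * j + 1 < 2 * m + 2),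
              v = Y • (Pi.single (⟨2 * j, by omega⟩ : Fin (2 * m + 2))
                    (1 : MonoidAlgebra k (Multiplicative (ZMod p × ZMod p))) : Fin (2 * m + 2) → MonoidAlgebra k (Multiplicative (ZMod p × ZMod p))) +
                  Z • (Pi.single (⟨2 * j + 1, h⟩ : Fin (2 * m + 2))
                    (1 : MonoidAlgebra k (Multiplicative (ZMod p × ZMod p))) : Fin (2 * m + 2) → MonoidAlgebra k (Multiplicative (ZMod p × ZMod p)))} ∪
            {v : Fin (2 * m + 2) → MonoidAlgebra k (Multiplicative (ZMod p × ZMod p)) |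
              ∃ (j : ℕ) (h : 2 * j + 2 < 2 * m + 2),
              v = Y ^ (p - 1) • (Pi.single (⟨2 * j + 1, by omega⟩ : Fin (2 * m + 2))
                    (1 : MonoidAlgebra k (Multiplicative (ZMod p × ZMod p))) : Fin (2 * m + 2) → MonoidAlgebra k (Multiplicative (ZMod p × ZMod p))) +
                  Z ^ (p - 1) • (Pi.single (⟨2 * j + 2, h⟩ : Fin (2 * m + 2))
                    (1 : MonoidAlgebra k (Multiplicative (ZMod p × ZMod p))) : Fin (2 * m + 2) → MonoidAlgebra k (Multiplicative (ZMod p × ZMod p)))}) :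
            Set (Fin (2 * m + 2) → MonoidAlgebra k (Multiplicative (ZMod p × ZMod p)))))
        ≃ₗ[MonoidAlgebra k (Multiplicative (ZMod p × ZMod p))] W) := by
  have : Fact p.Prime := ⟨hp⟩
  obtain ⟨hYp, hZp, hs, hi⟩ := CosyzAux.conc_facts hp Y Z hY hZ
  have hG := CosyzAux.good_of_mono hp.two_le hYp hZp hs hi
  have : Module.Finite k (MonoidAlgebra k (Multiplicative (ZMod p × ZMod p))) :=
    Module.Finite.of_basis (MonoidAlgebra.basis _ k)
  obtain ⟨φ, hφ⟩ := CosyzAux.main_abs (k := k) hG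
    (CosyzAux.aug_of_mono hp.two_le hYp hZp hs)
    (fun r N f => CosyzAux.selfinj N f) m T (e0.symm 1)
    (by simp)
    (fun t => by rw [hY, sub_smul, htriv, one_smul, sub_self])
    (fun t => by rw [hZ, sub_smul, htriv, one_smul, sub_self])
    I hIfree f0 hinj dI hex0 hex
  rw [CosyzAux.range_dS_eq] at hφ
  exact ⟨(Submodule.Quotient.equiv _ _ φ (hφ.trans hker.symm)).trans
    (π.quotKerEquivOfSurjective hsurj)⟩
end

section
/- Let G = ⟨y, z⟩ be elementary abelian of order p² and H = ⟨y⟩. Under the identification N(P_*, n) ≅ Ω^{-2n}(k), the map k → N(P_*, n) sending 1 to Z^{p-1}·u_0 represents the cohomology class ζ^n ∈ H^{2n}(G, k), where ζ ∈ H²(G, k) is the inflation to G of the degree-two polynomial generator of H*(H, k). -/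
open MonoidAlgebra

namespace ZP
section gen
variable {R : Type} [CommRing R] 

def al (p : ℕ) (Y : R) (a : ℕ) : R := if a % 2 = 0 then Y else Y ^ (p - 1)

lemma al_mul (p : ℕ) (hp : 2 ≤ p) (Y : R) (hY : Y ^ p = 0) (a : ℕ) : al p Y (a+1) * al p Y a = 0 := by
  have h1 : Y ^ (p-1) * Y = 0 := by rw [← pow_succ, Nat.sub_add_cancel (by omega), hY]
  unfold al
  rcases Nat.mod_two_eq_zero_or_one a with h | h
  · rw [if_neg (by omega), if_pos h, h1]
  · rw [if_pos (by omega), if_neg (by omega), mul_comm, h1]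

def ext {j : ℕ} (v : Fin (j+1) → R) (i : ℕ) : R := if h : i < j + 1 then v ⟨i, h⟩ else 0

lemma ext_of_lt {j : ℕ} (v : Fin (j+1) → R) (i : ℕ) (h : i < j + 1) : ext v i = v ⟨i, h⟩ := dif_pos h
lemma ext_of_ge {j : ℕ} (v : Fin (j+1) → R) (i : ℕ) (h : j + 1 ≤ i) : ext v i = 0 := dif_neg (by omega)
lemma ext_add {j : ℕ} (v w : Fin (j+1) → R) (i : ℕ) : ext (v + w) i = ext v i + ext w i := by
  unfold ext; split_ifs <;> simp
lemma ext_sub {j : ℕ} (v w : Fin (j+1) → R) (i : ℕ) : ext (v - w) i = ext v i - ext w i := by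
  unfold ext; split_ifs <;> simp
lemma ext_smul {j : ℕ} (c : R) (v : Fin (j+1) → R) (i : ℕ) : ext (c • v) i = c * ext v i := by
  unfold ext; split_ifs <;> simp
lemma ext_zero {j : ℕ} (i : ℕ) : ext (0 : Fin (j+1) → R) i = 0 := by
  unfold ext; split_ifs <;> simp
lemma ext_inj {j : ℕ} {v w : Fin (j+1) → R} (h : ∀ i, i < j + 1 → ext v i = ext w i) : v = w := by
  funext i
  have := h i i.2
  rwa [ext_of_lt _ _ i.2, ext_of_lt _ _ i.2] at this
lemma ext_single {j : ℕ} (s : ℕ) (hs : s < j + 1) (x : R) (i : ℕ) :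
    ext (Pi.single (⟨s, hs⟩ : Fin (j+1)) x : Fin (j+1) → R) i = if i = s then x else 0 := by
  by_cases h : i < j + 1
  · rw [ext_of_lt _ _ h, Pi.single_apply]
    simp [Fin.ext_iff]
  · rw [ext_of_ge _ _ (by omega), if_neg (by omega)]

/-- The explicit differential. -/
def dJ (p : ℕ) (Y Z : R) (j : ℕ) : (Fin (j+1) → R) →ₗ[R] (Fin (j+1+1) → R) where
  toFun v := fun i => al p Y (j - i) * ext v i +
    if (i : ℕ) = 0 then 0 else (-1)^j * al p Z (i - 1) * ext v (i - 1)
  map_add' v w := by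
    funext i; simp only [ext_add, Pi.add_apply]; split_ifs <;> ring
  map_smul' c v := by
    funext i; simp only [ext_smul, Pi.smul_apply, smul_eq_mul, RingHom.id_apply]; split_ifs <;> ring

lemma ext_dJ (p : ℕ) (Y Z : R) (j : ℕ) (v : Fin (j+1) → R) (i : ℕ) :
    ext (dJ p Y Z j v) i = al p Y (j - i) * ext v i +
    if i = 0 then 0 else (-1)^j * al p Z (i - 1) * ext v (i - 1) := by
  by_cases h : i < j + 1 + 1
  · rw [ext_of_lt _ _ h]; rfl
  · rw [ext_of_ge _ _ (by omega), ext_of_ge _ _ (by omega), ext_of_ge _ _ (by omega)]; simp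

lemma dJ_dJ (p : ℕ) (hp : 2 ≤ p) (Y Z : R) (hY : Y ^ p = 0) (hZ : Z ^ p = 0) (j : ℕ) (v : Fin (j+1) → R) :
    dJ p Y Z (j+1) (dJ p Y Z j v) = 0 := by
  apply ext_inj
  intro i hi
  rw [ext_zero]
  simp only [ext_dJ]
  have e1 : al p Y (j+1-i) * (al p Y (j-i) * ext v i) = 0 := by
    by_cases h : i ≤ j
    · rw [← mul_assoc, show j + 1 - i = (j-i)+1 by omega, al_mul p hp Y hY, zero_mul]
    · rw [ext_of_ge _ _ (by omega)]; simp
  rcases i with _ | i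
  · simpa using e1
  · have e2 : al p Z i * (if i = 0 then 0 else (-1)^j * al p Z (i - 1) * ext v (i - 1)) = 0 := by
      rcases i with _ | i
      · simp
      · have := al_mul p hp Z hZ i
        simp only [Nat.add_sub_cancel, Nat.add_eq_zero_iff, one_ne_zero, and_false, if_false]
        linear_combination (-1)^j * ext v i * this
    simp only [Nat.add_sub_cancel, Nat.add_eq_zero_iff, one_ne_zero, and_false, if_false] at *
    rw [show j + 1 - (i+1) = j - i by omega] at *
    linear_combination e1 + (-1)^(j+1) * e2

/-- The explicit ladder `R/(Z) → J_j`, `1 ↦ Z^{p-1} u_0`. -/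
def fJ (p : ℕ) (Z : R) (hp : 2 ≤ p) (hZ : Z ^ p = 0) (j : ℕ) : (R ⧸ Submodule.span R ({Z} : Set R)) →ₗ[R] (Fin (j+1) → R) :=
  Submodule.liftQ _ (LinearMap.toSpanSingleton R _ (Pi.single (⟨0, by omega⟩ : Fin (j+1)) (Z ^ (p-1)))) (by
    rw [Submodule.span_singleton_le_iff_mem, LinearMap.mem_ker, LinearMap.toSpanSingleton_apply,
      ← Pi.single_smul, smul_eq_mul, ← pow_succ', Nat.sub_add_cancel (by omega), hZ, Pi.single_zero])

lemma fJ_mk (p : ℕ) (Z : R) (hp : 2 ≤ p) (hZ : Z ^ p = 0) (j : ℕ) (r : R) : fJ p Z hp hZ j (Submodule.Quotient.mk r) =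
    Pi.single (⟨0, by omega⟩ : Fin (j+1)) (r * Z ^ (p-1)) := by
  rw [fJ, Submodule.liftQ_apply, LinearMap.toSpanSingleton_apply, ← Pi.single_smul, smul_eq_mul]

variable (p : ℕ) (hp : 2 ≤ p) (Y Z : R) (hY : Y ^ p = 0) (hZ : Z ^ p = 0)
  (hL : ∀ s t : ℕ, s ≤ p → t ≤ p → ∀ v : R, Y ^ s * v = 0 → Z ^ t * v = 0 →
    ∃ x, v = Y ^ (p - s) * Z ^ (p - t) * x)

include hp hZ hL in
lemma al_ann (a : ℕ) (v : R) (h : al p Y (a+1) * v = 0) : ∃ x, v = al p Y a * x := by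
  unfold al at *
  rcases Nat.mod_two_eq_zero_or_one a with h' | h'
  · rw [if_neg (by omega)] at h
    obtain ⟨x, hx⟩ := hL (p-1) p (by omega) le_rfl v h (by rw [hZ, zero_mul])
    refine ⟨x, ?_⟩
    rw [hx, if_pos h', Nat.sub_self, show p - (p-1) = 1 by omega]; simp
  · rw [if_pos (by omega)] at h
    obtain ⟨x, hx⟩ := hL 1 p (by omega) le_rfl v (by simpa using h) (by rw [hZ, zero_mul])
    refine ⟨x, ?_⟩
    rw [hx, if_neg (by omega), Nat.sub_self]; simp

include hp hL in
lemma al_ann2 (a : ℕ) (v : R) (h : Y * v = 0) (h2 : al p Z (a+1) * v = 0) :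
    ∃ x, v = al p Z a * (Y ^ (p-1) * x) := by
  unfold al at *
  rcases Nat.mod_two_eq_zero_or_one a with h' | h'
  · rw [if_neg (by omega)] at h2
    obtain ⟨x, hx⟩ := hL 1 (p-1) (by omega) (by omega) v (by simpa using h) h2
    refine ⟨x, ?_⟩
    rw [hx, if_pos h', show p - (p-1) = 1 by omega]; ring
  · rw [if_pos (by omega)] at h2
    obtain ⟨x, hx⟩ := hL 1 1 (by omega) (by omega) v (by simpa using h) (by simpa using h2)
    refine ⟨x, ?_⟩
    rw [hx, if_neg (by omega)]; ring

include hp hY hZ hL in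
lemma exact_aux (j : ℕ) (v : Fin (j+1+1) → R) (hv : dJ p Y Z (j+1) v = 0) (s : ℕ) (hs : s ≤ j + 1) :
    ∃ w, ∀ i < s, ext (v - dJ p Y Z j w) i = 0 := by
  induction s with
  | zero => exact ⟨0, fun i hi => by omega⟩
  | succ s ih =>
    obtain ⟨w, hw⟩ := ih (by omega)
    have hk : dJ p Y Z (j+1) (v - dJ p Y Z j w) = 0 := by
      rw [map_sub, hv, dJ_dJ p hp Y Z hY hZ, sub_zero]
    set v' := v - dJ p Y Z j w with hv'
    have h1 := ext_dJ p Y Z (j+1) v' s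
    rw [hk, ext_zero] at h1
    have h2 : (if s = 0 then 0 else (-1)^(j+1) * al p Z (s - 1) * ext v' (s - 1)) = 0 := by
      split_ifs with h
      · rfl
      · rw [hw _ (by omega), mul_zero]
    rw [h2, add_zero, show j + 1 - s = (j - s) + 1 by omega] at h1
    obtain ⟨x, hx⟩ := al_ann p hp Y Z hZ hL _ _ h1.symm
    refine ⟨w + Pi.single (⟨s, by omega⟩ : Fin (j+1)) x, fun i hi => ?_⟩
    rw [map_add, ← sub_sub, ← hv', ext_sub, ext_dJ]
    simp only [ext_single]
    have h3 : (if i = 0 then 0 else (-1)^j * al p Z (i - 1) * (if i - 1 = s then x else 0)) = 0 := by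
      split_ifs with h h'
      · rfl
      · omega
      · simp
    rw [h3]
    by_cases h : i = s
    · subst h; rw [hx]; simp
    · rw [hw i (by omega), if_neg h]; simp

include hp hY hZ hL in
lemma exact_J (j : ℕ) (v : Fin (j+1+1) → R) (hv : dJ p Y Z (j+1) v = 0) :
    ∃ w, dJ p Y Z j w = v := by
  obtain ⟨w, hw⟩ := exact_aux p hp Y Z hY hZ hL j v hv (j+1) le_rfl
  have hk : dJ p Y Z (j+1) (v - dJ p Y Z j w) = 0 := by
    rw [map_sub, hv, dJ_dJ p hp Y Z hY hZ, sub_zero]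
  set v' := v - dJ p Y Z j w with hv'
  have h1 := ext_dJ p Y Z (j+1) v' (j+1)
  have h2 := ext_dJ p Y Z (j+1) v' (j+2)
  rw [hk, ext_zero] at h1 h2
  rw [Nat.sub_self, if_neg (by omega), Nat.add_sub_cancel, hw j (by omega), mul_zero, add_zero] at h1
  rw [ext_of_ge _ (j+2) le_rfl, mul_zero, zero_add, if_neg (by omega), show j + 2 - 1 = j + 1 by omega,
    mul_assoc] at h2
  have h2' : al p Z (j+1) * ext v' (j+1) = 0 := by
    rcases neg_one_pow_eq_or R (j+1) with h | h <;> rw [h] at h2 <;> simpa using h2.symm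
  obtain ⟨x, hx⟩ := al_ann2 p hp Y Z hL j _ (by simpa [al] using h1.symm) h2'
  refine ⟨w + Pi.single (⟨j, by omega⟩ : Fin (j+1)) ((-1)^j * (Y^(p-1) * x)), ?_⟩
  rw [map_add, ← sub_eq_zero, ← neg_eq_zero, neg_sub, ← sub_sub, ← hv']
  apply ext_inj
  intro i hi
  rw [ext_zero, ext_sub, ext_dJ]
  simp only [ext_single]
  have hYY : Y * Y^(p-1) = 0 := by rw [← pow_succ', Nat.sub_add_cancel (by omega), hY]
  have hsg : ((-1:R)^j) * (-1)^j = 1 := by rw [← mul_pow]; simp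
  have h3 : i ≤ j → (if i = 0 then 0 else (-1)^j * al p Z (i - 1) *
      (if i - 1 = j then (-1)^j * (Y^(p-1) * x) else 0)) = 0 := by
    intro hij
    split_ifs with h h'
    · rfl
    · omega
    · simp
  rcases Nat.lt_or_ge i j with h | h
  · rw [hw i (by omega), h3 h.le, if_neg (by omega)]; simp
  · rcases Nat.eq_or_lt_of_le h with h | h
    · subst h
      rw [hw _ (by omega), h3 le_rfl, if_pos rfl, Nat.sub_self]
      simp only [al, Nat.zero_mod, if_true]
      linear_combination (-(-1)^j * x) * hYY
    · obtain rfl : i = j + 1 := by omega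
      rw [hx, if_neg (by omega), if_neg (by omega)]
      simp only [Nat.add_sub_cancel, if_true]
      linear_combination -(al p Z j * (Y^(p-1) * x)) * hsg

lemma dJ_soc (hp : 2 ≤ p) (j : ℕ) (v : Fin (j+1) → R) (h1 : Y • v = 0) (h2 : Z • v = 0) : dJ p Y Z j v = 0 := by
  have key : ∀ (X : R), X • v = 0 → ∀ a i, al p X a * ext v i = 0 := by
    intro X hX a i
    have : X * ext v i = 0 := by rw [← ext_smul, hX, ext_zero]
    unfold al
    split_ifs
    · exact this
    · rw [show p - 1 = (p-2)+1 by omega, pow_succ, mul_assoc, this, mul_zero]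
  apply ext_inj
  intro i _
  rw [ext_zero, ext_dJ, key Y h1, mul_assoc, key Z h2]; simp

include hY hZ in
/-- A map which is injective on the socle is injective. -/
lemma inj_of_soc {M N : Type} [AddCommGroup M] [AddCommGroup N] [Module R M] [Module R N]
    (ψ : M →ₗ[R] N) (h : ∀ v, Y • v = 0 → Z • v = 0 → ψ v = 0 → v = 0) : Function.Injective ψ := by
  have aux : ∀ (X : R), X ^ p = 0 → ∀ Q : M → Prop, (∀ v, Q v → Q (X • v)) → (∀ v, Q v → X • v = 0 → v = 0) →
      ∀ v, Q v → v = 0 := by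
    intro X hX Q hQ hQ0 v hv
    have hpow : ∀ i, Q (X ^ i • v) := by
      intro i
      induction i with
      | zero => simpa using hv
      | succ i ih => rw [pow_succ', mul_smul]; exact hQ _ ih
    have : ∀ i, X ^ i • v = 0 → v = 0 := by
      intro i
      induction i with
      | zero => simp
      | succ i ih => 
        intro hi
        exact ih (hQ0 _ (hpow i) (by rwa [← mul_smul, ← pow_succ']))
    exact this p (by rw [hX, zero_smul])
  rw [injective_iff_map_eq_zero]
  apply aux Y hY (fun v => ψ v = 0)
  · intro v hv; simp only [map_smul, hv, smul_zero]
  · intro v hv hYv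
    refine aux Z hZ (fun v => ψ v = 0 ∧ Y • v = 0) ?_ ?_ v ⟨hv, hYv⟩
    · rintro v ⟨a, b⟩
      exact ⟨by rw [map_smul, a, smul_zero], by rw [smul_comm, b, smul_zero]⟩
    · rintro v ⟨a, b⟩ c
      exact h v b c a

include hY hZ in
lemma step [Module.Injective R R] [IsArtinianRing R] {P I' : Type} [AddCommGroup P] [Module R P] [AddCommGroup I'] [Module R I']
    (j : ℕ) (g : I' ≃ₗ[R] (Fin (j+1) → R)) (a : P →ₗ[R] (Fin (j+1) → R)) (b : P →ₗ[R] I')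
    (hab : ∀ x, a x = 0 ↔ b x = 0)
    (hsoc : ∀ v, Y • v = 0 → Z • v = 0 → ∃ x, a x = v) :
    ∃ ψ : (Fin (j+1) → R) →ₗ[R] I', ψ ∘ₗ a = b ∧ Function.Bijective ψ := by
  have hinj : Module.Injective R (Fin (j+1) → R) := inferInstance
  let a' : (P ⧸ LinearMap.ker a) →ₗ[R] (Fin (j+1) → R) := (LinearMap.ker a).liftQ a le_rfl
  have ha' : Function.Injective a' := by
    rw [← LinearMap.ker_eq_bot]; exact Submodule.ker_liftQ_eq_bot _ _ _ le_rfl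
  let b' : (P ⧸ LinearMap.ker a) →ₗ[R] (Fin (j+1) → R) := (LinearMap.ker a).liftQ (g.toLinearMap ∘ₗ b) (by
    intro x hx
    have := (hab x).1 hx
    simp [this])
  obtain ⟨ψ, hψ⟩ := hinj.out a' ha' b'
  have hψa : ∀ x, ψ (a x) = g (b x) := fun x => hψ (Submodule.Quotient.mk x)
  have hψi : Function.Injective ψ := by
    apply inj_of_soc p Y Z hY hZ
    intro v h1 h2 h3
    obtain ⟨x, rfl⟩ := hsoc v h1 h2
    rw [hψa] at h3
    exact (hab x).2 (by simpa using h3)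
  have hψb : Function.Bijective ψ := IsArtinian.bijective_of_injective_endomorphism ψ hψi
  refine ⟨g.symm.toLinearMap ∘ₗ ψ, ?_, ?_⟩
  · ext x; simp [hψa]
  · exact g.symm.bijective.comp hψb


lemma dJ_single (j s : ℕ) (hs : s < j + 1) (x : R) :
    dJ p Y Z j (Pi.single (⟨s, hs⟩ : Fin (j+1)) x) =
      Pi.single (⟨s, by omega⟩ : Fin (j+1+1)) (al p Y (j-s) * x) +
      Pi.single (⟨s+1, by omega⟩ : Fin (j+1+1)) ((-1)^j * al p Z s * x) := by
  apply ext_inj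
  intro i hi
  rw [ext_dJ, ext_add]
  simp only [ext_single]
  congr 1
  · by_cases h : i = s <;> simp [h]
  · rcases i with _ | i
    · simp
    · by_cases h : i = s <;> simp [h]

lemma dJ_fJ (hp : 2 ≤ p) (hZ : Z ^ p = 0) (j : ℕ) (r : R) :
    dJ p Y Z j (fJ p Z hp hZ j (Submodule.Quotient.mk r)) =
      fJ p Z hp hZ (j+1) (Submodule.Quotient.mk (al p Y j * r)) := by
  rw [fJ_mk, fJ_mk, dJ_single]
  have : (-1)^j * al p Z 0 * (r * Z^(p-1)) = 0 := by
    have : Z * Z^(p-1) = 0 := by rw [← pow_succ', Nat.sub_add_cancel (by omega), hZ]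
    simp only [al, Nat.zero_mod, if_true]
    linear_combination (-1)^j * r * this
  rw [this, Pi.single_zero, add_zero, Nat.sub_zero, mul_assoc]

/-- Spanning set of the relations of `N`. -/
abbrev rel (m : ℕ) : Set (Fin (2 * m + 2) → R) :=
  ({v : Fin (2 * m + 2) → R |
              ∃ (j : ℕ) (h : 2 * j + 1 < 2 * m + 2),
              v = Y • (Pi.single (⟨2 * j, by omega⟩ : Fin (2 * m + 2)) (1 : R) : Fin (2 * m + 2) → R) +
                  Z • (Pi.single (⟨2 * j + 1, h⟩ : Fin (2 * m + 2)) (1 : R) : Fin (2 * m + 2) → R)} ∪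
            {v : Fin (2 * m + 2) → R |
              ∃ (j : ℕ) (h : 2 * j + 2 < 2 * m + 2),
              v = Y ^ (p - 1) • (Pi.single (⟨2 * j + 1, by omega⟩ : Fin (2 * m + 2)) (1 : R) : Fin (2 * m + 2) → R) +
                  Z ^ (p - 1) • (Pi.single (⟨2 * j + 2, h⟩ : Fin (2 * m + 2)) (1 : R) : Fin (2 * m + 2) → R)})

lemma range_dJ (m : ℕ) : LinearMap.range (dJ p Y Z (2*m)) = Submodule.span R (rel p Y Z m) := by
  have hs : ∀ s (hs : s < 2*m+1), dJ p Y Z (2*m) (Pi.single (⟨s, hs⟩ : Fin (2*m+1)) (1:R)) =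
      al p Y s • (Pi.single (⟨s, by omega⟩ : Fin (2*m+2)) (1:R) : Fin (2 * m + 2) → R) +
      al p Z s • (Pi.single (⟨s+1, by omega⟩ : Fin (2*m+2)) (1:R) : Fin (2 * m + 2) → R) := by
    intro s hs
    rw [dJ_single, ← Pi.single_smul, ← Pi.single_smul]
    have e : al p Y (2*m-s) = al p Y s := by
      unfold al; rw [show (2*m-s) % 2 = s % 2 by omega]
    simp [e]
  apply le_antisymm
  · rintro _ ⟨v, rfl⟩
    rw [← Finset.univ_sum_single v, map_sum]
    refine Submodule.sum_mem _ fun i _ => ?_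
    have : (Pi.single i (v i) : Fin (2*m+1) → R) = v i • Pi.single i 1 := by
      rw [← Pi.single_smul]; simp
    rw [this, map_smul]
    refine Submodule.smul_mem _ _ (Submodule.subset_span ?_)
    obtain ⟨s, h⟩ := i
    rw [hs s h]
    rcases Nat.even_or_odd' s with ⟨c, rfl | rfl⟩
    · left
      refine ⟨c, by omega, ?_⟩
      simp [al]
    · right
      refine ⟨c, by omega, ?_⟩
      simp [al, Nat.add_mod]
  · rw [Submodule.span_le]
    rintro v (⟨j, h, rfl⟩ | ⟨j, h, rfl⟩)
    · refine ⟨_, (hs (2*j) (by omega)).trans ?_⟩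
      simp [al]
    · refine ⟨_, (hs (2*j+1) (by omega)).trans ?_⟩
      simp [al, Nat.add_mod]

include hp hY hZ hL in
theorem main [Module.Injective R R] [IsArtinianRing R] (m : ℕ)
    (T : Type) [AddCommGroup T] [Module R T] (u : T)
    (hu : ∀ t : T, ∃ r : R, t = r • u ∧ (r * (Y ^ (p-1) * Z ^ (p-1)) = 0 → r = 0))
    (I : ℕ → Type) [∀ j, AddCommGroup (I j)] [∀ j, Module R (I j)]
    (hIfree : ∀ j, Nonempty (I j ≃ₗ[R] (Fin (j + 1) → R)))
    (f0 : T →ₗ[R] I 0) (hinj : Function.Injective f0)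
    (dI : ∀ j, I j →ₗ[R] I (j + 1))
    (hex0 : LinearMap.range f0 = LinearMap.ker (dI 0))
    (hex : ∀ j, j < 2 * m → LinearMap.range (dI j) = LinearMap.ker (dI (j + 1)))
    (W : Type) [AddCommGroup W] [Module R W]
    (π : I (2 * m + 1) →ₗ[R] W)
    (hsurjW : Function.Surjective π)
    (hker : LinearMap.ker π = LinearMap.range (dI (2 * m)))
    (μn : T →ₗ[R] ((Fin (2 * m + 2) → R) ⧸ Submodule.span R (rel p Y Z m)))
    (hμn : μn u = Z ^ (p - 1) • Submodule.Quotient.mk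
      ((Pi.single (⟨0, by omega⟩ : Fin (2 * m + 2)) (1 : R) : Fin (2 * m + 2) → R)))
    (ιE : T →ₗ[R] (R ⧸ Submodule.span R ({Z} : Set R)))
    (hιE : ιE u = Submodule.Quotient.mk (Y ^ (p - 1)))
    (mY : (R ⧸ Submodule.span R ({Z} : Set R)) →ₗ[R] (R ⧸ Submodule.span R ({Z} : Set R)))
    (hmY : ∀ a : R, mY (Submodule.Quotient.mk a) = Submodule.Quotient.mk (Y * a))
    (εE : (R ⧸ Submodule.span R ({Z} : Set R)) →ₗ[R] T)
    (hεE : εE (Submodule.Quotient.mk 1) = u) :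
    ∃ e : ((Fin (2 * m + 2) → R) ⧸ Submodule.span R (rel p Y Z m)) →ₗ[R] W,
      Function.Bijective e ∧ ∃ f : (j : ℕ) → j < 2 * m + 2 →
        ((R ⧸ Submodule.span R ({Z} : Set R)) →ₗ[R] I j),
      ((f 0 (by omega)) ∘ₗ ιE = f0) ∧
      (∀ (j : ℕ) (hj : j + 1 < 2 * m + 2),
        (dI j) ∘ₗ (f j (by omega)) =
          (f (j + 1) hj) ∘ₗ (if j % 2 = 0 then mY else ιE ∘ₗ εE)) ∧
      ∃ hcorr : T →ₗ[R] I (2 * m + 1),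
        π ∘ₗ (f (2 * m + 1) (by omega)) =
          ((e ∘ₗ μn) + π ∘ₗ hcorr) ∘ₗ εE := by
  have hεr : ∀ r : R, εE (Submodule.Quotient.mk r) = r • u := by
    intro r
    rw [← hεE, ← map_smul, ← Submodule.Quotient.mk_smul, smul_eq_mul, mul_one]
  have hιr : ∀ r : R, ιE (r • u) = Submodule.Quotient.mk (Y ^ (p-1) * r) := by
    intro r
    rw [map_smul, hιE, ← Submodule.Quotient.mk_smul, smul_eq_mul, mul_comm]
  let j0 : T →ₗ[R] (Fin (0+1) → R) := fJ p Z hp hZ 0 ∘ₗ ιE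
  have hj0 : ∀ r : R, j0 (r • u) = Pi.single (⟨0, by omega⟩ : Fin (0+1)) (Y^(p-1) * r * Z^(p-1)) := by
    intro r
    simp only [j0, LinearMap.comp_apply, hιr, fJ_mk]
  have hj0i : ∀ t, j0 t = 0 → t = 0 := by
    intro t ht
    obtain ⟨r, rfl, hr⟩ := hu t
    rw [hj0, Pi.single_eq_zero_iff] at ht
    rw [hr (by linear_combination ht), zero_smul]
  -- exactness at `J_0`
  have hJ0 : ∀ v, dJ p Y Z 0 v = 0 ↔ ∃ t, j0 t = v := by
    intro v
    constructor
    · intro hv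
      have h1 := ext_dJ p Y Z 0 v 0
      have h2 := ext_dJ p Y Z 0 v 1
      rw [hv, ext_zero] at h1 h2
      rw [ext_of_ge _ 1 le_rfl] at h2
      simp [al] at h1 h2
      obtain ⟨x, hx⟩ := hL 1 1 (by omega) (by omega) (ext v 0) (by simpa using h1.symm) (by simpa using h2.symm)
      refine ⟨x • u, ?_⟩
      rw [hj0]
      apply ext_inj
      intro i hi
      obtain rfl : i = 0 := by omega
      rw [ext_single, if_pos rfl, hx]; ring
    · rintro ⟨t, rfl⟩
      obtain ⟨r, rfl, -⟩ := hu t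
      have e : j0 (r • u) = fJ p Z hp hZ 0 (Submodule.Quotient.mk (Y^(p-1)*r)) := by
        simp only [j0, LinearMap.comp_apply, hιr]
      rw [e, dJ_fJ, fJ_mk]
      have : Y * Y^(p-1) = 0 := by rw [← pow_succ', Nat.sub_add_cancel (by omega), hY]
      simp only [al, Nat.zero_mod, if_true]
      rw [← mul_assoc, this]; simp
  -- the comparison isomorphism
  obtain ⟨φ0, hφ0, hbij⟩ := step p Y Z hY hZ 0 (hIfree 0).some j0 f0
    (fun x => ⟨fun h => by rw [hj0i x h, map_zero], fun h => by
      rw [hinj (h.trans (map_zero f0).symm), map_zero]⟩)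
    (fun v h1 h2 => (hJ0 v).1 (dJ_soc p Y Z hp 0 v h1 h2))
  classical
  let φ : ∀ j, (Fin (j+1) → R) →ₗ[R] I j := fun j => Nat.rec (motive := fun j => (Fin (j+1) → R) →ₗ[R] I j) φ0
    (fun j φj => if h : ∃ ψ : (Fin (j+1+1) → R) →ₗ[R] I (j+1), ψ ∘ₗ dJ p Y Z j = dI j ∘ₗ φj ∧ Function.Bijective ψ
      then h.choose else 0) j
  have hstep : ∀ j, Function.Bijective (φ j) → (∀ v, dJ p Y Z j v = 0 ↔ dI j (φ j v) = 0) →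
      φ (j+1) ∘ₗ dJ p Y Z j = dI j ∘ₗ φ j ∧ Function.Bijective (φ (j+1)) := by
    intro j hb hS
    have h : ∃ ψ : (Fin (j+1+1) → R) →ₗ[R] I (j+1), ψ ∘ₗ dJ p Y Z j = dI j ∘ₗ φ j ∧ Function.Bijective ψ :=
      step p Y Z hY hZ (j+1) (hIfree (j+1)).some (dJ p Y Z j) (dI j ∘ₗ φ j) hS
        (fun v h1 h2 => exact_J p hp Y Z hY hZ hL j v (dJ_soc p Y Z hp (j+1) v h1 h2))
    have e : φ (j+1) = h.choose := dif_pos h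
    rw [e]
    exact h.choose_spec
  have hind : ∀ j, j ≤ 2 * m → Function.Bijective (φ j) ∧ (∀ v, dJ p Y Z j v = 0 ↔ dI j (φ j v) = 0) := by
    intro j
    induction j with
    | zero =>
      intro _
      refine ⟨hbij, fun v => ?_⟩
      rw [hJ0]
      have : dI 0 (φ 0 v) = 0 ↔ ∃ t, f0 t = φ0 v := by
        rw [← LinearMap.mem_ker, ← hex0, LinearMap.mem_range]
        exact Iff.rfl
      rw [this]
      have e : ∀ t, f0 t = φ0 (j0 t) := fun t => by rw [← hφ0]; rfl
      constructor
      · rintro ⟨t, rfl⟩; exact ⟨t, e t⟩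
      · rintro ⟨t, ht⟩; exact ⟨t, hbij.1 ((e t).symm.trans ht)⟩
    | succ j ih =>
      intro hj
      obtain ⟨hb, hS⟩ := ih (by omega)
      obtain ⟨hc, hb'⟩ := hstep j hb hS
      refine ⟨hb', fun v => ?_⟩
      have hc' : ∀ w, φ (j+1) (dJ p Y Z j w) = dI j (φ j w) := fun w => LinearMap.congr_fun hc w
      constructor
      · intro hv
        obtain ⟨w, rfl⟩ := exact_J p hp Y Z hY hZ hL j v hv
        rw [hc', ← LinearMap.mem_ker, ← hex j (by omega)]
        exact ⟨_, rfl⟩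
      · intro hv
        rw [← LinearMap.mem_ker, ← hex j (by omega)] at hv
        obtain ⟨x, hx⟩ := hv
        obtain ⟨w, rfl⟩ := hb.2 x
        rw [← hc'] at hx
        rw [← hb'.1 hx, dJ_dJ p hp Y Z hY hZ]
  have hcomm : ∀ j, j ≤ 2 * m → ∀ w, φ (j+1) (dJ p Y Z j w) = dI j (φ j w) := fun j hj w =>
    LinearMap.congr_fun (hstep j (hind j hj).1 (hind j hj).2).1 w
  have hblast : Function.Bijective (φ (2*m+1)) := (hstep (2*m) (hind _ le_rfl).1 (hind _ le_rfl).2).2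
  have hkerφ : LinearMap.ker (π ∘ₗ φ (2*m+1)) = Submodule.span R (rel p Y Z m) := by
    rw [← range_dJ]
    ext v
    rw [LinearMap.mem_ker, LinearMap.comp_apply, ← LinearMap.mem_ker, hker]
    constructor
    · rintro ⟨x, hx⟩
      obtain ⟨w, rfl⟩ := (hind _ le_rfl).1.2 x
      rw [← hcomm _ le_rfl] at hx
      exact ⟨w, hblast.1 hx⟩
    · rintro ⟨w, rfl⟩
      exact ⟨_, (hcomm _ le_rfl w).symm⟩
  let e : ((Fin (2 * m + 2) → R) ⧸ Submodule.span R (rel p Y Z m)) →ₗ[R] W :=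
    Submodule.liftQ _ (π ∘ₗ φ (2*m+1)) hkerφ.ge
  have he : ∀ v, e (Submodule.Quotient.mk v) = π (φ (2*m+1) v) := fun v => rfl
  refine ⟨e, ⟨?_, ?_⟩, fun j _ => φ j ∘ₗ fJ p Z hp hZ j, ?_, ?_, 0, ?_⟩
  · rw [← LinearMap.ker_eq_bot]; exact Submodule.ker_liftQ_eq_bot _ _ _ hkerφ.le
  · intro w
    obtain ⟨x, rfl⟩ := hsurjW w
    obtain ⟨v, rfl⟩ := hblast.2 x
    exact ⟨Submodule.Quotient.mk v, he v⟩
  · exact hφ0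
  · intro j hj
    apply LinearMap.ext
    intro x
    obtain ⟨r, rfl⟩ := Submodule.Quotient.mk_surjective _ x
    simp only [LinearMap.comp_apply]
    rw [← hcomm j (by omega), dJ_fJ]
    congr 2
    unfold al
    split_ifs with h
    · rw [hmY]
    · rw [LinearMap.comp_apply, hεr, hιr]
  · apply LinearMap.ext
    intro x
    obtain ⟨r, rfl⟩ := Submodule.Quotient.mk_surjective _ x
    simp only [LinearMap.comp_apply, LinearMap.add_apply, LinearMap.zero_apply, map_zero, add_zero]
    rw [hεr, map_smul, hμn, ← Submodule.Quotient.mk_smul, ← Submodule.Quotient.mk_smul, he, fJ_mk,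
      ← Pi.single_smul, ← Pi.single_smul]
    simp

end gen
end ZP

namespace ZP
open MonoidAlgebra
section grp
variable (k : Type) [Field k] 

lemma injective_groupAlgebra (G : Type) [CommGroup G] [Finite G] : Module.Injective (MonoidAlgebra k G) (MonoidAlgebra k G) := by
  classical
  have := Fintype.ofFinite G
  apply Module.Baer.injective
  intro A g
  let lam : MonoidAlgebra k G →ₗ[k] k :=
    { toFun := fun a => a.coeff 1
      map_add' := fun a b => by simp
      map_smul' := fun c a => by simp }
  have hlam : ∀ a, lam a = a.coeff 1 := fun a => rfl
  let g' : (A.restrictScalars k) →ₗ[k] k := lam ∘ₗ (g.restrictScalars k)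
  obtain ⟨ψ, hψ⟩ := LinearMap.exists_extend g'
  let c : MonoidAlgebra k G := ∑ x : G, MonoidAlgebra.single x (ψ (MonoidAlgebra.single x⁻¹ 1))
  have hc : ∀ a, lam (a * c) = ψ a := by
    intro a
    induction a using MonoidAlgebra.induction_linear with
    | zero => simp
    | add a b ha hb => rw [add_mul, map_add, ha, hb, map_add]
    | single x r =>
      have : (MonoidAlgebra.single x r : MonoidAlgebra k G) = r • MonoidAlgebra.single x 1 := by simp
      rw [this, smul_mul_assoc, map_smul, map_smul]
      congr 1
      simp only [c, Finset.mul_sum, map_sum, MonoidAlgebra.single_mul_single, one_mul]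
      rw [Finset.sum_eq_single x⁻¹]
      · rw [mul_inv_cancel, inv_inv, hlam]; simp
      · intro b _ hb
        have : x * b ≠ 1 := fun h => hb (eq_inv_of_mul_eq_one_right h)
        rw [hlam]; simp [this]
      · simp
  refine ⟨LinearMap.toSpanSingleton _ _ c, fun a ha => ?_⟩
  rw [LinearMap.toSpanSingleton_apply, smul_eq_mul]
  -- compare all coefficients
  have key : ∀ b ∈ A, ∀ hb : b ∈ A, lam (b * c) = lam (g ⟨b, hb⟩) := by
    intro b _ hb
    rw [hc]
    exact LinearMap.congr_fun hψ ⟨b, hb⟩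
  ext x
  have hx := A.mul_mem_left (MonoidAlgebra.single x⁻¹ (1:k)) ha
  have h1 := key _ hx hx
  have h2 : g ⟨MonoidAlgebra.single x⁻¹ (1:k) * a, hx⟩ = MonoidAlgebra.single x⁻¹ (1:k) * g ⟨a, ha⟩ := by
    exact g.map_smul (MonoidAlgebra.single x⁻¹ (1:k)) ⟨a, ha⟩
  rw [h2, mul_assoc, hlam, hlam] at h1
  simpa [MonoidAlgebra.coeff_single_mul_apply] using h1

variable (p : ℕ) (hp : p.Prime) [CharP k p]

abbrev RR := MonoidAlgebra k (Multiplicative (ZMod p × ZMod p))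
noncomputable abbrev yy : RR k p := MonoidAlgebra.single (Multiplicative.ofAdd ((1 : ZMod p), (0 : ZMod p))) (1 : k) - 1
noncomputable abbrev zz : RR k p := MonoidAlgebra.single (Multiplicative.ofAdd ((0 : ZMod p), (1 : ZMod p))) (1 : k) - 1

instance : CharP (RR k p) p := charP_of_injective_algebraMap (algebraMap k (RR k p)).injective p

include hp in
lemma yy_pow : yy k p ^ p = 0 := by
  have := Fact.mk hp
  rw [yy, sub_pow_char, MonoidAlgebra.single_pow, one_pow, one_pow, ← ofAdd_nsmul]
  simp [MonoidAlgebra.one_def, ← Prod.zero_eq_mk]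

include hp in
lemma zz_pow : zz k p ^ p = 0 := by
  have := Fact.mk hp
  rw [zz, sub_pow_char, MonoidAlgebra.single_pow, one_pow, one_pow, ← ofAdd_nsmul]
  simp [MonoidAlgebra.one_def, ← Prod.zero_eq_mk]

noncomputable def mon (i : Fin p × Fin p) : RR k p := yy k p ^ (i.1 : ℕ) * zz k p ^ (i.2 : ℕ)

include hp in
lemma span_mon : ⊤ ≤ Submodule.span k (Set.range (mon k p)) := by
  have := Fact.mk hp
  have hm : ∀ a b : ℕ, yy k p ^ a * zz k p ^ b ∈ Submodule.span k (Set.range (mon k p)) := by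
    intro a b
    by_cases ha : a < p
    · by_cases hb : b < p
      · exact Submodule.subset_span ⟨(⟨a, ha⟩, ⟨b, hb⟩), rfl⟩
      · rw [pow_eq_zero_of_le (not_lt.1 hb) (zz_pow k p hp), mul_zero]; exact zero_mem _
    · rw [pow_eq_zero_of_le (not_lt.1 ha) (yy_pow k p hp), zero_mul]; exact zero_mem _
  rintro v -
  induction v using MonoidAlgebra.induction_linear with
  | zero => exact zero_mem _
  | add a b ha hb => exact add_mem ha hb
  | single x r =>
    have : (MonoidAlgebra.single x r : RR k p) = r • ((yy k p + 1) ^ (x.toAdd.1.val) * (zz k p + 1) ^ (x.toAdd.2.val)) := by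
      rw [yy, zz, sub_add_cancel, sub_add_cancel, MonoidAlgebra.single_pow, MonoidAlgebra.single_pow,
        MonoidAlgebra.single_mul_single, ← ofAdd_nsmul, ← ofAdd_nsmul, ← ofAdd_add]
      simp
    rw [this]
    refine Submodule.smul_mem _ _ ?_
    rw [add_pow, add_pow, Finset.sum_mul_sum]
    refine Submodule.sum_mem _ fun i _ => Submodule.sum_mem _ fun j _ => ?_
    have h := Submodule.smul_mem _ (((x.toAdd.1.val.choose i : ℕ) * (x.toAdd.2.val.choose j : ℕ) : ℕ) : k) (hm i j)
    convert h using 1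
    rw [Nat.cast_smul_eq_nsmul, nsmul_eq_mul]
    push_cast
    ring

include hp in
lemma li_mon : LinearIndependent k (mon k p) := by
  have := Fact.mk hp
  apply linearIndependent_of_top_le_span_of_card_eq_finrank (span_mon k p hp)
  rw [Module.finrank_eq_card_basis (MonoidAlgebra.basis _ k)]
  simp [Fintype.card_prod, ZMod.card]

include hp in
lemma coeffs (v : RR k p) : ∃ c : Fin p × Fin p → k, v = ∑ i, c i • mon k p i := by
  have := span_mon k p hp (Submodule.mem_top (x := v))
  rw [Submodule.mem_span_range_iff_exists_fun] at this
  obtain ⟨c, hc⟩ := this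
  exact ⟨c, hc.symm⟩

include hp in
lemma li_shift (s t : ℕ) (c : Fin p × Fin p → k)
    (h : ∑ i, c i • (yy k p ^ s * zz k p ^ t * mon k p i) = 0) (i : Fin p × Fin p)
    (h1 : i.1 + s < p) (h2 : i.2 + t < p) : c i = 0 := by
  classical
  let S := Finset.univ.filter (fun i : Fin p × Fin p => i.1 + s < p ∧ i.2 + t < p)
  let e : S → Fin p × Fin p := fun i => (⟨i.1.1 + s, (Finset.mem_filter.1 i.2).2.1⟩, ⟨i.1.2 + t, (Finset.mem_filter.1 i.2).2.2⟩)
  have hinj : Function.Injective e := by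
    rintro ⟨⟨a, b⟩, h⟩ ⟨⟨a', b'⟩, h'⟩ hh
    simp only [e, Prod.mk.injEq, Fin.mk.injEq] at hh
    simp only [Subtype.mk.injEq, Prod.mk.injEq, Fin.ext_iff]
    omega
  have hli := (li_mon k p hp).comp e hinj
  rw [Fintype.linearIndependent_iff] at hli
  refine hli (fun i => c i.1) ?_ ⟨i, Finset.mem_filter.2 ⟨Finset.mem_univ _, h1, h2⟩⟩
  rw [← h, ← Finset.sum_subset (Finset.subset_univ S), ← Finset.sum_coe_sort S]
  · refine Finset.sum_congr rfl fun i _ => ?_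
    congr 1
    simp only [Function.comp, mon, e]
    ring
  · intro i _ hi
    have hi' : p ≤ s + i.1 ∨ p ≤ t + i.2 := by
      by_contra hcon
      push Not at hcon
      exact hi (Finset.mem_filter.2 ⟨Finset.mem_univ _, by omega, by omega⟩)
    have : yy k p ^ s * zz k p ^ t * mon k p i = yy k p ^ (s + i.1) * zz k p ^ (t + i.2) := by
      simp only [mon]; ring
    rw [this]
    rcases hi' with h | h
    · rw [pow_eq_zero_of_le h (yy_pow k p hp)]; simp
    · rw [pow_eq_zero_of_le h (zz_pow k p hp)]; simp

include hp in
lemma ann (s t : ℕ) (hs : s ≤ p) (ht : t ≤ p) (v : RR k p) (h1 : yy k p ^ s * v = 0) (h2 : zz k p ^ t * v = 0) :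
    ∃ x, v = yy k p ^ (p - s) * zz k p ^ (p - t) * x := by
  obtain ⟨c, rfl⟩ := coeffs k p hp v
  have c1 : ∀ i : Fin p × Fin p, i.1 + s < p → c i = 0 := by
    intro i hi
    refine li_shift k p hp s 0 c ?_ i hi (by simp)
    rw [← h1, Finset.mul_sum]
    simp
  have c2 : ∀ i : Fin p × Fin p, i.2 + t < p → c i = 0 := by
    intro i hi
    refine li_shift k p hp 0 t c ?_ i (by simp) hi
    rw [← h2, Finset.mul_sum]
    simp
  refine ⟨∑ i, c i • (yy k p ^ (i.1 - (p - s)) * zz k p ^ (i.2 - (p - t))), ?_⟩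
  rw [Finset.mul_sum]
  refine Finset.sum_congr rfl fun i _ => ?_
  by_cases h : c i = 0
  · simp [h]
  have h3 := mt (c1 i) h
  have h4 := mt (c2 i) h
  rw [mul_smul_comm]
  congr 1
  rw [mul_mul_mul_comm, ← pow_add, ← pow_add, mon]
  congr 2 <;> omega

include hp in
lemma top_ne : yy k p ^ (p-1) * zz k p ^ (p-1) ≠ 0 := by
  have := hp.two_le
  have h := (li_mon k p hp).ne_zero (⟨p-1, by omega⟩, ⟨p-1, by omega⟩)
  unfold mon at h
  exact h

include hp in
lemma artin : IsArtinianRing (RR k p) := by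
  have := Fact.mk hp
  have : Module.Finite k (RR k p) := Module.Finite.of_basis (MonoidAlgebra.basis _ k)
  exact IsArtinianRing.of_finite k _
end grp
end ZP

set_option synthInstance.maxHeartbeats 1000000 in
/-- Let `G = ⟨y, z⟩` be elementary abelian of order `p²`, `H = ⟨y⟩`.
Under the identification `N(P_*, n) ≅ Ω^{-2n}(k)` (Statement 11), the map
`k → N(P_*, n)` sending `1` to `Z^{p-1}·u_0` represents the class
`ζ^n ∈ H^{2n}(G, k)`, where `ζ ∈ H²(G, k)` is the inflation to `G` of the
degree-two polynomial generator of `H*(H, k)`.  The class `ζ^n` is represented by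
the `n`-fold Yoneda splice of the `2`-extension
`0 → k → kG/(Z) →^{·Y} kG/(Z) → k → 0` (with `k → kG/(Z)` sending `1 ↦ Y^{p-1}`,
which represents `ζ`), and "represents" means: there is a chain map (ladder) from
this spliced `2n`-extension to the minimal injective resolution
`0 → k → I_0 → ⋯ → I_{2n-1} → Ω^{-2n}(k) → 0` extending the identity of `k`, whose
right-hand end equals `e ∘ μ_n` up to a map factoring through `I_{2n-1}`. -/
theorem map_to_N_represents_zeta_pow_n
    (k : Type) [Field k] (p : ℕ) (hp : p.Prime) [CharP k p]
    (m : ℕ)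
    (Y Z : MonoidAlgebra k (Multiplicative (ZMod p × ZMod p)))
    (hY : Y = MonoidAlgebra.single (Multiplicative.ofAdd ((1 : ZMod p), (0 : ZMod p))) (1 : k) - 1)
    (hZ : Z = MonoidAlgebra.single (Multiplicative.ofAdd ((0 : ZMod p), (1 : ZMod p))) (1 : k) - 1)
    (T : Type) [AddCommGroup T] [Module k T]
    [Module (MonoidAlgebra k (Multiplicative (ZMod p × ZMod p))) T]
    [IsScalarTower k (MonoidAlgebra k (Multiplicative (ZMod p × ZMod p))) T]
    (e0 : T ≃ₗ[k] k)
    (htriv : ∀ (g : Multiplicative (ZMod p × ZMod p)) (t : T),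
      (MonoidAlgebra.single g (1 : k) : MonoidAlgebra k (Multiplicative (ZMod p × ZMod p))) • t = t)
    (u : T) (hu : ∀ t : T, ∃ c : k, t = c • u)
    (I : ℕ → Type) [∀ j, AddCommGroup (I j)]
    [∀ j, Module (MonoidAlgebra k (Multiplicative (ZMod p × ZMod p))) (I j)]
    (hIfree : ∀ j, Nonempty
      (I j ≃ₗ[MonoidAlgebra k (Multiplicative (ZMod p × ZMod p))]
        (Fin (j + 1) → MonoidAlgebra k (Multiplicative (ZMod p × ZMod p)))))
    (f0 : T →ₗ[MonoidAlgebra k (Multiplicative (ZMod p × ZMod p))] I 0)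
    (hinj : Function.Injective f0)
    (dI : ∀ j, I j →ₗ[MonoidAlgebra k (Multiplicative (ZMod p × ZMod p))] I (j + 1))
    (hex0 : LinearMap.range f0 = LinearMap.ker (dI 0))
    (hex : ∀ j, j < 2 * m → LinearMap.range (dI j) = LinearMap.ker (dI (j + 1)))
    (W : Type) [AddCommGroup W]
    [Module (MonoidAlgebra k (Multiplicative (ZMod p × ZMod p))) W]
    (π : I (2 * m + 1) →ₗ[MonoidAlgebra k (Multiplicative (ZMod p × ZMod p))] W)
    (hsurjW : Function.Surjective π)
    (hker : LinearMap.ker π = LinearMap.range (dI (2 * m)))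
    -- `N = N(P_*, n)` as a presented module, and `μ_n : k → N`, `u ↦ Z^{p-1}·u_0`
    (μn : T →ₗ[MonoidAlgebra k (Multiplicative (ZMod p × ZMod p))]
      ((Fin (2 * m + 2) → MonoidAlgebra k (Multiplicative (ZMod p × ZMod p))) ⧸
        Submodule.span (MonoidAlgebra k (Multiplicative (ZMod p × ZMod p)))
          (({v : Fin (2 * m + 2) → MonoidAlgebra k (Multiplicative (ZMod p × ZMod p)) |
              ∃ (j : ℕ) (h : 2 * j + 1 < 2 * m + 2),
              v = Y • (Pi.single (⟨2 * j, by omega⟩ : Fin (2 * m + 2))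
                    (1 : MonoidAlgebra k (Multiplicative (ZMod p × ZMod p))) :
                    Fin (2 * m + 2) → MonoidAlgebra k (Multiplicative (ZMod p × ZMod p))) +
                  Z • (Pi.single (⟨2 * j + 1, h⟩ : Fin (2 * m + 2))
                    (1 : MonoidAlgebra k (Multiplicative (ZMod p × ZMod p))) :
                    Fin (2 * m + 2) → MonoidAlgebra k (Multiplicative (ZMod p × ZMod p)))} ∪
            {v : Fin (2 * m + 2) → MonoidAlgebra k (Multiplicative (ZMod p × ZMod p)) |
              ∃ (j : ℕ) (h : 2 * j + 2 < 2 * m + 2),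
              v = Y ^ (p - 1) • (Pi.single (⟨2 * j + 1, by omega⟩ : Fin (2 * m + 2))
                    (1 : MonoidAlgebra k (Multiplicative (ZMod p × ZMod p))) :
                    Fin (2 * m + 2) → MonoidAlgebra k (Multiplicative (ZMod p × ZMod p))) +
                  Z ^ (p - 1) • (Pi.single (⟨2 * j + 2, h⟩ : Fin (2 * m + 2))
                    (1 : MonoidAlgebra k (Multiplicative (ZMod p × ZMod p))) :
                    Fin (2 * m + 2) → MonoidAlgebra k (Multiplicative (ZMod p × ZMod p)))}) :
            Set (Fin (2 * m + 2) → MonoidAlgebra k (Multiplicative (ZMod p × ZMod p))))))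
    (hμn : μn u = Z ^ (p - 1) • Submodule.Quotient.mk
      ((Pi.single (⟨0, by omega⟩ : Fin (2 * m + 2))
        (1 : MonoidAlgebra k (Multiplicative (ZMod p × ZMod p))) :
        Fin (2 * m + 2) → MonoidAlgebra k (Multiplicative (ZMod p × ZMod p)))))
    -- the `2`-extension `0 → k → kG/(Z) → kG/(Z) → k → 0` representing `ζ`
    (ιE : T →ₗ[MonoidAlgebra k (Multiplicative (ZMod p × ZMod p))]
      (MonoidAlgebra k (Multiplicative (ZMod p × ZMod p)) ⧸
        Submodule.span (MonoidAlgebra k (Multiplicative (ZMod p × ZMod p)))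
          ({Z} : Set (MonoidAlgebra k (Multiplicative (ZMod p × ZMod p))))))
    (hιE : ιE u = Submodule.Quotient.mk (Y ^ (p - 1)))
    (mY : (MonoidAlgebra k (Multiplicative (ZMod p × ZMod p)) ⧸
        Submodule.span (MonoidAlgebra k (Multiplicative (ZMod p × ZMod p)))
          ({Z} : Set (MonoidAlgebra k (Multiplicative (ZMod p × ZMod p)))))
      →ₗ[MonoidAlgebra k (Multiplicative (ZMod p × ZMod p))]
      (MonoidAlgebra k (Multiplicative (ZMod p × ZMod p)) ⧸
        Submodule.span (MonoidAlgebra k (Multiplicative (ZMod p × ZMod p)))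
          ({Z} : Set (MonoidAlgebra k (Multiplicative (ZMod p × ZMod p))))))
    (hmY : ∀ a : MonoidAlgebra k (Multiplicative (ZMod p × ZMod p)),
      mY (Submodule.Quotient.mk a) = Submodule.Quotient.mk (Y * a))
    (εE : (MonoidAlgebra k (Multiplicative (ZMod p × ZMod p)) ⧸
        Submodule.span (MonoidAlgebra k (Multiplicative (ZMod p × ZMod p)))
          ({Z} : Set (MonoidAlgebra k (Multiplicative (ZMod p × ZMod p)))))
      →ₗ[MonoidAlgebra k (Multiplicative (ZMod p × ZMod p))] T)
    (hεE : εE (Submodule.Quotient.mk 1) = u) :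
    -- under the identification `e : N ≅ Ω^{-2n}(k)`, `μ_n` represents `ζ^n`:
    ∃ e : ((Fin (2 * m + 2) → MonoidAlgebra k (Multiplicative (ZMod p × ZMod p))) ⧸
        Submodule.span (MonoidAlgebra k (Multiplicative (ZMod p × ZMod p)))
          (({v : Fin (2 * m + 2) → MonoidAlgebra k (Multiplicative (ZMod p × ZMod p)) |
              ∃ (j : ℕ) (h : 2 * j + 1 < 2 * m + 2),
              v = Y • (Pi.single (⟨2 * j, by omega⟩ : Fin (2 * m + 2))
                    (1 : MonoidAlgebra k (Multiplicative (ZMod p × ZMod p))) :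
                    Fin (2 * m + 2) → MonoidAlgebra k (Multiplicative (ZMod p × ZMod p))) +
                  Z • (Pi.single (⟨2 * j + 1, h⟩ : Fin (2 * m + 2))
                    (1 : MonoidAlgebra k (Multiplicative (ZMod p × ZMod p))) :
                    Fin (2 * m + 2) → MonoidAlgebra k (Multiplicative (ZMod p × ZMod p)))} ∪
            {v : Fin (2 * m + 2) → MonoidAlgebra k (Multiplicative (ZMod p × ZMod p)) |
              ∃ (j : ℕ) (h : 2 * j + 2 < 2 * m + 2),
              v = Y ^ (p - 1) • (Pi.single (⟨2 * j + 1, by omega⟩ : Fin (2 * m + 2))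
                    (1 : MonoidAlgebra k (Multiplicative (ZMod p × ZMod p))) :
                    Fin (2 * m + 2) → MonoidAlgebra k (Multiplicative (ZMod p × ZMod p))) +
                  Z ^ (p - 1) • (Pi.single (⟨2 * j + 2, h⟩ : Fin (2 * m + 2))
                    (1 : MonoidAlgebra k (Multiplicative (ZMod p × ZMod p))) :
                    Fin (2 * m + 2) → MonoidAlgebra k (Multiplicative (ZMod p × ZMod p)))}) :
            Set (Fin (2 * m + 2) → MonoidAlgebra k (Multiplicative (ZMod p × ZMod p)))))
      →ₗ[MonoidAlgebra k (Multiplicative (ZMod p × ZMod p))] W,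
      Function.Bijective e ∧ ∃ f : (j : ℕ) → j < 2 * m + 2 →
        ((MonoidAlgebra k (Multiplicative (ZMod p × ZMod p)) ⧸
          Submodule.span (MonoidAlgebra k (Multiplicative (ZMod p × ZMod p)))
            ({Z} : Set (MonoidAlgebra k (Multiplicative (ZMod p × ZMod p)))))
          →ₗ[MonoidAlgebra k (Multiplicative (ZMod p × ZMod p))] I j),
      ((f 0 (by omega)) ∘ₗ ιE = f0) ∧
      (∀ (j : ℕ) (hj : j + 1 < 2 * m + 2),
        (dI j) ∘ₗ (f j (by omega)) =
          (f (j + 1) hj) ∘ₗ (if j % 2 = 0 then mY else ιE ∘ₗ εE)) ∧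
      ∃ hcorr : T →ₗ[MonoidAlgebra k (Multiplicative (ZMod p × ZMod p))] I (2 * m + 1),
        π ∘ₗ (f (2 * m + 1) (by omega)) =
          ((e ∘ₗ μn) + π ∘ₗ hcorr) ∘ₗ εE := by
  subst hY hZ
  have := Fact.mk hp
  have h1 := ZP.injective_groupAlgebra k (Multiplicative (ZMod p × ZMod p))
  have h2 := ZP.artin k p hp
  refine ZP.main p hp.two_le (ZP.yy k p) (ZP.zz k p) (ZP.yy_pow k p hp) (ZP.zz_pow k p hp) (ZP.ann k p hp) m T u
    ?_ I hIfree f0 hinj dI hex0 hex W π hsurjW hker μn hμn ιE hιE mY hmY εE hεE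
  intro t
  obtain ⟨c, rfl⟩ := hu t
  refine ⟨algebraMap k _ c, (algebraMap_smul _ c u).symm, fun h => ?_⟩
  rw [← Algebra.smul_def, smul_eq_zero] at h
  rcases h with h | h
  · rw [h, map_zero]
  · exact absurd h (ZP.top_ne k p hp)
end
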